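/- Let 5/3 < q < 5/2 and 5/3 < p < 5/2, and let Γ(t) = (t, γ(t)) be the plane curve associated with γ. Then there is a constant C_{p,q} such that for every f ∈ C_c^∞(ℝ²) ⊗ ℓ^q, the Hilbert transform along Γ, ℋf(x) = p.v. ∫_ℝ f(x − Γ(t)) dt/t, exists and satisfies ‖ℋf‖_{L^p(ℝ²; ℓ^q)} ≤ C_{p,q} ‖f‖_{L^p(ℝ²; ℓ^q)}; hence ℋ extends to a bounded operator on the Bochner space L^p(ℝ²; ℓ^q). -/

import Mathlib

open MeasureTheory Topology Filter

namespace ConvexCurve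

open ProbabilityTheory
open scoped ENNReal

/-- The plane, as the product `ℝ × ℝ`. -/
abbrev Plane := ℝ × ℝ

/-- Measurable functions that are bounded on bounded sets. -/
structure LocBdd (f : Plane → ℝ) : Prop where
  meas : Measurable f
  bdd : ∀ R : ℝ, ∃ C : ℝ, ∀ x, ‖x‖ ≤ R → |f x| ≤ C

namespace LocBdd

variable {f g : Plane → ℝ}

lemma of_bdd (hf : Measurable f) {C : ℝ} (h : ∀ x, |f x| ≤ C) : LocBdd f :=
  ⟨hf, fun _ => ⟨C, fun x _ => h x⟩⟩

lemma const (c : ℝ) : LocBdd (fun _ => c) := of_bdd measurable_const (fun _ => le_refl |c|)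

lemma add (hf : LocBdd f) (hg : LocBdd g) : LocBdd (fun x => f x + g x) := by
  refine ⟨hf.meas.add hg.meas, fun R => ?_⟩
  obtain ⟨C, hC⟩ := hf.bdd R
  obtain ⟨D, hD⟩ := hg.bdd R
  exact ⟨C + D, fun x hx => (abs_add_le _ _).trans (add_le_add (hC x hx) (hD x hx))⟩

lemma mul (hf : LocBdd f) (hg : LocBdd g) : LocBdd (fun x => f x * g x) := by
  refine ⟨hf.meas.mul hg.meas, fun R => ?_⟩
  obtain ⟨C, hC⟩ := hf.bdd R
  obtain ⟨D, hD⟩ := hg.bdd R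
  refine ⟨C * D, fun x hx => ?_⟩
  rw [abs_mul]
  exact mul_le_mul (hC x hx) (hD x hx) (abs_nonneg _) ((abs_nonneg _).trans (hC x hx))

lemma const_mul (c : ℝ) (hf : LocBdd f) : LocBdd (fun x => c * f x) := (const c).mul hf

lemma neg (hf : LocBdd f) : LocBdd (fun x => -f x) := by
  simpa using hf.const_mul (-1)

lemma sub (hf : LocBdd f) (hg : LocBdd g) : LocBdd (fun x => f x - g x) := by
  simpa [sub_eq_add_neg] using hf.add hg.neg

lemma sq (hf : LocBdd f) : LocBdd (fun x => f x ^ 2) := by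
  simpa [pow_two] using hf.mul hf

/-- A measurable function dominated by a locally bounded one is locally bounded. -/
lemma mono (hg : LocBdd g) (hf : Measurable f) (h : ∀ x, |f x| ≤ g x) : LocBdd f := by
  refine ⟨hf, fun R => ?_⟩
  obtain ⟨C, hC⟩ := hg.bdd R
  exact ⟨C, fun x hx => (h x).trans ((le_abs_self _).trans (hC x hx))⟩

end LocBdd

/-- Bounded measurable functions with bounded support. -/
def testFunctions : Submodule ℝ (Plane → ℝ) where
  carrier := {f | Measurable f ∧ ∃ R : ℝ, ∀ x, |f x| ≤ R ∧ (R < ‖x‖ → f x = 0)}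
  zero_mem' := ⟨measurable_const, 0, fun x => by simp⟩
  add_mem' := by
    rintro f g ⟨hf, R, hR⟩ ⟨hg, S, hS⟩
    have hR0 : 0 ≤ R := (abs_nonneg _).trans (hR 0).1
    have hS0 : 0 ≤ S := (abs_nonneg _).trans (hS 0).1
    refine ⟨hf.add hg, R + S, fun x => ⟨(abs_add_le _ _).trans (add_le_add (hR x).1 (hS x).1),
      fun hx => ?_⟩⟩
    simp [(hR x).2 (by linarith), (hS x).2 (by linarith)]
  smul_mem' := by
    rintro c f ⟨hf, R, hR⟩
    have hR0 : 0 ≤ R := (abs_nonneg _).trans (hR 0).1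
    refine ⟨hf.const_smul c, R + |c| * R, fun x => ⟨?_, fun hx => ?_⟩⟩
    · have := mul_le_mul_of_nonneg_left (hR x).1 (abs_nonneg c)
      simp only [Pi.smul_apply, smul_eq_mul, abs_mul]
      linarith
    · have : R < ‖x‖ := by have := mul_nonneg (abs_nonneg c) hR0; linarith
      simp [(hR x).2 this]

/-- The space of test functions. -/
abbrev TestFn : Type := testFunctions

instance : CoeFun TestFn (fun _ => Plane → ℝ) := ⟨Subtype.val⟩

namespace TestFn

lemma measurable (f : TestFn) : Measurable (f : Plane → ℝ) := f.2.1

lemma locBdd (f : TestFn) : LocBdd (f : Plane → ℝ) := by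
  obtain ⟨hf, R, hR⟩ := f.2
  exact LocBdd.of_bdd hf fun x => (hR x).1

lemma mul_mem {f g : Plane → ℝ} (hf : f ∈ testFunctions) (hg : LocBdd g) :
    (fun x => f x * g x) ∈ testFunctions := by
  obtain ⟨hf, R, hR⟩ := hf
  obtain ⟨C, hC⟩ := hg.bdd R
  have hR0 : 0 ≤ R := (abs_nonneg _).trans (hR 0).1
  refine ⟨hf.mul hg.meas, max R (R * C), fun x => ⟨?_, fun hx => ?_⟩⟩
  · by_cases hx : ‖x‖ ≤ R
    · rw [abs_mul]
      exact (mul_le_mul (hR x).1 (hC x hx) (abs_nonneg _) hR0).trans (le_max_right _ _)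
    · simp [(hR x).2 (not_le.1 hx), hR0]
  · simp [(hR x).2 ((le_max_left _ _).trans_lt hx)]

/-- Multiplication of a test function by a locally bounded function. -/
def mul (f : TestFn) {g : Plane → ℝ} (hg : LocBdd g) : TestFn := ⟨_, mul_mem f.2 hg⟩

@[simp] lemma mul_apply (f : TestFn) {g : Plane → ℝ} (hg : LocBdd g) (x : Plane) :
    (f.mul hg : Plane → ℝ) x = f x * g x := rfl

@[simp] lemma add_apply (f g : TestFn) (x : Plane) :
    ((f + g : TestFn) : Plane → ℝ) x = f x + g x := rfl

@[simp] lemma sub_apply (f g : TestFn) (x : Plane) :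
    ((f - g : TestFn) : Plane → ℝ) x = f x - g x := rfl

@[simp] lemma smul_apply (c : ℝ) (f : TestFn) (x : Plane) :
    ((c • f : TestFn) : Plane → ℝ) x = c * f x := rfl

@[simp] lemma zero_apply (x : Plane) : ((0 : TestFn) : Plane → ℝ) x = 0 := rfl

lemma sum_apply {ι : Type*} (s : Finset ι) (f : ι → TestFn) (x : Plane) :
    ((∑ i ∈ s, f i : TestFn) : Plane → ℝ) x = ∑ i ∈ s, f i x := by
  simp

lemma integrable_of_mem {f : Plane → ℝ} (hf : f ∈ testFunctions) : Integrable f := by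
  obtain ⟨hf, R, hR⟩ := hf
  have h : IntegrableOn f (Metric.closedBall 0 R) :=
    Measure.integrableOn_of_bounded (M := R) measure_closedBall_lt_top.ne
      hf.aestronglyMeasurable (ae_of_all _ fun x => by simpa using (hR x).1)
  refine (integrableOn_iff_integrable_of_support_subset fun x hx => ?_).1 h
  by_contra hx'
  exact hx ((hR x).2 (by simpa using hx'))

lemma integrable (f : TestFn) : Integrable (f : Plane → ℝ) := integrable_of_mem f.2

lemma integrable_mul (f : TestFn) {g : Plane → ℝ} (hg : LocBdd g) :
    Integrable (fun x => f x * g x) := (f.mul hg).integrable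

end TestFn

/-- An averaging operator given by a sub-Markov kernel of bounded range, together with
its adjoint with respect to Lebesgue measure. -/
structure Avg where
  ker : Kernel Plane Plane
  adj : Kernel Plane Plane
  rad : ℝ
  ker_mass : ∀ x, ker x Set.univ ≤ 1
  adj_mass : ∀ x, adj x Set.univ ≤ 1
  ker_rad : ∀ x, ∀ᵐ y ∂ker x, ‖y - x‖ ≤ rad
  adj_rad : ∀ x, ∀ᵐ y ∂adj x, ‖y - x‖ ≤ rad
  dual : ∀ F : Plane × Plane → ℝ≥0∞, Measurable F →
    ∫⁻ x, ∫⁻ y, F (x, y) ∂ker x = ∫⁻ y, ∫⁻ x, F (x, y) ∂adj y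

namespace Avg

/-- The adjoint averaging operator. -/
def symm (A : Avg) : Avg where
  ker := A.adj
  adj := A.ker
  rad := A.rad
  ker_mass := A.adj_mass
  adj_mass := A.ker_mass
  ker_rad := A.adj_rad
  adj_rad := A.ker_rad
  dual F hF := (A.dual (fun z => F z.swap) (hF.comp measurable_swap)).symm

instance (A : Avg) : IsFiniteKernel A.ker := ⟨⟨1, ENNReal.one_lt_top, A.ker_mass⟩⟩

/-- The action of an averaging operator on functions. -/
noncomputable def op (A : Avg) (f : Plane → ℝ) (x : Plane) : ℝ := ∫ y, f y ∂A.ker x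

variable (A : Avg) {f g : Plane → ℝ}

lemma measureReal_le (x : Plane) : (A.ker x).real Set.univ ≤ 1 := by
  simpa [Measure.real] using ENNReal.toReal_mono ENNReal.one_ne_top (A.ker_mass x)

lemma ae_bound (hf : LocBdd f) (R : ℝ) :
    ∃ C, 0 ≤ C ∧ ∀ x, ‖x‖ ≤ R → ∀ᵐ y ∂A.ker x, ‖f y‖ ≤ C := by
  obtain ⟨C, hC⟩ := hf.bdd (R + A.rad)
  refine ⟨max C 0, le_max_right _ _, fun x hx => ?_⟩
  filter_upwards [A.ker_rad x] with y hy
  refine (hC y ?_).trans (le_max_left _ _)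
  have := norm_add_le (y - x) x
  simp only [sub_add_cancel] at this
  linarith

lemma integrable (hf : LocBdd f) (x : Plane) : Integrable f (A.ker x) := by
  obtain ⟨C, -, hC⟩ := A.ae_bound hf ‖x‖
  exact Integrable.of_bound hf.meas.aestronglyMeasurable C (hC x le_rfl)

lemma op_locBdd (hf : LocBdd f) : LocBdd (A.op f) := by
  refine ⟨(hf.meas.stronglyMeasurable.comp_measurable measurable_snd).integral_kernel_prod_right'
    |>.measurable, fun R => ?_⟩
  obtain ⟨C, hC0, hC⟩ := A.ae_bound hf R
  refine ⟨C, fun x hx => ?_⟩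
  refine (norm_integral_le_of_norm_le_const (hC x hx)).trans ?_
  exact mul_le_of_le_one_right hC0 (A.measureReal_le x)

lemma op_mem (hf : f ∈ testFunctions) : A.op f ∈ testFunctions := by
  have hm := (A.op_locBdd (TestFn.locBdd ⟨f, hf⟩)).meas
  obtain ⟨hf, R, hR⟩ := hf
  have hR0 : 0 ≤ R := (abs_nonneg _).trans (hR 0).1
  refine ⟨hm, R + |A.rad|, fun x => ⟨?_, fun hx => ?_⟩⟩
  · refine (norm_integral_le_of_norm_le_const (f := f) (C := R)
      (ae_of_all _ fun y => (hR y).1)).trans ?_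
    have := mul_le_of_le_one_right hR0 (A.measureReal_le x)
    have := abs_nonneg A.rad
    linarith
  · refine integral_eq_zero_of_ae ?_
    filter_upwards [A.ker_rad x] with y hy
    refine (hR y).2 ?_
    have h1 := norm_sub_norm_le x y
    rw [norm_sub_rev] at h1
    have := le_abs_self A.rad
    linarith

/-- The action of an averaging operator on test functions. -/
noncomputable def lin : Module.End ℝ TestFn where
  toFun f := ⟨A.op f, A.op_mem f.2⟩
  map_add' f g := by
    ext x
    exact integral_add (A.integrable f.locBdd x) (A.integrable g.locBdd x)
  map_smul' c f := by
    ext x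
    exact integral_const_mul c _

@[simp] lemma lin_apply (f : TestFn) : (A.lin f : Plane → ℝ) = A.op f := rfl

lemma op_mono (hf : LocBdd f) (hg : LocBdd g) (h : ∀ x, f x ≤ g x) (x : Plane) :
    A.op f x ≤ A.op g x :=
  integral_mono (A.integrable hf x) (A.integrable hg x) h

lemma op_nonneg (h : ∀ x, 0 ≤ f x) (x : Plane) : 0 ≤ A.op f x := integral_nonneg h

lemma op_add (hf : LocBdd f) (hg : LocBdd g) (x : Plane) :
    A.op (fun y => f y + g y) x = A.op f x + A.op g x :=
  integral_add (A.integrable hf x) (A.integrable hg x)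

lemma op_sub (hf : LocBdd f) (hg : LocBdd g) (x : Plane) :
    A.op (fun y => f y - g y) x = A.op f x - A.op g x :=
  integral_sub (A.integrable hf x) (A.integrable hg x)

lemma op_const_mul (c : ℝ) (x : Plane) : A.op (fun y => c * f y) x = c * A.op f x :=
  integral_const_mul c _

lemma op_const_le {c : ℝ} (hc : 0 ≤ c) (x : Plane) : A.op (fun _ => c) x ≤ c := by
  simp only [op, integral_const, smul_eq_mul]
  exact mul_le_of_le_one_left hc (A.measureReal_le x)

lemma op_le_of_le (hf : LocBdd f) {c : ℝ} (hc : 0 ≤ c) (h : ∀ x, f x ≤ c) (x : Plane) :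
    A.op f x ≤ c :=
  (A.op_mono hf (LocBdd.const c) h x).trans (A.op_const_le hc x)

lemma integral_mul_op (f : TestFn) (hg : LocBdd g) :
    ∫ x, f x * A.op g x = ∫ x, A.symm.op f x * g x := by
  have : IsFiniteKernel A.adj := inferInstanceAs (IsFiniteKernel A.symm.ker)
  have hsw : (volume ⊗ₘ A.ker) = (volume ⊗ₘ A.adj).map Prod.swap := by
    refine Measure.ext_of_lintegral _ fun F hF => ?_
    rw [Measure.lintegral_compProd hF, lintegral_map hF measurable_swap, A.dual F hF]
    exact (Measure.lintegral_compProd (hF.comp measurable_swap)).symm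
  have hi_int : Integrable (fun z : Plane × Plane => f z.1 * g z.2)
      (volume ⊗ₘ A.ker) := by
    have hm : AEStronglyMeasurable (fun z : Plane × Plane => f z.1 * g z.2)
        (volume ⊗ₘ A.ker) :=
      ((f.measurable.comp measurable_fst).mul
        (hg.meas.comp measurable_snd)).aestronglyMeasurable
    rw [Measure.integrable_compProd_iff hm]
    refine ⟨ae_of_all _ fun x => (A.integrable hg x).const_mul (f x), ?_⟩
    have hg' : LocBdd (fun x => |g x|) :=
      ⟨hg.meas.abs, fun R => by simpa using hg.bdd R⟩
    have hf' : (fun x => |f x|) ∈ testFunctions := by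
      obtain ⟨hf, R, hR⟩ := f.2
      exact ⟨hf.abs, R, fun x => by simpa using hR x⟩
    refine (TestFn.integrable_of_mem (TestFn.mul_mem hf' (A.op_locBdd hg'))).congr
      (ae_of_all _ fun x => ?_)
    simp only [op, norm_mul, Real.norm_eq_abs]
    exact (integral_const_mul _ _).symm
  have h1 := Measure.integral_compProd hi_int
  have h2 := hi_int
  rw [hsw] at h2 h1
  rw [integral_map measurable_swap.aemeasurable h2.aestronglyMeasurable] at h1
  have h3 := h2.comp_measurable measurable_swap
  have h4 := Measure.integral_compProd h3
  simp only [Function.comp_def, Prod.fst_swap, Prod.snd_swap] at h4 h1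
  rw [h4] at h1
  simp only [integral_const_mul, integral_mul_const] at h1
  exact h1.symm

/-- Cauchy–Schwarz inequality for averaging operators. -/
lemma op_sq_le {v : Plane → ℝ} (hf : LocBdd f) (hv : LocBdd v)
    (hfv : LocBdd (fun x => f x ^ 2 / v x)) (hpos : ∀ x, 0 < v x) (x : Plane) :
    A.op f x ^ 2 ≤ A.op (fun y => f y ^ 2 / v y) x * A.op v x := by
  have key : ∀ t : ℝ, 0 ≤ A.op v x * (t * t) + (-2 * A.op f x) * t +
      A.op (fun y => f y ^ 2 / v y) x := by
    intro t
    have h0 : 0 ≤ A.op (fun y => (f y ^ 2 / v y + (-2 * t) * f y) + (t * t) * v y) x := by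
      refine A.op_nonneg (fun y => ?_) x
      have : f y ^ 2 / v y + (-2 * t) * f y + (t * t) * v y = (f y - t * v y) ^ 2 / v y := by
        field_simp [(hpos y).ne']
        ring
      rw [this]
      exact div_nonneg (sq_nonneg _) (hpos y).le
    rw [A.op_add (hfv.add (hf.const_mul _)) (hv.const_mul _),
      A.op_add hfv (hf.const_mul _), A.op_const_mul, A.op_const_mul] at h0
    linarith
  have := discrim_le_zero key
  rw [discrim] at this
  nlinarith

end Avg

/-- Positive functions that are locally bounded together with their inverse. -/
structure IsWeight (w : Plane → ℝ) : Prop where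
  pos : ∀ x, 0 < w x
  loc : LocBdd w
  loc_inv : LocBdd (fun x => (w x)⁻¹)

namespace IsWeight

variable {w v : Plane → ℝ}

lemma inv (hw : IsWeight w) : IsWeight (fun x => (w x)⁻¹) :=
  ⟨fun x => inv_pos.2 (hw.pos x), hw.loc_inv, by simpa using hw.loc⟩

lemma mul (hw : IsWeight w) (hv : IsWeight v) : IsWeight (fun x => w x * v x) :=
  ⟨fun x => mul_pos (hw.pos x) (hv.pos x), hw.loc.mul hv.loc, by
    simpa [mul_inv] using hv.loc_inv.mul hw.loc_inv⟩

lemma div (hw : IsWeight w) (hv : IsWeight v) : IsWeight (fun x => w x / v x) := by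
  simpa [div_eq_mul_inv] using hw.mul hv.inv

lemma one : IsWeight (fun _ => (1 : ℝ)) :=
  ⟨fun _ => one_pos, LocBdd.const _, LocBdd.const _⟩

lemma locBdd_rpow (hw : IsWeight w) {s : ℝ} (hs : 0 ≤ s) :
    LocBdd (fun x => w x ^ s) := by
  refine ⟨hw.loc.meas.pow_const s, fun R => ?_⟩
  obtain ⟨C, hC⟩ := hw.loc.bdd R
  refine ⟨C ^ s, fun x hx => ?_⟩
  rw [abs_of_nonneg (Real.rpow_nonneg (hw.pos x).le s)]
  exact Real.rpow_le_rpow (hw.pos x).le ((le_abs_self _).trans (hC x hx)) hs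

lemma rpow (hw : IsWeight w) (s : ℝ) : IsWeight (fun x => w x ^ s) := by
  have key : ∀ s : ℝ, LocBdd (fun x => w x ^ s) := by
    intro s
    rcases le_total 0 s with hs | hs
    · exact hw.locBdd_rpow hs
    · have := hw.inv.locBdd_rpow (neg_nonneg.2 hs)
      simpa only [Real.inv_rpow (hw.pos _).le, Real.rpow_neg (hw.pos _).le, inv_inv] using this
  refine ⟨fun x => Real.rpow_pos_of_pos (hw.pos x) s, key s, ?_⟩
  simpa only [Real.rpow_neg (hw.pos _).le] using key (-s)

end IsWeight

/-- The squared norm of a test function in a weighted `L²` space. -/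
noncomputable def wnorm (w : Plane → ℝ) (f : TestFn) : ℝ := ∫ x, f x ^ 2 * w x

namespace TestFn

lemma sq_mul_mem (f : TestFn) {w : Plane → ℝ} (hw : LocBdd w) :
    (fun x => f x ^ 2 * w x) ∈ testFunctions := by
  have := mul_mem f.2 (f.locBdd.mul hw)
  refine (congrArg (· ∈ testFunctions) (funext fun x => ?_)).mp this
  ring

lemma integrable_sq_mul (f : TestFn) {w : Plane → ℝ} (hw : LocBdd w) :
    Integrable (fun x => f x ^ 2 * w x) := integrable_of_mem (f.sq_mul_mem hw)

end TestFn

section wnorm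

variable {w v : Plane → ℝ}

lemma wnorm_nonneg (hw : ∀ x, 0 ≤ w x) (f : TestFn) : 0 ≤ wnorm w f :=
  integral_nonneg fun x => mul_nonneg (sq_nonneg _) (hw x)

lemma wnorm_smul (c : ℝ) (f : TestFn) : wnorm w (c • f) = c ^ 2 * wnorm w f := by
  rw [wnorm, wnorm, ← integral_const_mul]
  congr 1 with x
  simp only [TestFn.smul_apply]
  ring

lemma wnorm_add_le (hw : IsWeight w) (f g : TestFn) :
    wnorm w (f + g) ≤ 2 * wnorm w f + 2 * wnorm w g := by
  rw [wnorm, wnorm, wnorm, ← integral_const_mul, ← integral_const_mul,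
    ← integral_add ((f.integrable_sq_mul hw.loc).const_mul _)
      ((g.integrable_sq_mul hw.loc).const_mul _)]
  refine integral_mono (TestFn.integrable_sq_mul _ hw.loc)
    (((f.integrable_sq_mul hw.loc).const_mul _).add
      ((g.integrable_sq_mul hw.loc).const_mul _)) fun x => ?_
  simp only [TestFn.add_apply]
  nlinarith [mul_nonneg (sq_nonneg (f x - g x)) (hw.pos x).le]

lemma wnorm_neg (f : TestFn) : wnorm w (-f) = wnorm w f := by
  rw [← neg_one_smul ℝ f, wnorm_smul]
  norm_num

lemma wnorm_sub_le (hw : IsWeight w) (f g : TestFn) :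
    wnorm w (f - g) ≤ 2 * wnorm w f + 2 * wnorm w g := by
  rw [sub_eq_add_neg, ← wnorm_neg g]
  exact wnorm_add_le hw f (-g)

/-- The `L²` pairing of test functions. -/
noncomputable def pair : TestFn →ₗ[ℝ] TestFn →ₗ[ℝ] ℝ :=
  LinearMap.mk₂ ℝ (fun f g => ∫ x, f x * g x)
    (fun f g h => by
      rw [← integral_add (f.integrable_mul h.locBdd) (g.integrable_mul h.locBdd)]
      simp [add_mul])
    (fun c f g => by
      simp [mul_assoc, integral_const_mul])
    (fun f g h => by
      rw [← integral_add (f.integrable_mul g.locBdd) (f.integrable_mul h.locBdd)]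
      simp [mul_add])
    (fun c f g => by
      simp [mul_left_comm, integral_const_mul])

lemma pair_apply (f g : TestFn) : pair f g = ∫ x, f x * g x := rfl

lemma pair_comm (f g : TestFn) : pair f g = pair g f := by
  simp [pair_apply, mul_comm]

lemma pair_lin (A : Avg) (f g : TestFn) : pair f (A.lin g) = pair (A.symm.lin f) g :=
  A.integral_mul_op f g.locBdd

lemma pair_le (hw : IsWeight w) {a : ℝ} (ha : 0 < a) (f h : TestFn) :
    pair f h ≤ (a⁻¹ * wnorm w f + a * wnorm (fun x => (w x)⁻¹) h) / 2 := by
  rw [wnorm, wnorm, ← integral_const_mul, ← integral_const_mul,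
    ← integral_add ((f.integrable_sq_mul hw.loc).const_mul _)
      ((h.integrable_sq_mul hw.loc_inv).const_mul _), ← integral_div]
  refine integral_mono (f.integrable_mul h.locBdd)
    ((((f.integrable_sq_mul hw.loc).const_mul _).add
      ((h.integrable_sq_mul hw.loc_inv).const_mul _)).div_const _) fun x => ?_
  have hwx := hw.pos x
  have : 0 ≤ (f x * w x - a * h x) ^ 2 / (a * w x) := by positivity
  have e : (f x * w x - a * h x) ^ 2 / (a * w x) =
      a⁻¹ * (f x ^ 2 * w x) + a * (h x ^ 2 * (w x)⁻¹) - 2 * (f x * h x) := by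
    field_simp
    ring
  simp only
  linarith

/-- A bound for a weighted norm by duality. -/
lemma wnorm_le_of_pair (hw : IsWeight w) {g : TestFn} {S C : ℝ} (hC : 0 < C)
    (h : ∀ h, pair g h ≤ S + C * wnorm (fun x => (w x)⁻¹) h) :
    wnorm w g ≤ 4 * C * S := by
  have h1 := h ((2 * C)⁻¹ • g.mul hw.loc)
  have e1 : pair g (g.mul hw.loc) = wnorm w g := by
    rw [pair_apply, wnorm]
    congr 1 with x
    simp only [TestFn.mul_apply]
    ring
  have e2 : wnorm (fun x => (w x)⁻¹) (g.mul hw.loc) = wnorm w g := by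
    rw [wnorm, wnorm]
    congr 1 with x
    have := (hw.pos x).ne'
    simp only [TestFn.mul_apply]
    field_simp
  rw [wnorm_smul, map_smul, smul_eq_mul, e1, e2] at h1
  have h2 := mul_le_mul_of_nonneg_left h1 (by positivity : 0 ≤ 4 * C)
  have e3 : 4 * C * ((2 * C)⁻¹ * wnorm w g) = 2 * wnorm w g := by
    field_simp
    ring
  have e4 : 4 * C * (S + C * ((2 * C)⁻¹ ^ 2 * wnorm w g)) = 4 * C * S + wnorm w g := by
    field_simp
    ring
  linarith

end wnorm

/-- Muckenhoupt `A₁` weights relative to a family of averaging operators. -/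
structure IsA1 (𝒜 : Set Avg) (C : ℝ) (U : Plane → ℝ) : Prop where
  weight : IsWeight U
  le : ∀ A ∈ 𝒜, ∀ x, A.op U x ≤ C * U x

namespace IsA1

variable {𝒜 : Set Avg} {C : ℝ} {U V : Plane → ℝ}

lemma one (hC : 1 ≤ C) : IsA1 𝒜 C (fun _ => 1) :=
  ⟨IsWeight.one, fun A _ x => by
    simpa using (A.op_const_le zero_le_one x).trans hC⟩

lemma rpow_mul (hC : 1 ≤ C) (hU : IsA1 𝒜 C U) (hV : IsA1 𝒜 C V) {s t : ℝ} (hs : 0 ≤ s)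
    (ht : 0 ≤ t) (hst : s + t ≤ 1) : IsA1 𝒜 C (fun x => U x ^ s * V x ^ t) := by
  refine ⟨(hU.weight.rpow s).mul (hV.weight.rpow t), fun A hA x => ?_⟩
  have hu := hU.weight.pos x
  have hv := hV.weight.pos x
  set m := U x ^ s * V x ^ t with hm
  have hm0 : 0 < m := by positivity
  have hle : ∀ y, U y ^ s * V y ^ t ≤
      (m * s / U x) * U y + (m * t / V x) * V y + m * (1 - s - t) := by
    intro y
    have hu' := hU.weight.pos y
    have hv' := hV.weight.pos y
    have := Real.geom_mean_le_arith_mean3_weighted hs ht (by linarith : 0 ≤ 1 - s - t)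
      (p₁ := U y / U x) (p₂ := V y / V x) (p₃ := 1) (by positivity) (by positivity)
      zero_le_one (by ring)
    rw [Real.one_rpow, mul_one, Real.div_rpow hu'.le hu.le, Real.div_rpow hv'.le hv.le,
      div_mul_div_comm, ← hm, div_le_iff₀ hm0] at this
    refine this.trans (le_of_eq ?_)
    field_simp
  have h1 := A.op_mono ((hU.weight.rpow s).mul (hV.weight.rpow t)).loc
    (((hU.weight.loc.const_mul _).add (hV.weight.loc.const_mul _)).add (LocBdd.const _)) hle x
  rw [A.op_add ((hU.weight.loc.const_mul _).add (hV.weight.loc.const_mul _)) (LocBdd.const _),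
    A.op_add (hU.weight.loc.const_mul _) (hV.weight.loc.const_mul _), A.op_const_mul,
    A.op_const_mul] at h1
  have h2 := A.op_const_le (mul_nonneg hm0.le (by linarith : 0 ≤ 1 - s - t)) x
  have h3 := mul_le_mul_of_nonneg_left (hU.le A hA x) (by positivity : 0 ≤ m * s / U x)
  have h4 := mul_le_mul_of_nonneg_left (hV.le A hA x) (by positivity : 0 ≤ m * t / V x)
  have e3 : m * s / U x * (C * U x) = m * (s * C) := by field_simp
  have e4 : m * t / V x * (C * V x) = m * (t * C) := by field_simp
  rw [e3] at h3
  rw [e4] at h4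
  have h5 : m * (1 - s - t) ≤ m * ((1 - s - t) * C) :=
    mul_le_mul_of_nonneg_left (le_mul_of_one_le_right (by linarith) hC) hm0.le
  linarith

lemma rpow (hC : 1 ≤ C) (hU : IsA1 𝒜 C U) {s : ℝ} (hs : 0 ≤ s) (hs1 : s ≤ 1) :
    IsA1 𝒜 C (fun x => U x ^ s) := by
  simpa using hU.rpow_mul hC hU hs le_rfl (by simpa using hs1)

end IsA1

/-- Averaging operators are bounded on `L²(U / V)` when `U` and `V` are `A₁` weights. -/
lemma wnorm_lin_le {𝒜 : Set Avg} {C : ℝ} {U V : Plane → ℝ} (hC : 0 ≤ C) (hU : IsA1 𝒜 C U)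
    (hV : IsA1 𝒜 C V) {A : Avg} (hA : A ∈ 𝒜) (hA' : A.symm ∈ 𝒜) (f : TestFn) :
    wnorm (fun x => U x / V x) (A.lin f) ≤ C ^ 2 * wnorm (fun x => U x / V x) f := by
  have hfV : LocBdd (fun x => f x ^ 2 / V x) := by
    simpa [div_eq_mul_inv] using f.locBdd.sq.mul hV.weight.loc_inv
  have hfV' : (fun x => f x ^ 2 / V x) ∈ testFunctions := by
    simpa [div_eq_mul_inv] using f.sq_mul_mem hV.weight.loc_inv
  have h0 : ∀ x, 0 ≤ f x ^ 2 / V x := fun x => div_nonneg (sq_nonneg _) (hV.weight.pos x).le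
  let F : TestFn := ⟨_, hfV'⟩
  have hint1 : Integrable (fun x => U x * A.op (fun x => f x ^ 2 / V x) x) := by
    simpa [mul_comm] using (A.lin F).integrable_mul hU.weight.loc
  calc wnorm (fun x => U x / V x) (A.lin f)
      ≤ ∫ x, C * (U x * A.op (fun x => f x ^ 2 / V x) x) := by
        refine integral_mono ((A.lin f).integrable_sq_mul (hU.weight.div hV.weight).loc)
          (hint1.const_mul C) fun x => ?_
        have h1 := A.op_sq_le f.locBdd hV.weight.loc hfV hV.weight.pos x
        have h2 := hV.le A hA x
        have h3 := A.op_nonneg h0 x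
        have hu := hU.weight.pos x
        have hv := hV.weight.pos x
        simp only [Avg.lin_apply]
        calc A.op f x ^ 2 * (U x / V x)
            ≤ (A.op (fun x => f x ^ 2 / V x) x * (C * V x)) * (U x / V x) := by
              gcongr
              exact h1.trans (by gcongr)
          _ = _ := by field_simp
    _ = C * ∫ x, f x ^ 2 / V x * A.symm.op U x := by
        rw [integral_const_mul]
        have := A.symm.integral_mul_op F hU.weight.loc
        simp only [F] at this
        rw [this]
        simp only [mul_comm (U _)]
        rfl
    _ ≤ C * ∫ x, C * (f x ^ 2 * (U x / V x)) := by
        refine mul_le_mul_of_nonneg_left ?_ hC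
        refine integral_mono (F.integrable_mul (A.symm.op_locBdd hU.weight.loc))
          ((f.integrable_sq_mul (hU.weight.div hV.weight).loc).const_mul C) fun x => ?_
        refine (mul_le_mul_of_nonneg_left (hU.le _ hA' x) (h0 x)).trans (le_of_eq ?_)
        ring
    _ = _ := by rw [integral_const_mul, wnorm]; ring

/-- Averaging operators are contractions on `L²`. -/
lemma wnorm_one_lin_le (A : Avg) (f : TestFn) :
    wnorm (fun _ => 1) (A.lin f) ≤ wnorm (fun _ => 1) f := by
  have h1 : IsA1 Set.univ 1 (fun _ => (1 : ℝ)) := IsA1.one le_rfl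
  simpa using wnorm_lin_le zero_le_one h1 h1 (Set.mem_univ A) (Set.mem_univ _) f

/-- The normalising constant in the real interpolation of weights. -/
noncomputable def interpConst (β : ℝ) : ℝ≥0∞ :=
  ∫⁻ t in Set.Ioi (0 : ℝ), ENNReal.ofReal (t ^ (β - 1) * (1 / (t + 1)))

lemma interpConst_ne_zero (β : ℝ) : interpConst β ≠ 0 := by
  have hm : Measurable fun t : ℝ => ENNReal.ofReal (t ^ (β - 1) * (1 / (t + 1))) := by
    fun_prop
  rw [interpConst, Ne, lintegral_eq_zero_iff hm]
  intro h
  rw [Filter.EventuallyEq, ae_restrict_iff' measurableSet_Ioi] at h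
  have h2 : volume (Set.Ioi (0 : ℝ)) = 0 := by
    refine measure_mono_null (fun t ht => ?_) h
    simp only [Set.mem_compl_iff, Set.mem_ofPred_eq, Pi.zero_apply, ENNReal.ofReal_eq_zero,
      not_forall,
      not_le]
    have ht' : 0 < t := ht
    exact ⟨ht, by positivity⟩
  simp at h2

lemma interpConst_ne_top {β : ℝ} (h0 : 0 < β) (h1 : β < 1) : interpConst β ≠ ⊤ := by
  have hi : IntegrableOn (fun t : ℝ => t ^ (β - 1) * (1 / (t + 1))) (Set.Ioi 0) := by
    have hm : Measurable fun t : ℝ => t ^ (β - 1) * (1 / (t + 1)) := by fun_prop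
    rw [← Set.Ioc_union_Ioi_eq_Ioi zero_le_one]
    refine IntegrableOn.union ?_ ?_
    · have := (intervalIntegral.intervalIntegrable_rpow' (a := 0) (b := 1)
        (by linarith : -1 < β - 1))
      rw [intervalIntegrable_iff_integrableOn_Ioc_of_le zero_le_one] at this
      refine this.mono' hm.aestronglyMeasurable ?_
      filter_upwards [ae_restrict_mem measurableSet_Ioc] with t ht
      have ht0 : 0 < t := ht.1
      rw [Real.norm_of_nonneg (by positivity)]
      refine mul_le_of_le_one_right (by positivity) ?_
      rw [div_le_one (by positivity)]
      linarith
    · have := integrableOn_Ioi_rpow_of_lt (a := β - 2) (by linarith) (zero_lt_one' ℝ)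
      refine this.mono' hm.aestronglyMeasurable ?_
      filter_upwards [ae_restrict_mem measurableSet_Ioi] with t ht
      have ht0 : 0 < t := lt_trans zero_lt_one ht
      rw [Real.norm_of_nonneg (by positivity)]
      have : t ^ (β - 2) = t ^ (β - 1) * (1 / t) := by
        rw [show β - 2 = β - 1 - 1 by ring, Real.rpow_sub_one ht0.ne']
        ring
      rw [this]
      gcongr
      linarith
  exact hi.lintegral_lt_top.ne

lemma lintegral_interp {β a : ℝ} (ha : 0 < a) :
    ∫⁻ t in Set.Ioi (0 : ℝ), ENNReal.ofReal (t ^ (β - 1) * (a / (t + a))) =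
      ENNReal.ofReal (a ^ β) * interpConst β := by
  have hm : Measurable fun t : ℝ => ENNReal.ofReal (t ^ (β - 1) * (a / (t + a))) := by fun_prop
  have h1 : ENNReal.ofReal |a⁻¹| • (volume : Measure ℝ) = Measure.map (a * ·) volume :=
    (Real.map_volume_mul_left ha.ne').symm
  have h2 : ∫⁻ t in Set.Ioi (0 : ℝ), ENNReal.ofReal (t ^ (β - 1) * (a / (t + a))) =
      ENNReal.ofReal a * ∫⁻ t in Set.Ioi (0 : ℝ),
        ENNReal.ofReal ((a * t) ^ (β - 1) * (a / (a * t + a))) := by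
    have hv : (volume : Measure ℝ) = ENNReal.ofReal a • Measure.map (a * ·) volume := by
      rw [← h1, smul_smul, abs_of_pos (inv_pos.2 ha), ← ENNReal.ofReal_mul ha.le,
        mul_inv_cancel₀ ha.ne']
      simp
    conv_lhs => rw [hv]
    rw [Measure.restrict_smul, lintegral_smul_measure, smul_eq_mul,
      Measure.restrict_map (measurable_const_mul a) measurableSet_Ioi,
      lintegral_map hm (measurable_const_mul a)]
    congr 3
    ext t
    simp [ha]
  rw [h2, interpConst, ← lintegral_const_mul _ (by fun_prop), ← lintegral_const_mul _ (by fun_prop)]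
  refine setLIntegral_congr_fun measurableSet_Ioi fun t ht => ?_
  have ht0 : 0 < t := ht
  rw [← ENNReal.ofReal_mul ha.le, ← ENNReal.ofReal_mul (by positivity)]
  congr 1
  rw [Real.mul_rpow ha.le ht0.le, Real.rpow_sub_one ha.ne']
  field_simp

lemma wnorm_split_le {w : Plane → ℝ} (hw : IsWeight w) {T : Module.End ℝ TestFn} {M₀ M₁ : ℝ}
    (hM₀ : 0 < M₀) (hM₁ : 0 < M₁) (h₀ : ∀ f, wnorm (fun _ => 1) (T f) ≤ M₀ * wnorm (fun _ => 1) f)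
    (h₁ : ∀ f, wnorm w (T f) ≤ M₁ * wnorm w f) (f : TestFn) {t : ℝ} (ht : 0 < t) :
    wnorm (fun x => w x / (t * M₁ + w x * M₀)) (T f) ≤ wnorm (fun x => w x / (t + w x)) f := by
  have hl : ∀ a b : ℝ, 0 < a → 0 < b → LocBdd (fun x => w x / (a + w x * b)) := by
    intro a b ha hb
    refine (hw.loc.const_mul a⁻¹).mono
      (hw.loc.meas.div (measurable_const.add (hw.loc.meas.mul_const b))) fun x => ?_
    have := hw.pos x
    rw [abs_of_pos (by positivity), div_le_iff₀ (by positivity)]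
    have : a⁻¹ * w x * (a + w x * b) = w x + a⁻¹ * w x * (w x * b) := by field_simp
    rw [this]
    have : 0 ≤ a⁻¹ * w x * (w x * b) := by positivity
    linarith
  have hθ : LocBdd (fun x => w x / (t + w x)) := by simpa using hl t 1 ht one_pos
  have hk := hl (t * M₁) M₀ (by positivity) hM₀
  set f₀ := f.mul hθ with hf₀
  set f₁ := f - f₀ with hf₁
  have hT : T f = T f₀ + T f₁ := by rw [← map_add, hf₁, add_sub_cancel]
  calc wnorm (fun x => w x / (t * M₁ + w x * M₀)) (T f)
      ≤ ∫ x, (M₀⁻¹ * (T f₀ x ^ 2 * 1) + (t * M₁)⁻¹ * (T f₁ x ^ 2 * w x)) := by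
        refine integral_mono ((T f).integrable_sq_mul hk)
          ((((T f₀).integrable_sq_mul (LocBdd.const 1)).const_mul _).add
            (((T f₁).integrable_sq_mul hw.loc).const_mul _)) fun x => ?_
        have := hw.pos x
        simp only [hT, TestFn.add_apply]
        have e : M₀⁻¹ * (T f₀ x ^ 2 * 1) + (t * M₁)⁻¹ * (T f₁ x ^ 2 * w x) -
            (T f₀ x + T f₁ x) ^ 2 * (w x / (t * M₁ + w x * M₀)) =
            (t * M₁ * T f₀ x - w x * M₀ * T f₁ x) ^ 2 / (M₀ * (t * M₁) *
              (t * M₁ + w x * M₀)) := by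
          field_simp
          ring
        have : 0 ≤ (t * M₁ * T f₀ x - w x * M₀ * T f₁ x) ^ 2 / (M₀ * (t * M₁) *
              (t * M₁ + w x * M₀)) := by positivity
        linarith
    _ = M₀⁻¹ * wnorm (fun _ => 1) (T f₀) + (t * M₁)⁻¹ * wnorm w (T f₁) := by
        rw [integral_add (((T f₀).integrable_sq_mul (LocBdd.const 1)).const_mul _)
          (((T f₁).integrable_sq_mul hw.loc).const_mul _), integral_const_mul,
          integral_const_mul]
        rfl
    _ ≤ M₀⁻¹ * (M₀ * wnorm (fun _ => 1) f₀) + (t * M₁)⁻¹ * (M₁ * wnorm w f₁) := by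
        gcongr
        · exact h₀ _
        · exact h₁ _
    _ = wnorm (fun _ => 1) f₀ + t⁻¹ * wnorm w f₁ := by field_simp
    _ = ∫ x, (f₀ x ^ 2 * 1 + t⁻¹ * (f₁ x ^ 2 * w x)) := by
        rw [integral_add (f₀.integrable_sq_mul (LocBdd.const 1))
          ((f₁.integrable_sq_mul hw.loc).const_mul _), integral_const_mul]
        rfl
    _ = wnorm (fun x => w x / (t + w x)) f := by
        rw [wnorm]
        congr 1 with x
        have := hw.pos x
        simp only [hf₁, hf₀, TestFn.sub_apply, TestFn.mul_apply]
        field_simp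
        ring

lemma ofReal_wnorm {w : Plane → ℝ} (hw : LocBdd w) (hw0 : ∀ x, 0 ≤ w x) (f : TestFn) :
    ENNReal.ofReal (wnorm w f) = ∫⁻ x, ENNReal.ofReal (f x ^ 2 * w x) :=
  ofReal_integral_eq_lintegral_ofReal (f.integrable_sq_mul hw)
    (ae_of_all _ fun x => mul_nonneg (sq_nonneg _) (hw0 x))

/-- Stein–Weiss interpolation with change of measure, in the Hilbert space case. -/
lemma wnorm_interp {w : Plane → ℝ} (hw : IsWeight w) {T : Module.End ℝ TestFn} {M₀ M₁ β : ℝ}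
    (hβ0 : 0 < β) (hβ1 : β < 1) (hM₀ : 0 < M₀) (hM₁ : 0 < M₁)
    (h₀ : ∀ f, wnorm (fun _ => 1) (T f) ≤ M₀ * wnorm (fun _ => 1) f)
    (h₁ : ∀ f, wnorm w (T f) ≤ M₁ * wnorm w f) (f : TestFn) :
    wnorm (fun x => w x ^ β) (T f) ≤ M₀ ^ (1 - β) * M₁ ^ β * wnorm (fun x => w x ^ β) f := by
  have hwm := hw.loc.meas
  have swap : ∀ (g : TestFn) (b : ℝ), 0 < b →
      ∫⁻ t in Set.Ioi (0 : ℝ), ∫⁻ x, ENNReal.ofReal (t ^ (β - 1)) *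
          ENNReal.ofReal (g x ^ 2 * (w x / (t + w x * b))) =
        ENNReal.ofReal (b ^ (β - 1)) * (ENNReal.ofReal (wnorm (fun x => w x ^ β) g) *
          interpConst β) := by
    intro g b hb
    have hgm := g.measurable
    rw [lintegral_lintegral_swap (by fun_prop), ofReal_wnorm (hw.rpow β).loc
      (fun x => ((hw.rpow β).pos x).le), ← lintegral_mul_const _ (by fun_prop),
      ← lintegral_const_mul _ (by fun_prop)]
    refine lintegral_congr fun x => ?_
    have hx := hw.pos x
    have := lintegral_interp (β := β) (mul_pos hx hb)
    have e : ∀ t ∈ Set.Ioi (0 : ℝ), ENNReal.ofReal (t ^ (β - 1)) *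
        ENNReal.ofReal (g x ^ 2 * (w x / (t + w x * b))) = ENNReal.ofReal (g x ^ 2 * b⁻¹) *
          ENNReal.ofReal (t ^ (β - 1) * (w x * b / (t + w x * b))) := by
      intro t ht
      have ht0 : 0 < t := ht
      rw [← ENNReal.ofReal_mul (by positivity), ← ENNReal.ofReal_mul (by positivity)]
      congr 1
      field_simp
    rw [setLIntegral_congr_fun measurableSet_Ioi e, lintegral_const_mul _ (by fun_prop), this,
      ← mul_assoc, ← mul_assoc, ← ENNReal.ofReal_mul (by positivity),
      ← ENNReal.ofReal_mul (by positivity)]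
    congr 2
    rw [Real.mul_rpow hx.le hb.le, Real.rpow_sub_one hb.ne']
    ring
  have hle : ∫⁻ t in Set.Ioi (0 : ℝ), ∫⁻ x, ENNReal.ofReal (t ^ (β - 1)) *
          ENNReal.ofReal (T f x ^ 2 * (w x / (t + w x * (M₀ / M₁)))) ≤
      ENNReal.ofReal M₁ * ∫⁻ t in Set.Ioi (0 : ℝ), ∫⁻ x, ENNReal.ofReal (t ^ (β - 1)) *
          ENNReal.ofReal (f x ^ 2 * (w x / (t + w x * 1))) := by
    have hfm := f.measurable
    have hTm := (T f).measurable
    rw [← lintegral_const_mul _ (by fun_prop)]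
    refine setLIntegral_mono' measurableSet_Ioi fun t ht => ?_
    have ht0 : 0 < t := ht
    rw [lintegral_const_mul _ (by fun_prop), lintegral_const_mul _ (by fun_prop), mul_left_comm]
    refine mul_le_mul_right ?_ _
    have hl : ∀ a b : ℝ, 0 < a → 0 < b → LocBdd (fun x => w x / (a + w x * b)) := by
      intro a b ha hb
      refine (hw.loc.const_mul a⁻¹).mono
        (hw.loc.meas.div (measurable_const.add (hw.loc.meas.mul_const b))) fun x => ?_
      have := hw.pos x
      rw [abs_of_pos (by positivity), inv_mul_eq_div]
      gcongr
      have : 0 ≤ w x * b := by positivity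
      linarith
    have key := wnorm_split_le hw hM₀ hM₁ h₀ h₁ f ht0
    rw [← ofReal_wnorm (hl t (M₀ / M₁) ht0 (by positivity)) fun x => ?_,
      ← ofReal_wnorm (hl t 1 ht0 one_pos) fun x => ?_, ← ENNReal.ofReal_mul hM₁.le]
    · refine ENNReal.ofReal_le_ofReal ?_
      simp only [mul_one]
      refine le_trans (le_of_eq ?_) (mul_le_mul_of_nonneg_left key hM₁.le)
      rw [wnorm, wnorm, ← integral_const_mul]
      congr 1 with x
      have := hw.pos x
      field_simp
    · have := hw.pos x
      positivity
    · have := hw.pos x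
      positivity
  rw [swap _ _ (by positivity), swap _ _ one_pos, ← mul_assoc, ← mul_assoc, ← mul_assoc,
    ENNReal.mul_le_mul_iff_left (interpConst_ne_zero β) (interpConst_ne_top hβ0 hβ1),
    Real.one_rpow, ENNReal.ofReal_one, mul_one, ← ENNReal.ofReal_mul (by positivity),
    ← ENNReal.ofReal_mul (by positivity)] at hle
  have hn := wnorm_nonneg (fun x => ((hw.rpow β).pos x).le) f
  rw [ENNReal.ofReal_le_ofReal_iff (by positivity)] at hle
  have h3 := mul_le_mul_of_nonneg_left hle (by positivity : 0 ≤ (M₀ / M₁) ^ (1 - β))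
  rw [← mul_assoc, ← Real.rpow_add (by positivity), show 1 - β + (β - 1) = 0 by ring,
    Real.rpow_zero, one_mul] at h3
  refine h3.trans (le_of_eq ?_)
  rw [← mul_assoc]
  congr 1
  rw [Real.div_rpow hM₀.le hM₁.le, show β = 1 - (1 - β) by ring, Real.rpow_sub hM₁,
    Real.rpow_one, show 1 - (1 - (1 - β)) = 1 - β by ring]
  field_simp

/-- The index of the dyadic rectangle of side lengths `2 ^ s.1` and `2 ^ s.2` containing `x`. -/
noncomputable def cell (s : ℤ × ℤ) (x : Plane) : ℤ × ℤ :=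
  (⌊x.1 / 2 ^ s.1⌋, ⌊x.2 / 2 ^ s.2⌋)

lemma measurable_cell (s : ℤ × ℤ) : Measurable (cell s) :=
  (Int.measurable_floor.comp (measurable_fst.div_const _)).prodMk
    (Int.measurable_floor.comp (measurable_snd.div_const _))

lemma floor_div_zpow_nested {a b : ℤ} (hab : a ≤ b) {u v : ℝ}
    (h : ⌊u / 2 ^ a⌋ = ⌊v / 2 ^ a⌋) : ⌊u / 2 ^ b⌋ = ⌊v / 2 ^ b⌋ := by
  have key : ∀ u : ℝ, ⌊u / 2 ^ b⌋ = ⌊u / 2 ^ a⌋ / ((2 ^ (b - a).toNat : ℕ) : ℤ) := by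
    intro u
    rw [← Int.floor_div_natCast, div_div]
    congr 2
    push_cast
    rw [← zpow_natCast, Int.toNat_of_nonneg (by linarith), ← zpow_add₀ two_ne_zero]
    congr 1
    ring
  rw [key, key, h]

lemma cell_nested {s t : ℤ × ℤ} (hst : s ≤ t) {x y : Plane} (h : cell s x = cell s y) :
    cell t x = cell t y := by
  simp only [cell, Prod.mk.injEq] at h ⊢
  exact ⟨floor_div_zpow_nested hst.1 h.1, floor_div_zpow_nested hst.2 h.2⟩

/-- The area of a dyadic rectangle. -/
noncomputable def area (s : ℤ × ℤ) : ℝ := 2 ^ s.1 * 2 ^ s.2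

lemma area_pos (s : ℤ × ℤ) : 0 < area s := by unfold area; positivity

lemma floor_div_eq_iff {a : ℤ} {u : ℝ} {k : ℤ} :
    ⌊u / 2 ^ a⌋ = k ↔ u ∈ Set.Ico (k * 2 ^ a : ℝ) ((k + 1) * 2 ^ a) := by
  have : (0 : ℝ) < 2 ^ a := by positivity
  rw [Int.floor_eq_iff, le_div_iff₀ this, div_lt_iff₀ this, Set.mem_Ico]

lemma volume_cell (s : ℤ × ℤ) (k : ℤ × ℤ) :
    volume {y | k = cell s y} = ENNReal.ofReal (area s) := by
  have : {y | k = cell s y} = Set.Ico (k.1 * 2 ^ s.1 : ℝ) ((k.1 + 1) * 2 ^ s.1) ×ˢ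
      Set.Ico (k.2 * 2 ^ s.2 : ℝ) ((k.2 + 1) * 2 ^ s.2) := by
    ext y
    rw [Set.mem_prod, ← floor_div_eq_iff, ← floor_div_eq_iff]
    simp only [cell, Set.mem_ofPred_eq, Prod.ext_iff, eq_comm]
  rw [this, Measure.volume_eq_prod, Measure.prod_prod, Real.volume_Ico, Real.volume_Ico, area,
    ENNReal.ofReal_mul (by positivity)]
  congr 2 <;> ring

lemma abs_sub_le_of_floor {a : ℤ} {u v : ℝ} (h : ⌊u / 2 ^ a⌋ = ⌊v / 2 ^ a⌋) :
    |v - u| ≤ 2 ^ a := by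
  have hu := floor_div_eq_iff.1 h
  have hv := (floor_div_eq_iff (a := a) (u := v)).1 rfl
  rw [Set.mem_Ico] at hu hv
  rw [abs_le]
  constructor <;> nlinarith

lemma norm_sub_le_of_cell {s : ℤ × ℤ} {x y : Plane} (h : cell s x = cell s y) :
    |(y - x).1| ≤ 2 ^ s.1 ∧ |(y - x).2| ≤ 2 ^ s.2 := by
  simp only [cell, Prod.mk.injEq] at h
  exact ⟨abs_sub_le_of_floor h.1, abs_sub_le_of_floor h.2⟩

/-- The density of the averaging kernel over dyadic rectangles. -/
noncomputable def cellDensity (s : ℤ × ℤ) (x y : Plane) : ℝ≥0∞ :=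
  (ENNReal.ofReal (area s))⁻¹ * {z : Plane × Plane | cell s z.1 = cell s z.2}.indicator 1 (x, y)

lemma measurableSet_same_cell (s : ℤ × ℤ) :
    MeasurableSet {z : Plane × Plane | cell s z.1 = cell s z.2} :=
  measurableSet_eq_fun ((measurable_cell s).comp measurable_fst)
    ((measurable_cell s).comp measurable_snd)

lemma measurable_cellDensity (s : ℤ × ℤ) :
    Measurable (Function.uncurry (cellDensity s)) :=
  (measurable_one.indicator (measurableSet_same_cell s)).const_mul _

lemma cellDensity_comm (s : ℤ × ℤ) (x y : Plane) : cellDensity s x y = cellDensity s y x := by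
  simp [cellDensity, Set.indicator_apply, eq_comm]

lemma cellDensity_eq (s : ℤ × ℤ) (x : Plane) :
    cellDensity s x = fun y => {y | cell s x = cell s y}.indicator
      (fun _ => (ENNReal.ofReal (area s))⁻¹) y := by
  ext y
  simp [cellDensity, Set.indicator_apply]

lemma lintegral_cellDensity (s : ℤ × ℤ) (x : Plane) : ∫⁻ y, cellDensity s x y = 1 := by
  have hm : MeasurableSet {y | cell s x = cell s y} :=
    measurableSet_eq_fun measurable_const (measurable_cell s)
  rw [cellDensity_eq, lintegral_indicator hm, setLIntegral_const, volume_cell]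
  exact ENNReal.inv_mul_cancel (by simpa using area_pos s) ENNReal.ofReal_ne_top

/-- The averaging kernel over dyadic rectangles. -/
noncomputable def cellKernel (s : ℤ × ℤ) : Kernel Plane Plane :=
  Kernel.withDensity (Kernel.const Plane volume) (cellDensity s)

lemma cellKernel_apply (s : ℤ × ℤ) (x : Plane) :
    cellKernel s x = (volume : Measure Plane).withDensity (cellDensity s x) := by
  rw [cellKernel, Kernel.withDensity_apply _ (measurable_cellDensity s), Kernel.const_apply]

lemma cellKernel_univ (s : ℤ × ℤ) (x : Plane) : cellKernel s x Set.univ = 1 := by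
  rw [cellKernel_apply, withDensity_apply _ MeasurableSet.univ, setLIntegral_univ,
    lintegral_cellDensity]

lemma ae_cellKernel (s : ℤ × ℤ) (x : Plane) : ∀ᵐ y ∂cellKernel s x, cell s x = cell s y := by
  rw [cellKernel_apply, ae_withDensity_iff ((measurable_cellDensity s).of_uncurry_left)]
  refine ae_of_all _ fun y hy => ?_
  by_contra h
  simp [cellDensity, h] at hy

/-- Averaging over dyadic rectangles. -/
noncomputable def cellAvg (s : ℤ × ℤ) : Avg where
  ker := cellKernel s
  adj := cellKernel s
  rad := max (2 ^ s.1) (2 ^ s.2)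
  ker_mass x := (cellKernel_univ s x).le
  adj_mass x := (cellKernel_univ s x).le
  ker_rad x := by
    filter_upwards [ae_cellKernel s x] with y hy
    have := norm_sub_le_of_cell hy
    exact max_le_max this.1 this.2
  adj_rad x := by
    filter_upwards [ae_cellKernel s x] with y hy
    have := norm_sub_le_of_cell hy
    exact max_le_max this.1 this.2
  dual F hF := by
    have hm := measurable_cellDensity s
    have h1 : ∀ x, ∫⁻ y, F (x, y) ∂cellKernel s x = ∫⁻ y, cellDensity s x y * F (x, y) := by
      intro x
      rw [cellKernel_apply, lintegral_withDensity_eq_lintegral_mul _ hm.of_uncurry_left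
        (g := fun y => F (x, y)) (hF.comp measurable_prodMk_left)]
      rfl
    have h2 : ∀ y, ∫⁻ x, F (x, y) ∂cellKernel s y = ∫⁻ x, cellDensity s x y * F (x, y) := by
      intro y
      rw [cellKernel_apply, lintegral_withDensity_eq_lintegral_mul _ hm.of_uncurry_left
        (g := fun x => F (x, y)) (hF.comp measurable_prodMk_right)]
      simp only [Pi.mul_apply, cellDensity_comm s y]
    simp only [h1, h2]
    exact lintegral_lintegral_swap (hm.mul hF).aemeasurable

@[simp] lemma cellAvg_symm (s : ℤ × ℤ) : (cellAvg s).symm = cellAvg s := rfl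

/-- Functions constant on dyadic rectangles. -/
def CellConst (s : ℤ × ℤ) (g : Plane → ℝ) : Prop := ∀ x y, cell s x = cell s y → g x = g y

lemma CellConst.mono {s t : ℤ × ℤ} (hst : s ≤ t) {g : Plane → ℝ} (hg : CellConst t g) :
    CellConst s g := fun x y h => hg x y (cell_nested hst h)

lemma cellConst_op (s : ℤ × ℤ) (f : Plane → ℝ) : CellConst s ((cellAvg s).op f) := by
  intro x y h
  have : cellKernel s x = cellKernel s y := by
    rw [cellKernel_apply, cellKernel_apply, cellDensity_eq, cellDensity_eq, h]
  simp only [Avg.op, cellAvg, this]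

lemma cellAvg_op_congr (s : ℤ × ℤ) {f g : Plane → ℝ} {x : Plane}
    (h : ∀ y, cell s x = cell s y → f y = g y) : (cellAvg s).op f x = (cellAvg s).op g x := by
  refine integral_congr_ae ?_
  filter_upwards [ae_cellKernel s x] with y hy using h y hy

lemma cellAvg_op_mono (s : ℤ × ℤ) {f g : Plane → ℝ} (hf : LocBdd f) (hg : LocBdd g) {x : Plane}
    (h : ∀ y, cell s x = cell s y → f y ≤ g y) : (cellAvg s).op f x ≤ (cellAvg s).op g x := by
  refine integral_mono_ae ((cellAvg s).integrable hf x) ((cellAvg s).integrable hg x) ?_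
  filter_upwards [ae_cellKernel s x] with y hy using h y hy

@[simp] lemma cellAvg_op_const (s : ℤ × ℤ) (c : ℝ) (x : Plane) :
    (cellAvg s).op (fun _ => c) x = c := by
  simp [Avg.op, cellAvg, Measure.real, cellKernel_univ]

lemma cellAvg_op_of_const {s : ℤ × ℤ} {g : Plane → ℝ} (hg : CellConst s g) :
    (cellAvg s).op g = g := by
  ext x
  rw [cellAvg_op_congr s (g := fun _ => g x) fun y hy => hg _ _ hy.symm, cellAvg_op_const]

/-- Averaging commutes with testing against functions constant on rectangles. -/
lemma integral_mul_cellAvg {s : ℤ × ℤ} {φ : TestFn} (hφ : CellConst s φ) {g : Plane → ℝ}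
    (hg : LocBdd g) : ∫ x, φ x * (cellAvg s).op g x = ∫ x, φ x * g x := by
  rw [(cellAvg s).integral_mul_op φ hg, cellAvg_symm, cellAvg_op_of_const hφ]

lemma cellAvg_op_le_two {s t : ℤ × ℤ} (hst : s ≤ t) (harea : area t ≤ 2 * area s)
    {u : Plane → ℝ} (hu : LocBdd u) (hu0 : ∀ x, 0 ≤ u x) (x : Plane) :
    (cellAvg s).op u x ≤ 2 * (cellAvg t).op u x := by
  have hle : cellKernel s x ≤ (2 : ℝ≥0∞) • cellKernel t x := by
    rw [cellKernel_apply, cellKernel_apply, ← withDensity_smul _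
      (measurable_cellDensity t).of_uncurry_left]
    refine withDensity_mono (ae_of_all _ fun y => ?_)
    simp only [cellDensity, Set.indicator_apply, Set.mem_ofPred_eq, Pi.smul_apply, smul_eq_mul]
    by_cases h : cell s x = cell s y
    · rw [if_pos h, if_pos (cell_nested hst h)]
      simp only [Pi.one_apply, mul_one]
      rw [← ENNReal.ofReal_inv_of_pos (area_pos s), ← ENNReal.ofReal_inv_of_pos (area_pos t),
        ← ENNReal.ofReal_ofNat 2, ← ENNReal.ofReal_mul zero_le_two]
      refine ENNReal.ofReal_le_ofReal ?_
      have := area_pos s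
      have := area_pos t
      rw [inv_eq_one_div, inv_eq_one_div, mul_one_div, div_le_div_iff₀ (by positivity)
        (by positivity)]
      linarith
    · simp [h]
  have h2 : ∫ y, u y ∂((2 : ℝ≥0∞) • cellKernel t x) = 2 * (cellAvg t).op u x := by
    rw [integral_smul_measure]
    rfl
  rw [← h2]
  exact integral_mono_measure hle (ae_of_all _ hu0)
    (((cellAvg t).integrable hu x).smul_measure ENNReal.ofNat_ne_top)

lemma cellAvg_lin_comp_of_le {s t : ℤ × ℤ} (hst : s ≤ t) (f : TestFn) :
    (cellAvg s).lin ((cellAvg t).lin f) = (cellAvg t).lin f :=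
  Subtype.ext (cellAvg_op_of_const ((cellConst_op t f).mono hst))

lemma eq_zero_of_cellConst {s : ℤ × ℤ} {g : TestFn} (hg : CellConst s g)
    (h : pair g g = 0) : g = 0 := by
  have h2 : (fun x => g x * g x) =ᵐ[volume] 0 :=
    (integral_eq_zero_iff_of_nonneg (fun x => mul_self_nonneg _) (g.integrable_mul g.locBdd)).1 h
  ext x
  by_contra hx
  have h3 : volume {y | cell s x = cell s y} = 0 := by
    refine measure_mono_null (fun y hy => ?_) h2
    have hy' : g y = g x := hg _ _ (Eq.symm hy)
    simp only [Set.mem_compl_iff, Set.mem_ofPred_eq, hy', Pi.zero_apply, mul_self_eq_zero]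
    exact hx
  rw [volume_cell] at h3
  exact absurd h3 (by simpa using area_pos s)

lemma cellAvg_lin_comp_of_ge {s t : ℤ × ℤ} (hst : s ≤ t) (f : TestFn) :
    (cellAvg t).lin ((cellAvg s).lin f) = (cellAvg t).lin f := by
  rw [← sub_eq_zero]
  set g := (cellAvg t).lin ((cellAvg s).lin f) - (cellAvg t).lin f with hg
  have hc : CellConst t g := by
    intro x y h
    simp only [hg, TestFn.sub_apply, Avg.lin_apply]
    rw [cellConst_op t _ x y h, cellConst_op t f x y h]
  have e1 : ∀ r ≤ t, (cellAvg r).lin g = g := fun r hr =>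
    Subtype.ext (cellAvg_op_of_const (hc.mono hr))
  refine eq_zero_of_cellConst hc ?_
  have e2 : ∀ r ≤ t, ∀ h, pair g ((cellAvg r).lin h) = pair g h := fun r hr h => by
    rw [pair_lin, cellAvg_symm, e1 r hr]
  calc pair g g = pair g ((cellAvg t).lin ((cellAvg s).lin f)) - pair g ((cellAvg t).lin f) := by
        rw [← map_sub]
    _ = 0 := by rw [e2 t le_rfl, e2 s hst, e2 t le_rfl, sub_self]

lemma gap_poly {u m c f d : ℝ} (hu : 0 < u) (hm1 : m ≤ 1) (hm : m ≤ u ^ 4)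
    (hc0 : 0 ≤ c) (hc : 200 * c ≤ m) :
    u ^ 4 * (f ^ 2 + 2 * f * d - 4 / 5 * f ^ 2 * (u ^ 5 - 1)) + c * d ^ 2 ≤ (f + d) ^ 2 := by
  set K := 1 - u ^ 4 + 4 / 5 * u ^ 4 * (u ^ 5 - 1) with hK
  have hKB : K - (1 - u ^ 4) ^ 2 =
      (u - 1) ^ 2 * (u ^ 4 / 5 * (4 * u ^ 3 + 3 * u ^ 2 + 2 * u + 1)) := by
    rw [hK]; ring
  have hq : c * ((1 + u) * (1 + u ^ 2)) ^ 2 ≤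
      (1 - c) * (u ^ 4 / 5 * (4 * u ^ 3 + 3 * u ^ 2 + 2 * u + 1)) := by
    have hc1 : c ≤ 1 / 200 := by linarith
    have h4 : 200 * c ≤ u ^ 4 := hc.trans hm
    rcases le_total u 1 with h1 | h1
    · have hu2 : u ^ 2 ≤ 1 := pow_le_one₀ hu.le h1
      have ha : (1 + u) * (1 + u ^ 2) ≤ 2 * 2 := by gcongr <;> linarith
      have ha' : ((1 + u) * (1 + u ^ 2)) ^ 2 ≤ 16 := by
        calc ((1 + u) * (1 + u ^ 2)) ^ 2 ≤ (2 * 2) ^ 2 := by gcongr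
          _ = 16 := by norm_num
      have hb : u ^ 4 / 5 ≤ u ^ 4 / 5 * (4 * u ^ 3 + 3 * u ^ 2 + 2 * u + 1) := by
        refine le_mul_of_one_le_right (by positivity) ?_
        have : 0 ≤ 4 * u ^ 3 + 3 * u ^ 2 + 2 * u := by positivity
        linarith
      calc c * ((1 + u) * (1 + u ^ 2)) ^ 2 ≤ c * 16 := by gcongr
        _ ≤ (1 / 2) * (u ^ 4 / 5) := by linarith
        _ ≤ _ := by
          refine mul_le_mul (by linarith) hb (by positivity) (by linarith)
    · have hu2 : u ^ 2 ≥ 1 := one_le_pow₀ h1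
      have ha : (1 + u) * (1 + u ^ 2) ≤ (2 * u) * (2 * u ^ 2) := by gcongr <;> linarith
      have ha' : ((1 + u) * (1 + u ^ 2)) ^ 2 ≤ 16 * u ^ 6 := by
        calc ((1 + u) * (1 + u ^ 2)) ^ 2 ≤ ((2 * u) * (2 * u ^ 2)) ^ 2 := by gcongr
          _ = 16 * u ^ 6 := by ring
      have hb : 4 / 5 * u ^ 6 ≤ u ^ 4 / 5 * (4 * u ^ 3 + 3 * u ^ 2 + 2 * u + 1) := by
        have e : u ^ 4 / 5 * (4 * u ^ 3 + 3 * u ^ 2 + 2 * u + 1) =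
          4 / 5 * u ^ 6 * u + u ^ 4 / 5 * (3 * u ^ 2 + 2 * u + 1) := by ring
        have h2 : 0 ≤ u ^ 4 / 5 * (3 * u ^ 2 + 2 * u + 1) := by positivity
        have h3 : 4 / 5 * u ^ 6 ≤ 4 / 5 * u ^ 6 * u := le_mul_of_one_le_right (by positivity) h1
        linarith
      have hu6 : 0 ≤ u ^ 6 := by positivity
      calc c * ((1 + u) * (1 + u ^ 2)) ^ 2 ≤ (1 / 200) * (16 * u ^ 6) := by gcongr
        _ ≤ (1 / 2) * (4 / 5 * u ^ 6) := by linarith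
        _ ≤ _ := by
          refine mul_le_mul (by linarith) hb (by positivity) (by linarith)
  have hdisc : (1 - u ^ 4) ^ 2 ≤ (1 - c) * K := by
    have h1 := mul_le_mul_of_nonneg_left hq (sq_nonneg (u - 1))
    have h2 : (u - 1) ^ 2 * (c * ((1 + u) * (1 + u ^ 2)) ^ 2) = c * (1 - u ^ 4) ^ 2 := by ring
    rw [h2, mul_left_comm, ← hKB] at h1
    linarith
  have hA : 0 < 1 - c := by linarith
  have h3 : 0 ≤ (1 - c) * ((1 - c) * d ^ 2 + 2 * (1 - u ^ 4) * f * d + K * f ^ 2) := by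
    have e : (1 - c) * ((1 - c) * d ^ 2 + 2 * (1 - u ^ 4) * f * d + K * f ^ 2) =
      ((1 - c) * d + (1 - u ^ 4) * f) ^ 2 + ((1 - c) * K - (1 - u ^ 4) ^ 2) * f ^ 2 := by ring
    rw [e]
    have := mul_nonneg (sub_nonneg.2 hdisc) (sq_nonneg f)
    positivity
  have h4 := nonneg_of_mul_nonneg_right h3 hA
  rw [hK] at h4
  linarith

/-- The pointwise convexity inequality behind the weighted square function estimate. -/
lemma gap_le {z₀ z₁ m c f d : ℝ} (h₀ : 0 < z₀) (h₁ : 0 < z₁) (hm1 : m ≤ 1)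
    (hm : m * z₀ ^ (4 / 5 : ℝ) ≤ z₁ ^ (4 / 5 : ℝ)) (hc0 : 0 ≤ c) (hc : 200 * c ≤ m) :
    f ^ 2 * z₀ ^ (-(4 / 5) : ℝ) + 2 * (f * z₀ ^ (-(4 / 5) : ℝ) * d) -
        4 / 5 * (f ^ 2 * z₀ ^ (-(4 / 5) : ℝ) * z₀⁻¹ * (z₁ - z₀)) +
      c * (d ^ 2 * z₁ ^ (-(4 / 5) : ℝ)) ≤ (f + d) ^ 2 * z₁ ^ (-(4 / 5) : ℝ) := by
  set u := (z₁ / z₀) ^ (1 / 5 : ℝ) with hu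
  have hu0 : 0 < u := by positivity
  have hu5 : u ^ 5 = z₁ / z₀ := by
    rw [hu, ← Real.rpow_natCast, ← Real.rpow_mul (by positivity)]
    norm_num
  have hu4 : u ^ 4 = z₁ ^ (4 / 5 : ℝ) / z₀ ^ (4 / 5 : ℝ) := by
    rw [hu, ← Real.rpow_natCast, ← Real.rpow_mul (by positivity), ← Real.div_rpow h₁.le h₀.le]
    norm_num
  have hp0 : 0 < z₀ ^ (4 / 5 : ℝ) := by positivity
  have hp1 : 0 < z₁ ^ (4 / 5 : ℝ) := by positivity
  have hmu : m ≤ u ^ 4 := by rwa [hu4, le_div_iff₀ hp0]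
  have key := gap_poly (f := f) (d := d) hu0 hm1 hmu hc0 hc
  rw [Real.rpow_neg h₀.le, Real.rpow_neg h₁.le, ← div_eq_mul_inv ((f + d) ^ 2),
    le_div_iff₀ hp1]
  refine le_trans (le_of_eq ?_) key
  rw [hu5, hu4]
  field_simp

lemma isWeight_cellAvg {s : ℤ × ℤ} {w : Plane → ℝ} (hw : IsWeight w) :
    IsWeight ((cellAvg s).op w) := by
  have hl := (cellAvg s).op_locBdd hw.loc
  have hli := (cellAvg s).op_locBdd hw.loc_inv
  have h1 : ∀ x, 1 ≤ (cellAvg s).op (fun x => (w x)⁻¹) x * (cellAvg s).op w x := by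
    intro x
    have := (cellAvg s).op_sq_le (LocBdd.const 1) hw.loc (by simpa using hw.loc_inv) hw.pos x
    simpa using this
  have hpos : ∀ x, 0 < (cellAvg s).op w x := by
    intro x
    refine ((cellAvg s).op_nonneg (fun y => (hw.pos y).le) x).lt_of_ne fun h => ?_
    have := h1 x
    rw [← h, mul_zero] at this
    linarith
  refine ⟨hpos, hl, hli.mono hl.meas.inv fun x => ?_⟩
  rw [abs_of_pos (inv_pos.2 (hpos x)), inv_le_iff_one_le_mul₀ (hpos x)]
  exact h1 x

/-- One step of the weighted square function estimate. -/
lemma wnorm_gap_le {t : ℤ × ℤ} {f₀ f₁ f : TestFn} {z₀ z₁ z : Plane → ℝ} (hz₀ : IsWeight z₀)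
    (hz₁ : IsWeight z₁) (hcf : CellConst t f₀) (hcz : CellConst t z₀)
    (hf₀ : ∀ φ : TestFn, CellConst t φ → ∫ x, φ x * f₀ x = ∫ x, φ x * f x)
    (hf₁ : ∀ φ : TestFn, CellConst t φ → ∫ x, φ x * f₁ x = ∫ x, φ x * f x)
    (hz₀' : ∀ φ : TestFn, CellConst t φ → ∫ x, φ x * z₀ x = ∫ x, φ x * z x)
    (hz₁' : ∀ φ : TestFn, CellConst t φ → ∫ x, φ x * z₁ x = ∫ x, φ x * z x)
    {m c : ℝ} (hm1 : m ≤ 1) (hm : ∀ x, m * z₀ x ^ (4 / 5 : ℝ) ≤ z₁ x ^ (4 / 5 : ℝ))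
    (hc0 : 0 ≤ c) (hc : 200 * c ≤ m) :
    wnorm (fun x => z₀ x ^ (-(4 / 5) : ℝ)) f₀ +
      c * wnorm (fun x => z₁ x ^ (-(4 / 5) : ℝ)) (f₁ - f₀) ≤
      wnorm (fun x => z₁ x ^ (-(4 / 5) : ℝ)) f₁ := by
  have hw₀ := hz₀.rpow (-(4 / 5))
  have hw₁ := hz₁.rpow (-(4 / 5))
  let φ : TestFn := f₀.mul hw₀.loc
  let ψ : TestFn := ⟨_, TestFn.mul_mem (f₀.sq_mul_mem hw₀.loc) hz₀.loc_inv⟩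
  have hφ : CellConst t φ := fun x y h => by
    simp only [φ, TestFn.mul_apply, hcf x y h, hcz x y h]
  have hψ : CellConst t ψ := fun x y h => by
    simp only [ψ, hcf x y h, hcz x y h]
  have i1 := (f₀.integrable_sq_mul hw₀.loc)
  have i2 := φ.integrable_mul (f₁ - f₀).locBdd
  have i3 := ψ.integrable_mul (hz₁.loc.sub hz₀.loc)
  have i4 := (f₁ - f₀).integrable_sq_mul hw₁.loc
  have i12 : Integrable fun x => f₀ x ^ 2 * z₀ x ^ (-(4 / 5) : ℝ) + 2 * (φ x * (f₁ - f₀) x) :=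
    i1.add (i2.const_mul 2)
  have i123 : Integrable fun x => f₀ x ^ 2 * z₀ x ^ (-(4 / 5) : ℝ) + 2 * (φ x * (f₁ - f₀) x) -
      4 / 5 * (ψ x * (z₁ x - z₀ x)) := i12.sub (i3.const_mul _)
  have e2 : ∫ x, φ x * (f₁ - f₀) x = 0 := by
    have : ∀ x, φ x * (f₁ - f₀) x = φ x * f₁ x - φ x * f₀ x := fun x => by
      simp only [TestFn.sub_apply]; ring
    simp only [this]
    rw [integral_sub (φ.integrable_mul f₁.locBdd) (φ.integrable_mul f₀.locBdd), hf₀ φ hφ,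
      hf₁ φ hφ, sub_self]
  have e3 : ∫ x, ψ x * (z₁ x - z₀ x) = 0 := by
    simp only [mul_sub]
    rw [integral_sub (ψ.integrable_mul hz₁.loc) (ψ.integrable_mul hz₀.loc), hz₀' ψ hψ,
      hz₁' ψ hψ, sub_self]
  calc wnorm (fun x => z₀ x ^ (-(4 / 5) : ℝ)) f₀ +
        c * wnorm (fun x => z₁ x ^ (-(4 / 5) : ℝ)) (f₁ - f₀)
      = ∫ x, (f₀ x ^ 2 * z₀ x ^ (-(4 / 5) : ℝ) + 2 * (φ x * (f₁ - f₀) x) -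
        4 / 5 * (ψ x * (z₁ x - z₀ x)) +
          c * ((f₁ - f₀) x ^ 2 * z₁ x ^ (-(4 / 5) : ℝ))) := by
        rw [integral_add i123 (i4.const_mul c), integral_sub i12 (i3.const_mul _),
          integral_add i1 (i2.const_mul 2), integral_const_mul, integral_const_mul,
          integral_const_mul, e2, e3]
        simp [wnorm]
    _ ≤ _ := by
        refine integral_mono (i123.add (i4.const_mul c)) (f₁.integrable_sq_mul hw₁.loc) fun x => ?_
        have := gap_le (f := f₀ x) (d := f₁ x - f₀ x) (hz₀.pos x) (hz₁.pos x) hm1 (hm x) hc0 hc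
        simpa [φ, ψ] using this

/-- The weight `(U / V) ^ (4 / 5)` attached to a pair of weights. -/
noncomputable def ratioWeight (U V : Plane → ℝ) (x : Plane) : ℝ := (U x / V x) ^ (4 / 5 : ℝ)

lemma isWeight_ratioWeight {U V : Plane → ℝ} (hU : IsWeight U) (hV : IsWeight V) :
    IsWeight (ratioWeight U V) := (hU.div hV).rpow _

lemma ratioWeight_inv {U V : Plane → ℝ} (hU : IsWeight U) (hV : IsWeight V) :
    (fun x => (ratioWeight U V x)⁻¹) = ratioWeight V U := by
  ext x
  have := (hU.pos x).le
  have := (hV.pos x).le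
  rw [ratioWeight, ratioWeight, ← Real.inv_rpow (by positivity), inv_div]

lemma rpow_neg_le_cellAvg {Z : Plane → ℝ} (hZ : IsWeight Z) (s : ℤ × ℤ) (x : Plane) :
    (cellAvg s).op Z x ^ (-(4 / 5) : ℝ) ≤ (cellAvg s).op (fun y => Z y ^ (-(4 / 5) : ℝ)) x := by
  have hE := isWeight_cellAvg (s := s) hZ
  set z := (cellAvg s).op Z x with hz
  have hz0 : 0 < z := hE.pos x
  have h : ∀ y, (z ^ (-(4 / 5) : ℝ) * (1 + 4 / 5)) - (4 / 5 * z ^ (-(4 / 5) : ℝ) * z⁻¹) * Z y ≤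
      Z y ^ (-(4 / 5) : ℝ) := by
    intro y
    have := gap_le (m := 0) (c := 0) (f := 1) (d := 0) hz0 (hZ.pos y) zero_le_one
      (by have := hZ.pos y; rw [zero_mul]; positivity) le_rfl (by norm_num)
    have e : (4 / 5 : ℝ) * (z ^ (-(4 / 5) : ℝ) * z⁻¹ * (Z y - z)) =
        4 / 5 * z ^ (-(4 / 5) : ℝ) * z⁻¹ * Z y - 4 / 5 * z ^ (-(4 / 5) : ℝ) := by
      field_simp
    norm_num at this e ⊢
    linarith
  have h2 := (cellAvg s).op_mono ((LocBdd.const _).sub (hZ.loc.const_mul _)) (hZ.rpow _).loc h x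
  rw [(cellAvg s).op_sub (LocBdd.const _) (hZ.loc.const_mul _),
    cellAvg_op_const, (cellAvg s).op_const_mul (f := Z), ← hz] at h2
  refine le_trans (le_of_eq ?_) h2
  field_simp
  ring

lemma cellAvg_ratioWeight_le {𝒜 : Set Avg} {C : ℝ} {U V : Plane → ℝ} (hC : 1 ≤ C)
    (hU : IsA1 𝒜 C U) (hV : IsA1 𝒜 C V) {s : ℤ × ℤ} (hs : cellAvg s ∈ 𝒜) (x : Plane) :
    (cellAvg s).op (ratioWeight U V) x ≤
      C ^ 2 * (cellAvg s).op (fun y => V y / U y) x ^ (-(4 / 5) : ℝ) := by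
  have hEU := isWeight_cellAvg (s := s) hU.weight
  have hEV := isWeight_cellAvg (s := s) hV.weight
  have hEZ := isWeight_cellAvg (s := s) (hV.weight.div hU.weight)
  set a := (cellAvg s).op U x with ha
  set b := (cellAvg s).op V x with hb
  set z := (cellAvg s).op (fun y => V y / U y) x with hz
  have ha0 : 0 < a := hEU.pos x
  have hb0 : 0 < b := hEV.pos x
  have hz0 : 0 < z := hEZ.pos x
  have hC0 : 0 < C := by linarith
  have hUle : ∀ y, cell s x = cell s y → a ≤ C * U y := fun y hy => by
    rw [ha, cellConst_op s U x y hy]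
    exact hU.le _ hs y
  have hVle : ∀ y, cell s x = cell s y → b ≤ C * V y := fun y hy => by
    rw [hb, cellConst_op s V x y hy]
    exact hV.le _ hs y
  have h1 : z ≤ C / a * b := by
    have := cellAvg_op_mono s (hV.weight.div hU.weight).loc (hV.weight.loc.const_mul (C / a))
      (x := x) fun y hy => by
        have hy1 := hUle y hy
        have hu := hU.weight.pos y
        have hv := hV.weight.pos y
        rw [div_mul_eq_mul_div, div_le_div_iff₀ hu ha0]
        nlinarith
    rwa [Avg.op_const_mul] at this
  have h2 : (cellAvg s).op (ratioWeight U V) x ≤ (C * a / b) ^ (4 / 5 : ℝ) := by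
    set D := (C * a / b) ^ (4 / 5 : ℝ) with hD
    have hD0 : 0 < D := by positivity
    have := cellAvg_op_mono s (isWeight_ratioWeight hU.weight hV.weight).loc
      ((hU.weight.loc.const_mul (D * (4 / 5) / a)).add (LocBdd.const (D * (1 / 5))))
      (x := x) fun y hy => by
        have hy1 := hVle y hy
        have hu := hU.weight.pos y
        have hv := hV.weight.pos y
        have h3 := Real.geom_mean_le_arith_mean2_weighted (w₁ := 4 / 5) (w₂ := 1 / 5)
          (p₁ := U y / a) (p₂ := 1) (by norm_num) (by norm_num) (by positivity) zero_le_one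
          (by norm_num)
        rw [Real.one_rpow, mul_one] at h3
        calc ratioWeight U V y ≤ (C * a / b * (U y / a)) ^ (4 / 5 : ℝ) := by
              rw [ratioWeight]
              gcongr
              rw [div_mul_div_comm, div_le_div_iff₀ hv (by positivity)]
              have := mul_le_mul_of_nonneg_left hy1 (by positivity : 0 ≤ U y * a)
              linarith
          _ = D * (U y / a) ^ (4 / 5 : ℝ) := by rw [Real.mul_rpow (by positivity) (by positivity)]
          _ ≤ D * (4 / 5 * (U y / a) + 1 / 5 * 1) := by gcongr
          _ = _ := by ring
    rw [(cellAvg s).op_add (hU.weight.loc.const_mul _) (LocBdd.const _), Avg.op_const_mul,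
      cellAvg_op_const, ← ha] at this
    refine this.trans (le_of_eq ?_)
    field_simp
    ring
  have h4 : z * (C * a / b) ≤ C ^ 2 := by
    calc z * (C * a / b) ≤ (C / a * b) * (C * a / b) := by gcongr
      _ = C ^ 2 := by field_simp
  rw [Real.rpow_neg hz0.le, ← div_eq_mul_inv, le_div_iff₀ (by positivity)]
  calc (cellAvg s).op (ratioWeight U V) x * z ^ (4 / 5 : ℝ)
      ≤ (C * a / b) ^ (4 / 5 : ℝ) * z ^ (4 / 5 : ℝ) := by gcongr
    _ = (z * (C * a / b)) ^ (4 / 5 : ℝ) := by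
        rw [← Real.mul_rpow (by positivity) (by positivity), mul_comm]
    _ ≤ (C ^ 2) ^ (4 / 5 : ℝ) := by gcongr
    _ ≤ (C ^ 2) ^ (1 : ℝ) := Real.rpow_le_rpow_of_exponent_le (one_le_pow₀ hC) (by norm_num)
    _ = C ^ 2 := Real.rpow_one _

/-- Weighted square function estimate for a regular chain of dyadic averages. -/
lemma sum_wnorm_sub_le {𝒜 : Set Avg} {C : ℝ} {U V : Plane → ℝ} (hC : 1 ≤ C)
    (hU : IsA1 𝒜 C U) (hV : IsA1 𝒜 C V) {F : ℕ → ℤ × ℤ} {L : ℕ} (hF : ∀ i < L, F i ≤ F (i + 1))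
    (harea : ∀ i < L, area (F (i + 1)) ≤ 2 * area (F i)) (hA : ∀ i ≤ L, cellAvg (F i) ∈ 𝒜)
    (f : TestFn) :
    ∑ i ∈ Finset.range L, wnorm (ratioWeight U V)
        ((cellAvg (F i)).lin f - (cellAvg (F (i + 1))).lin f) ≤
      400 * C ^ 4 * wnorm (ratioWeight U V) f := by
  have hC0 : 0 < C := by linarith
  have hw := isWeight_ratioWeight hU.weight hV.weight
  have hZ := hV.weight.div hU.weight
  have hwZ : ratioWeight U V = fun y => (V y / U y) ^ (-(4 / 5) : ℝ) := by
    ext y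
    have hu := (hU.weight.pos y).le
    have hv := (hV.weight.pos y).le
    rw [ratioWeight, Real.rpow_neg (by positivity), ← Real.inv_rpow (by positivity), inv_div]
  set z : ℕ → Plane → ℝ := fun i => (cellAvg (F i)).op (fun y => V y / U y) with hz
  have hzw : ∀ i, IsWeight (z i) := fun i => isWeight_cellAvg hZ
  have hlow : ∀ i x, z i x ^ (-(4 / 5) : ℝ) ≤ (cellAvg (F i)).op (ratioWeight U V) x := by
    intro i x
    rw [hwZ]
    exact rpow_neg_le_cellAvg hZ (F i) x
  have hup : ∀ i ≤ L, ∀ x, (cellAvg (F i)).op (ratioWeight U V) x ≤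
      C ^ 2 * z i x ^ (-(4 / 5) : ℝ) := fun i hi x =>
    cellAvg_ratioWeight_le hC hU hV (hA i hi) x
  have hf_mem : ∀ (s t : ℤ × ℤ), s ≤ t → ∀ g : Plane → ℝ, LocBdd g → ∀ φ : TestFn,
      CellConst t φ → ∫ x, φ x * (cellAvg s).op g x = ∫ x, φ x * g x :=
    fun s t hst g hg φ hφ => integral_mul_cellAvg (hφ.mono hst) hg
  have hC2 : 1 ≤ C ^ 2 := one_le_pow₀ hC
  set m := 1 / (2 * C ^ 2) with hm
  have hm1 : m ≤ 1 := by
    rw [hm, div_le_one (by positivity)]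
    linarith
  have hm0 : 0 < m := by positivity
  have hstep : ∀ i < L,
      wnorm (fun x => z (i + 1) x ^ (-(4 / 5) : ℝ)) ((cellAvg (F (i + 1))).lin f) +
      m / 200 * wnorm (fun x => z i x ^ (-(4 / 5) : ℝ))
        ((cellAvg (F i)).lin f - (cellAvg (F (i + 1))).lin f) ≤
      wnorm (fun x => z i x ^ (-(4 / 5) : ℝ)) ((cellAvg (F i)).lin f) := by
    intro i hi
    refine wnorm_gap_le (t := F (i + 1)) (f := f) (z := fun y => V y / U y) (hzw _) (hzw _)
      (cellConst_op _ _) (cellConst_op _ _) (hf_mem _ _ le_rfl _ f.locBdd)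
      (hf_mem _ _ (hF i hi) _ f.locBdd) (hf_mem _ _ le_rfl _ hZ.loc) (hf_mem _ _ (hF i hi) _ hZ.loc)
      hm1 (fun x => ?_) (by positivity) (by linarith)
    have h0 := (hzw i).pos x
    have h1 := (hzw (i + 1)).pos x
    have h2 := (hlow i x).trans ((cellAvg_op_le_two (hF i hi) (harea i hi) hw.loc
      (fun y => (hw.pos y).le) x).trans (mul_le_mul_of_nonneg_left (hup (i + 1) hi x) zero_le_two))
    rw [Real.rpow_neg h0.le, Real.rpow_neg h1.le, ← mul_assoc, ← div_eq_mul_inv,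
      le_div_iff₀ (by positivity), inv_mul_le_iff₀ (by positivity)] at h2
    rw [hm, one_div, inv_mul_le_iff₀ (by positivity)]
    linarith
  have hzero : wnorm (fun x => z 0 x ^ (-(4 / 5) : ℝ)) ((cellAvg (F 0)).lin f) ≤
      wnorm (ratioWeight U V) f := by
    rw [hwZ]
    have := wnorm_gap_le (t := F 0) (f := f) (f₁ := f) (f₀ := (cellAvg (F 0)).lin f)
      (z := fun y => V y / U y) (m := 0) (c := 0) (hzw 0) hZ
      (cellConst_op _ _) (cellConst_op _ _) (hf_mem _ _ le_rfl _ f.locBdd)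
      (fun _ _ => rfl) (hf_mem _ _ le_rfl _ hZ.loc) (fun _ _ => rfl) zero_le_one
      (fun x => by have := hZ.pos x; rw [zero_mul]; positivity) le_rfl (by norm_num)
    simpa using this
  have hd : ∀ i < L, wnorm (ratioWeight U V)
        ((cellAvg (F i)).lin f - (cellAvg (F (i + 1))).lin f) ≤
      C ^ 2 * wnorm (fun x => z i x ^ (-(4 / 5) : ℝ))
        ((cellAvg (F i)).lin f - (cellAvg (F (i + 1))).lin f) := by
    intro i hi
    set d := (cellAvg (F i)).lin f - (cellAvg (F (i + 1))).lin f with hd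
    have hdc : CellConst (F i) d := fun x y h => by
      simp only [hd, TestFn.sub_apply, Avg.lin_apply]
      rw [cellConst_op _ f x y h, ((cellConst_op _ f).mono (hF i hi)) x y h]
    let φ : TestFn := d.mul d.locBdd
    have hφ : CellConst (F i) φ := fun x y h => by simp only [φ, TestFn.mul_apply, hdc x y h]
    have e := integral_mul_cellAvg hφ hw.loc
    have e1 : wnorm (ratioWeight U V) d = ∫ x, φ x * ratioWeight U V x := by
      simp [wnorm, φ, pow_two]
    rw [e1, ← e, wnorm, ← integral_const_mul]
    refine integral_mono (φ.integrable_mul ((cellAvg _).op_locBdd hw.loc))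
      ((d.integrable_sq_mul ((hzw i).rpow _).loc).const_mul _) fun x => ?_
    have := mul_le_mul_of_nonneg_left (hup i hi.le x) (sq_nonneg (d x))
    simp only [φ, TestFn.mul_apply]
    linarith
  have htel : ∀ n ≤ L, m / 200 * ∑ i ∈ Finset.range n, wnorm (fun x => z i x ^ (-(4 / 5) : ℝ))
        ((cellAvg (F i)).lin f - (cellAvg (F (i + 1))).lin f) +
      wnorm (fun x => z n x ^ (-(4 / 5) : ℝ)) ((cellAvg (F n)).lin f) ≤
      wnorm (ratioWeight U V) f := by
    intro n
    induction n with
    | zero => intro _; simpa using hzero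
    | succ n ih =>
      intro hn
      have h1 := ih (by omega)
      have h2 := hstep n hn
      rw [Finset.sum_range_succ, mul_add]
      linarith
  have h1 := htel L le_rfl
  have h2 := wnorm_nonneg (fun x => (((hzw L).rpow (-(4 / 5))).pos x).le) ((cellAvg (F L)).lin f)
  calc _ ≤ ∑ i ∈ Finset.range L, C ^ 2 * wnorm (fun x => z i x ^ (-(4 / 5) : ℝ))
        ((cellAvg (F i)).lin f - (cellAvg (F (i + 1))).lin f) :=
        Finset.sum_le_sum fun i hi => hd i (Finset.mem_range.1 hi)
    _ = C ^ 2 * (200 / m) * (m / 200 * ∑ i ∈ Finset.range L,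
          wnorm (fun x => z i x ^ (-(4 / 5) : ℝ))
            ((cellAvg (F i)).lin f - (cellAvg (F (i + 1))).lin f)) := by
        rw [← Finset.mul_sum]
        field_simp
    _ ≤ C ^ 2 * (200 / m) * wnorm (ratioWeight U V) f := by
        gcongr
        linarith
    _ = _ := by
        rw [hm]
        field_simp
        ring

lemma wnorm_ratioWeight_lin_le {𝒜 : Set Avg} {C : ℝ} {U V : Plane → ℝ} (hC : 1 ≤ C)
    (hU : IsA1 𝒜 C U) (hV : IsA1 𝒜 C V) {A : Avg} (hA : A ∈ 𝒜) (hA' : A.symm ∈ 𝒜)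
    (f : TestFn) :
    wnorm (ratioWeight U V) (A.lin f) ≤ C ^ 2 * wnorm (ratioWeight U V) f := by
  have e : ratioWeight U V = fun x => U x ^ (4 / 5 : ℝ) / V x ^ (4 / 5 : ℝ) := by
    ext x
    rw [ratioWeight, Real.div_rpow (hU.weight.pos x).le (hV.weight.pos x).le]
  rw [e]
  exact wnorm_lin_le (by linarith) (hU.rpow hC (by norm_num) (by norm_num))
    (hV.rpow hC (by norm_num) (by norm_num)) hA hA' f

/-- Almost orthogonality in a weighted space. -/
lemma wnorm_sum_le_of_decay {w : Plane → ℝ} (hw : IsWeight w) {D B : ℕ → Module.End ℝ TestFn}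
    {M J : ℕ} {κ : ℕ → ℕ → ℝ} {S Cd Cb : ℝ} (hS : 0 < S) (hCd : 0 ≤ Cd) (hCb : 0 < Cb)
    (hsum : ∀ f, ∑ k ∈ Finset.range M, D k f = f)
    (hproj : ∀ k f, D k (D k f) = D k f)
    (hadj : ∀ k f h, pair (D k f) h = pair f (D k h))
    (hb : ∀ f, ∑ k ∈ Finset.range M, wnorm w (D k f) ≤ Cb * wnorm w f)
    (hb' : ∀ f, ∑ k ∈ Finset.range M, wnorm (fun x => (w x)⁻¹) (D k f) ≤
      Cb * wnorm (fun x => (w x)⁻¹) f)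
    (hκ : ∀ i j, 0 < κ i j) (hκr : ∀ i, ∑ j ∈ Finset.range J, κ i j ≤ S)
    (hκc : ∀ j, ∑ i ∈ Finset.range M, κ i j ≤ S)
    (hdec : ∀ k < M, ∀ j < J, ∀ i < M, ∀ f,
      wnorm w (D k (B j (D i f))) ≤ Cd * (κ k j * κ i j) ^ 2 * wnorm w f) (f : TestFn) :
    wnorm w (∑ j ∈ Finset.range J, B j f) ≤ S ^ 4 * Cb ^ 2 * Cd * wnorm w f := by
  have hpos : ∀ g, 0 ≤ wnorm w g := wnorm_nonneg fun x => (hw.pos x).le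
  have hpos' : ∀ g, 0 ≤ wnorm (fun x => (w x)⁻¹) g := wnorm_nonneg fun x => (hw.inv.pos x).le
  have hexp : ∀ h, pair (∑ j ∈ Finset.range J, B j f) h =
      ∑ j ∈ Finset.range J, ∑ k ∈ Finset.range M, ∑ i ∈ Finset.range M,
        pair (D k (B j (D i (D i f)))) (D k h) := by
    intro h
    rw [map_sum, LinearMap.sum_apply]
    refine Finset.sum_congr rfl fun j _ => ?_
    conv_lhs => rw [← hsum h, map_sum]
    refine Finset.sum_congr rfl fun k _ => ?_
    conv_lhs => rw [← hsum f, map_sum, map_sum, LinearMap.sum_apply]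
    refine Finset.sum_congr rfl fun i _ => ?_
    rw [hproj i, hadj, hproj]
  have hterm : ∀ h, ∀ j ∈ Finset.range J, ∀ k ∈ Finset.range M, ∀ i ∈ Finset.range M,
      pair (D k (B j (D i (D i f)))) (D k h) ≤ κ k j * κ i j * (Cd / 2 * wnorm w (D i f)) +
        κ k j * κ i j * (1 / 2 * wnorm (fun x => (w x)⁻¹) (D k h)) := by
    intro h j hj k hk i hi
    have hkj := hκ k j
    have hij := hκ i j
    have ha : 0 < κ k j * κ i j := mul_pos hkj hij
    have h1 := pair_le hw ha (D k (B j (D i (D i f)))) (D k h)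
    have h2 := mul_le_mul_of_nonneg_left (hdec k (Finset.mem_range.1 hk) j (Finset.mem_range.1 hj) i
      (Finset.mem_range.1 hi) (D i f)) (inv_pos.2 ha).le
    have h3 : (κ k j * κ i j)⁻¹ * (Cd * (κ k j * κ i j) ^ 2 * wnorm w (D i f)) =
        κ k j * κ i j * (Cd * wnorm w (D i f)) := by
      field_simp
    linarith
  have hκ0 : ∀ j, 0 ≤ ∑ i ∈ Finset.range M, κ i j := fun j =>
    Finset.sum_nonneg fun i _ => (hκ i j).le
  have hS1 : ∀ a : ℕ → ℝ, (∀ i, 0 ≤ a i) → ∑ j ∈ Finset.range J, ∑ k ∈ Finset.range M,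
      ∑ i ∈ Finset.range M, κ k j * κ i j * a i ≤ S ^ 2 * ∑ i ∈ Finset.range M, a i := by
    intro a ha
    calc _ = ∑ j ∈ Finset.range J, (∑ k ∈ Finset.range M, κ k j) *
          ∑ i ∈ Finset.range M, κ i j * a i := by
          refine Finset.sum_congr rfl fun j _ => ?_
          rw [Finset.sum_mul]
          refine Finset.sum_congr rfl fun k _ => ?_
          rw [Finset.mul_sum]
          exact Finset.sum_congr rfl fun i _ => by ring
      _ ≤ ∑ j ∈ Finset.range J, S * ∑ i ∈ Finset.range M, κ i j * a i := by
          refine Finset.sum_le_sum fun j _ => ?_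
          exact mul_le_mul_of_nonneg_right (hκc j)
            (Finset.sum_nonneg fun i _ => mul_nonneg (hκ i j).le (ha i))
      _ = S * ∑ i ∈ Finset.range M, (∑ j ∈ Finset.range J, κ i j) * a i := by
          rw [← Finset.mul_sum, Finset.sum_comm]
          simp only [Finset.sum_mul]
      _ ≤ S * ∑ i ∈ Finset.range M, S * a i := by
          gcongr with i _
          · exact ha i
          · exact hκr i
      _ = _ := by rw [← Finset.mul_sum]; ring
  have hS2 : ∀ a : ℕ → ℝ, (∀ i, 0 ≤ a i) → ∑ j ∈ Finset.range J, ∑ k ∈ Finset.range M,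
      ∑ i ∈ Finset.range M, κ k j * κ i j * a k ≤ S ^ 2 * ∑ i ∈ Finset.range M, a i := by
    intro a ha
    refine le_trans (le_of_eq ?_) (hS1 a ha)
    refine Finset.sum_congr rfl fun j _ => ?_
    rw [Finset.sum_comm]
    exact Finset.sum_congr rfl fun k _ => Finset.sum_congr rfl fun i _ => by ring
  have key : ∀ h, pair (∑ j ∈ Finset.range J, B j f) h ≤
      S ^ 2 * (Cd / 2) * Cb * wnorm w f +
        S ^ 2 * Cb / 2 * wnorm (fun x => (w x)⁻¹) h := by
    intro h
    rw [hexp]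
    calc _ ≤ ∑ j ∈ Finset.range J, ∑ k ∈ Finset.range M, ∑ i ∈ Finset.range M,
          (κ k j * κ i j * (Cd / 2 * wnorm w (D i f)) +
            κ k j * κ i j * (1 / 2 * wnorm (fun x => (w x)⁻¹) (D k h))) :=
          Finset.sum_le_sum fun j hj => Finset.sum_le_sum fun k hk =>
            Finset.sum_le_sum fun i hi => hterm h j hj k hk i hi
      _ ≤ S ^ 2 * ∑ i ∈ Finset.range M, Cd / 2 * wnorm w (D i f) +
          S ^ 2 * ∑ k ∈ Finset.range M, 1 / 2 * wnorm (fun x => (w x)⁻¹) (D k h) := by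
          simp only [Finset.sum_add_distrib]
          refine add_le_add (hS1 _ fun i => ?_)
            (hS2 (fun k => 1 / 2 * wnorm (fun x => (w x)⁻¹) (D k h)) fun i => ?_)
          · exact mul_nonneg (by positivity) (hpos _)
          · exact mul_nonneg (by norm_num) (hpos' _)
      _ ≤ S ^ 2 * (Cd / 2 * (Cb * wnorm w f)) +
          S ^ 2 * (1 / 2 * (Cb * wnorm (fun x => (w x)⁻¹) h)) := by
          rw [← Finset.mul_sum, ← Finset.mul_sum]
          gcongr
          · exact hb f
          · exact hb' h
      _ = _ := by ring
  refine (wnorm_le_of_pair hw (by positivity) key).trans (le_of_eq ?_)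
  ring

/-- A chain of dyadic rectangles growing one doubling at a time, with marked stops. -/
structure IsChain (𝒜 : Set Avg) (F : ℕ → ℤ × ℤ) (n : ℕ → ℕ) (K : ℕ) : Prop where
  step : ∀ i, F i ≤ F (i + 1)
  area : ∀ i, area (F (i + 1)) ≤ 2 * area (F i)
  mem : ∀ i ≤ n K, cellAvg (F i) ∈ 𝒜
  zero : n 0 = 0
  mono : Monotone n

/-- The identity, the averages at the stops, then zero. -/
noncomputable def stopAvg (F : ℕ → ℤ × ℤ) (n : ℕ → ℕ) (K k : ℕ) : Module.End ℝ TestFn :=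
  if k = 0 then 1 else if k ≤ K + 1 then (cellAvg (F (n (k - 1)))).lin else 0

/-- The blocks of martingale differences between consecutive stops. -/
noncomputable def stopDiff (F : ℕ → ℤ × ℤ) (n : ℕ → ℕ) (K k : ℕ) : Module.End ℝ TestFn :=
  stopAvg F n K k - stopAvg F n K (k + 1)

section Stopping

variable {F : ℕ → ℤ × ℤ} {n : ℕ → ℕ} {K : ℕ} {𝒜 : Set Avg}

@[simp] lemma stopAvg_zero : stopAvg F n K 0 = 1 := if_pos rfl

lemma stopAvg_succ {k : ℕ} (hk : k ≤ K) : stopAvg F n K (k + 1) = (cellAvg (F (n k))).lin := by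
  simp [stopAvg, hk]

lemma stopAvg_last {k : ℕ} (hk : K + 1 < k) : stopAvg F n K k = 0 := by
  rw [stopAvg, if_neg (by omega), if_neg (by omega)]

lemma stopAvg_adj (k : ℕ) (f h : TestFn) :
    pair (stopAvg F n K k f) h = pair f (stopAvg F n K k h) := by
  unfold stopAvg
  split_ifs
  · simp
  · rw [pair_lin, cellAvg_symm]
  · simp

lemma stopAvg_comp (hF : ∀ i, F i ≤ F (i + 1)) (hn : Monotone n) {a b : ℕ} (hab : a ≤ b)
    (f : TestFn) : stopAvg F n K a (stopAvg F n K b f) = stopAvg F n K b f ∧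
      stopAvg F n K b (stopAvg F n K a f) = stopAvg F n K b f := by
  have hFm : Monotone F := monotone_nat_of_le_succ hF
  rcases Nat.eq_zero_or_pos a with rfl | ha
  · simp
  rcases lt_or_ge (K + 1) b with hb | hb
  · simp [stopAvg_last hb]
  · obtain ⟨a, rfl⟩ := Nat.exists_eq_add_of_le' ha
    obtain ⟨b, rfl⟩ := Nat.exists_eq_add_of_le' (le_trans ha hab)
    have h : F (n a) ≤ F (n b) := hFm (hn (by omega))
    rw [stopAvg_succ (by omega), stopAvg_succ (by omega)]
    exact ⟨cellAvg_lin_comp_of_le h f, cellAvg_lin_comp_of_ge h f⟩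

lemma stopDiff_adj (k : ℕ) (f h : TestFn) :
    pair (stopDiff F n K k f) h = pair f (stopDiff F n K k h) := by
  simp only [stopDiff, LinearMap.sub_apply, map_sub, stopAvg_adj]

lemma stopAvg_stopDiff (hF : ∀ i, F i ≤ F (i + 1)) (hn : Monotone n) (k : ℕ) (f : TestFn) :
    stopAvg F n K k (stopDiff F n K k f) = stopDiff F n K k f := by
  simp only [stopDiff, LinearMap.sub_apply, map_sub, (stopAvg_comp hF hn (le_refl k) f).1,
    (stopAvg_comp hF hn k.le_succ f).1]

lemma stopAvg_succ_stopDiff (hF : ∀ i, F i ≤ F (i + 1)) (hn : Monotone n) (k : ℕ) (f : TestFn) :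
    stopAvg F n K (k + 1) (stopDiff F n K k f) = 0 := by
  simp only [stopDiff, LinearMap.sub_apply, map_sub, (stopAvg_comp hF hn k.le_succ f).2,
    (stopAvg_comp hF hn (le_refl (k + 1)) f).1, sub_self]

lemma stopDiff_proj (hF : ∀ i, F i ≤ F (i + 1)) (hn : Monotone n) (k : ℕ) (f : TestFn) :
    stopDiff F n K k (stopDiff F n K k f) = stopDiff F n K k f := by
  conv_lhs => rw [stopDiff, LinearMap.sub_apply, ← stopDiff, stopAvg_stopDiff hF hn,
    stopAvg_succ_stopDiff hF hn, sub_zero]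

lemma sum_stopDiff (f : TestFn) :
    ∑ k ∈ Finset.range (K + 2), stopDiff F n K k f = f := by
  have := Finset.sum_range_sub' (fun k => stopAvg F n K k f) (K + 2)
  simpa [stopDiff, stopAvg_last (show K + 1 < K + 2 by omega)] using this

lemma IsChain.wnorm_stopAvg_le (hch : IsChain 𝒜 F n K) {C : ℝ} {U V : Plane → ℝ} (hC : 1 ≤ C)
    (hU : IsA1 𝒜 C U) (hV : IsA1 𝒜 C V) (k : ℕ) (f : TestFn) :
    wnorm (fun x => U x / V x) (stopAvg F n K k f) ≤
      C ^ 2 * wnorm (fun x => U x / V x) f := by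
  have h0 := wnorm_nonneg (fun x => ((hU.weight.div hV.weight).pos x).le) f
  have hC2 : 1 ≤ C ^ 2 := one_le_pow₀ hC
  unfold stopAvg
  split_ifs with h1 h2
  · simpa using le_mul_of_one_le_left h0 hC2
  · have hm := hch.mem (n (k - 1)) (hch.mono (by omega))
    exact wnorm_lin_le (by linarith) hU hV hm (by simpa using hm) f
  · have : wnorm (fun x => U x / V x) 0 = 0 := by simp [wnorm]
    simp only [LinearMap.zero_apply, this]
    positivity

lemma IsChain.wnorm_stopDiff_le (hch : IsChain 𝒜 F n K) {C : ℝ} {U V : Plane → ℝ} (hC : 1 ≤ C)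
    (hU : IsA1 𝒜 C U) (hV : IsA1 𝒜 C V) (k : ℕ) (f : TestFn) :
    wnorm (fun x => U x / V x) (stopDiff F n K k f) ≤
      4 * C ^ 2 * wnorm (fun x => U x / V x) f := by
  have h1 := wnorm_sub_le (hU.weight.div hV.weight) (stopAvg F n K k f) (stopAvg F n K (k + 1) f)
  have h2 := hch.wnorm_stopAvg_le hC hU hV k f
  have h3 := hch.wnorm_stopAvg_le hC hU hV (k + 1) f
  rw [stopDiff, LinearMap.sub_apply]
  linarith

/-- A block of martingale differences is controlled by its individual differences. -/
lemma IsChain.wnorm_block_le (hch : IsChain 𝒜 F n K) {C : ℝ} {U V : Plane → ℝ} (hC : 1 ≤ C)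
    (hU : IsA1 𝒜 C U) (hV : IsA1 𝒜 C V) {a b : ℕ} (hab : a ≤ b) (hb : b ≤ n K) (f : TestFn) :
    wnorm (ratioWeight U V) ((cellAvg (F a)).lin f - (cellAvg (F b)).lin f) ≤
      400 * C ^ 4 * ∑ i ∈ Finset.Ico a b, wnorm (ratioWeight U V)
        ((cellAvg (F i)).lin f - (cellAvg (F (i + 1))).lin f) := by
  have hw := isWeight_ratioWeight hU.weight hV.weight
  set d : ℕ → TestFn → TestFn := fun i f => (cellAvg (F i)).lin f - (cellAvg (F (i + 1))).lin f
    with hd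
  have htel : (cellAvg (F a)).lin f - (cellAvg (F b)).lin f = ∑ i ∈ Finset.Ico a b, d i f := by
    rw [Finset.sum_Ico_eq_sub _ hab, Finset.sum_range_sub', Finset.sum_range_sub']
    abel
  have hpd : ∀ i h, pair (d i f) h = pair (d i f) (d i h) := by
    intro i h
    have h1 := cellAvg_lin_comp_of_le (le_refl (F i)) f
    have h2 := cellAvg_lin_comp_of_le (hch.step i) f
    have h3 := cellAvg_lin_comp_of_ge (hch.step i) f
    have h4 := cellAvg_lin_comp_of_le (le_refl (F (i + 1))) f
    simp only [hd, map_sub, LinearMap.sub_apply, pair_lin, cellAvg_symm, h1, h2, h3, h4]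
    ring
  have hSQ : ∀ h, ∑ i ∈ Finset.Ico a b, wnorm (fun x => (ratioWeight U V x)⁻¹) (d i h) ≤
      400 * C ^ 4 * wnorm (fun x => (ratioWeight U V x)⁻¹) h := by
    intro h
    rw [ratioWeight_inv hU.weight hV.weight]
    refine le_trans (Finset.sum_le_sum_of_subset_of_nonneg (t := Finset.range (n K))
      (fun i hi => ?_) fun i _ _ => ?_) (sum_wnorm_sub_le hC hV hU (fun i _ => hch.step i)
        (fun i _ => hch.area i) hch.mem h)
    · rw [Finset.mem_Ico] at hi
      exact Finset.mem_range.2 (by omega)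
    · exact wnorm_nonneg (fun x => ((isWeight_ratioWeight hV.weight hU.weight).pos x).le) _
  have key : ∀ h, pair (∑ i ∈ Finset.Ico a b, d i f) h ≤
      (∑ i ∈ Finset.Ico a b, wnorm (ratioWeight U V) (d i f)) / 2 +
        200 * C ^ 4 * wnorm (fun x => (ratioWeight U V x)⁻¹) h := by
    intro h
    rw [map_sum, LinearMap.sum_apply]
    calc _ ≤ ∑ i ∈ Finset.Ico a b, (wnorm (ratioWeight U V) (d i f) / 2 +
          wnorm (fun x => (ratioWeight U V x)⁻¹) (d i h) / 2) := by
          refine Finset.sum_le_sum fun i _ => ?_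
          rw [hpd]
          have := pair_le hw one_pos (d i f) (d i h)
          rw [inv_one] at this
          linarith
      _ ≤ _ := by
          rw [Finset.sum_add_distrib, ← Finset.sum_div, ← Finset.sum_div]
          linarith [hSQ h]
  rw [htel]
  refine (wnorm_le_of_pair hw (by positivity) key).trans (le_of_eq ?_)
  ring

lemma sum_Ico_stops (hn : Monotone n) (hn0 : n 0 = 0) (a : ℕ → ℝ) (k : ℕ) :
    ∑ i ∈ Finset.range k, ∑ s ∈ Finset.Ico (n i) (n (i + 1)), a s =
      ∑ s ∈ Finset.range (n k), a s := by
  induction k with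
  | zero => simp [hn0]
  | succ k ih =>
    rw [Finset.sum_range_succ, ih, Finset.range_eq_Ico, Finset.range_eq_Ico,
      Finset.sum_Ico_consecutive _ (Nat.zero_le _) (hn k.le_succ)]

/-- The weighted square function estimate for the blocks. -/
lemma IsChain.sum_wnorm_stopDiff_le (hch : IsChain 𝒜 F n K) {C : ℝ} {U V : Plane → ℝ} (hC : 1 ≤ C)
    (hU : IsA1 𝒜 C U) (hV : IsA1 𝒜 C V) (f : TestFn) :
    ∑ k ∈ Finset.range (K + 2), wnorm (ratioWeight U V) (stopDiff F n K k f) ≤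
      200000 * C ^ 8 * wnorm (ratioWeight U V) f := by
  have hw := isWeight_ratioWeight hU.weight hV.weight
  have h0 := wnorm_nonneg (fun x => (hw.pos x).le) f
  have hE : ∀ i ≤ n K, wnorm (ratioWeight U V) ((cellAvg (F i)).lin f) ≤
      C ^ 2 * wnorm (ratioWeight U V) f := fun i hi =>
    wnorm_ratioWeight_lin_le hC hU hV (hch.mem i hi) (by simpa using hch.mem i hi) f
  have hmid : ∑ k ∈ Finset.range K, wnorm (ratioWeight U V) (stopDiff F n K (k + 1) f) ≤
      160000 * C ^ 8 * wnorm (ratioWeight U V) f := by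
    calc _ ≤ ∑ k ∈ Finset.range K, 400 * C ^ 4 * ∑ i ∈ Finset.Ico (n k) (n (k + 1)),
          wnorm (ratioWeight U V) ((cellAvg (F i)).lin f - (cellAvg (F (i + 1))).lin f) := by
          refine Finset.sum_le_sum fun k hk => ?_
          have hk' := Finset.mem_range.1 hk
          rw [stopDiff, LinearMap.sub_apply, stopAvg_succ hk'.le, stopAvg_succ hk']
          exact hch.wnorm_block_le hC hU hV (hch.mono k.le_succ) (hch.mono hk') f
      _ ≤ 400 * C ^ 4 * (400 * C ^ 4 * wnorm (ratioWeight U V) f) := by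
          rw [← Finset.mul_sum, sum_Ico_stops hch.mono hch.zero]
          gcongr
          exact sum_wnorm_sub_le hC hU hV (fun i _ => hch.step i)
            (fun i _ => hch.area i) hch.mem f
      _ = _ := by ring
  have hfirst : wnorm (ratioWeight U V) (stopDiff F n K 0 f) ≤
      2 * wnorm (ratioWeight U V) f + 2 * (C ^ 2 * wnorm (ratioWeight U V) f) := by
    rw [stopDiff, LinearMap.sub_apply, stopAvg_succ (Nat.zero_le _)]
    refine (wnorm_sub_le hw _ _).trans ?_
    have := hE (n 0) (hch.mono (Nat.zero_le _))
    simp only [stopAvg_zero, Module.End.one_apply]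
    linarith
  have hlast : wnorm (ratioWeight U V) (stopDiff F n K (K + 1) f) ≤
      C ^ 2 * wnorm (ratioWeight U V) f := by
    rw [stopDiff, LinearMap.sub_apply, stopAvg_succ le_rfl, stopAvg_last (by omega),
      LinearMap.zero_apply, sub_zero]
    exact hE _ le_rfl
  rw [Finset.sum_range_succ, Finset.sum_range_succ']
  have hC2 : C ^ 2 * wnorm (ratioWeight U V) f ≤ C ^ 8 * wnorm (ratioWeight U V) f := by
    gcongr
    norm_num
  have hC0 : 1 * wnorm (ratioWeight U V) f ≤ C ^ 8 * wnorm (ratioWeight U V) f := by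
    gcongr
    exact one_le_pow₀ hC
  have hC8 : 0 ≤ C ^ 8 * wnorm (ratioWeight U V) f := by positivity
  linarith

/-- A bound for an operator on `L²` passes to its adjoint. -/
lemma wnorm_one_le_of_adj {S T : Module.End ℝ TestFn} {M : ℝ} (hM : 0 < M)
    (hadj : ∀ f h, pair (T f) h = pair f (S h))
    (hS : ∀ f, wnorm (fun _ => 1) (S f) ≤ M * wnorm (fun _ => 1) f) (f : TestFn) :
    wnorm (fun _ => 1) (T f) ≤ M * wnorm (fun _ => 1) f := by
  have h1 : wnorm (fun _ => 1) (T f) = pair f (S (T f)) := by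
    rw [← hadj, pair_apply]
    simp [wnorm, pow_two]
  have h2 := pair_le IsWeight.one (inv_pos.2 hM) f (S (T f))
  have h3 := mul_le_mul_of_nonneg_left (hS (T f)) (inv_pos.2 hM).le
  rw [inv_mul_cancel_left₀ hM.ne'] at h3
  simp only [inv_one, inv_inv] at h2
  linarith

lemma sum_pow_dist_le {r : ℝ} (h0 : 0 < r) (h1 : r < 1) (i J : ℕ) :
    ∑ j ∈ Finset.range J, r ^ ((i - j) + (j - i)) ≤ 2 * (1 - r)⁻¹ := by
  have hg : ∀ n, ∑ j ∈ Finset.range n, r ^ j ≤ (1 - r)⁻¹ := fun n => by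
    rw [← tsum_geometric_of_lt_one h0.le h1]
    exact (summable_geometric_of_lt_one h0.le h1).sum_le_tsum _ fun j _ => by positivity
  have hsub : Finset.range J ⊆ Finset.range (i + J) := Finset.range_subset_range.2 (by omega)
  refine (Finset.sum_le_sum_of_subset_of_nonneg hsub fun j _ _ => by positivity).trans ?_
  rw [Finset.sum_range_add]
  have e1 : ∑ j ∈ Finset.range i, r ^ ((i - j) + (j - i)) ≤ (1 - r)⁻¹ := by
    rw [← Finset.sum_range_reflect]
    refine le_trans (Finset.sum_le_sum fun j hj => ?_) (hg i)
    have := Finset.mem_range.1 hj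
    exact pow_le_pow_of_le_one h0.le h1.le (by omega)
  have e2 : ∑ j ∈ Finset.range J, r ^ ((i - (i + j)) + (i + j - i)) ≤ (1 - r)⁻¹ := by
    refine le_trans (Finset.sum_le_sum fun j hj => ?_) (hg J)
    exact pow_le_pow_of_le_one h0.le h1.le (by omega)
  linarith

/-- Weighted bounds for a sum of skew averages whose interaction with the blocks decays. -/
lemma IsChain.wnorm_sum_skew_le (hch : IsChain 𝒜 F n K) {A : ℕ → Avg}
    (hA : ∀ j < K, A j ∈ 𝒜 ∧ (A j).symm ∈ 𝒜) {r C₁ : ℝ} (hr0 : 0 < r) (hr1 : r < 1)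
    (hC₁ : 0 < C₁)
    (hdec : ∀ i < K + 2, ∀ j < K, ∀ f, wnorm (fun _ => 1)
      (((A j).lin - (A j).symm.lin) (stopDiff F n K i f)) ≤
        C₁ * (r ^ ((i - j) + (j - i))) ^ 20 * wnorm (fun _ => 1) f)
    {C : ℝ} {U V : Plane → ℝ} (hC : 1 ≤ C) (hU : IsA1 𝒜 C U) (hV : IsA1 𝒜 C V) (f : TestFn) :
    wnorm (ratioWeight U V) (∑ j ∈ Finset.range K, ((A j).lin - (A j).symm.lin) f) ≤
      (2 * (1 - r)⁻¹) ^ 4 * (200000 * C ^ 8) ^ 2 *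
        ((4 * C₁) ^ (1 / 5 : ℝ) * (64 * C ^ 6) ^ (4 / 5 : ℝ)) * wnorm (ratioWeight U V) f := by
  have hone : IsA1 𝒜 1 (fun _ => 1) := IsA1.one le_rfl
  have hD1 : ∀ k f, wnorm (fun _ => 1) (stopDiff F n K k f) ≤ 4 * wnorm (fun _ => 1) f := by
    intro k f
    simpa using hch.wnorm_stopDiff_le le_rfl hone hone k f
  have hskew : ∀ j f h, pair (((A j).lin - (A j).symm.lin) f) h =
      -pair f (((A j).lin - (A j).symm.lin) h) := by
    intro j f h
    have e1 := pair_lin (A j) f h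
    have e2 : pair f ((A j).symm.lin h) = pair ((A j).lin f) h := pair_lin (A j).symm f h
    simp only [LinearMap.sub_apply, map_sub, e1, e2]
    ring
  have hleft : ∀ k < K + 2, ∀ j < K, ∀ f, wnorm (fun _ => 1)
      (stopDiff F n K k (((A j).lin - (A j).symm.lin) f)) ≤
        C₁ * (r ^ ((k - j) + (j - k))) ^ 20 * wnorm (fun _ => 1) f := by
    intro k hk j hj f
    refine wnorm_one_le_of_adj (T := stopDiff F n K k ∘ₗ ((A j).lin - (A j).symm.lin))
      (S := -(((A j).lin - (A j).symm.lin) ∘ₗ stopDiff F n K k)) (by positivity) (fun f h => ?_)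
      (fun f => ?_) f
    · rw [LinearMap.comp_apply, stopDiff_adj, hskew, LinearMap.neg_apply, map_neg,
        LinearMap.comp_apply]
    · rw [LinearMap.neg_apply, wnorm_neg]
      exact hdec k hk j hj f
  have hBw : ∀ j < K, ∀ f, wnorm (fun x => U x / V x) (((A j).lin - (A j).symm.lin) f) ≤
      4 * C ^ 2 * wnorm (fun x => U x / V x) f := by
    intro j hj f
    have h1 := wnorm_lin_le (by linarith) hU hV (hA j hj).1 (hA j hj).2 f
    have h2 := wnorm_lin_le (by linarith) hU hV (hA j hj).2 (hA j hj).1 f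
    rw [LinearMap.sub_apply]
    linarith [wnorm_sub_le (hU.weight.div hV.weight) ((A j).lin f) ((A j).symm.lin f)]
  refine wnorm_sum_le_of_decay (isWeight_ratioWeight hU.weight hV.weight)
    (D := stopDiff F n K) (B := fun j => (A j).lin - (A j).symm.lin) (M := K + 2)
    (κ := fun i j => r ^ ((i - j) + (j - i)))
    (mul_pos two_pos (inv_pos.2 (by linarith))) (by positivity) (by positivity)
    sum_stopDiff (stopDiff_proj hch.step hch.mono) stopDiff_adj
    (hch.sum_wnorm_stopDiff_le hC hU hV) ?_ (fun i j => by positivity)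
    (fun i => sum_pow_dist_le hr0 hr1 i K) (fun j => ?_) ?_ f
  · rw [ratioWeight_inv hU.weight hV.weight]
    exact hch.sum_wnorm_stopDiff_le hC hV hU
  · refine le_trans (le_of_eq ?_) (sum_pow_dist_le hr0 hr1 j (K + 2))
    exact Finset.sum_congr rfl fun i _ => by rw [add_comm]
  · intro k hk j hj i hi f
    set a := r ^ ((k - j) + (j - k)) with ha
    set b := r ^ ((i - j) + (j - i)) with hb
    have ha0 : 0 < a := by positivity
    have hb0 : 0 < b := by positivity
    set T : Module.End ℝ TestFn :=
      stopDiff F n K k ∘ₗ ((A j).lin - (A j).symm.lin) ∘ₗ stopDiff F n K i with hT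
    have h₀ : ∀ f, wnorm (fun _ => 1) (T f) ≤ 4 * C₁ * (a * b) ^ 10 * wnorm (fun _ => 1) f := by
      intro f
      have hN := wnorm_nonneg (w := fun _ => 1) (fun _ => zero_le_one) f
      have g1 : wnorm (fun _ => 1) (T f) ≤ 4 * C₁ * wnorm (fun _ => 1) f * b ^ 20 := by
        refine (hD1 k _).trans ?_
        have := hdec i hi j hj f
        rw [LinearMap.comp_apply]
        linarith
      have g2 : wnorm (fun _ => 1) (T f) ≤ 4 * C₁ * wnorm (fun _ => 1) f * a ^ 20 := by
        refine (hleft k hk j hj _).trans ?_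
        have := mul_le_mul_of_nonneg_left (hD1 i f) (by positivity : 0 ≤ C₁ * a ^ 20)
        linarith
      have hm : 0 ≤ 4 * C₁ * wnorm (fun _ => 1) f := by positivity
      rcases le_total a b with hab | hab
      · refine g2.trans ?_
        have : a ^ 20 ≤ (a * b) ^ 10 := by
          rw [mul_pow, show 20 = 10 + 10 from rfl, pow_add]
          gcongr
        nlinarith
      · refine g1.trans ?_
        have : b ^ 20 ≤ (a * b) ^ 10 := by
          rw [mul_pow, show 20 = 10 + 10 from rfl, pow_add]
          gcongr
        nlinarith
    have h₁ : ∀ f, wnorm (fun x => U x / V x) (T f) ≤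
        64 * C ^ 6 * wnorm (fun x => U x / V x) f := by
      intro f
      have g1 := hch.wnorm_stopDiff_le hC hU hV k (((A j).lin - (A j).symm.lin)
        (stopDiff F n K i f))
      have g2 := hBw j hj (stopDiff F n K i f)
      have g3 := hch.wnorm_stopDiff_le hC hU hV i f
      calc _ ≤ 4 * C ^ 2 * (4 * C ^ 2 * (4 * C ^ 2 * wnorm (fun x => U x / V x) f)) :=
            g1.trans (by gcongr; exact g2.trans (by gcongr))
        _ = _ := by ring
    refine (wnorm_interp (hU.weight.div hV.weight) (by norm_num : (0 : ℝ) < 4 / 5) (by norm_num)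
      (by positivity) (by positivity) h₀ h₁ f).trans (le_of_eq ?_)
    have e : (4 * C₁ * (a * b) ^ 10) ^ (1 - 4 / 5 : ℝ) = (4 * C₁) ^ (1 / 5 : ℝ) * (a * b) ^ 2 := by
      rw [Real.mul_rpow (by positivity) (by positivity), ← Real.rpow_natCast (a * b) 10,
        ← Real.rpow_mul (by positivity), ← Real.rpow_natCast (a * b) 2]
      norm_num
    have e' : wnorm (ratioWeight U V) f = wnorm (fun x => (U x / V x) ^ (4 / 5 : ℝ)) f := rfl
    rw [e, e']
    ring

end Stopping

/-- A measure on the plane of mass at most one and with bounded support. -/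
structure SubProb (ν : Measure Plane) (R : ℝ) : Prop where
  mass : ν Set.univ ≤ 1
  rad : ∀ᵐ y ∂ν, ‖y‖ ≤ R

lemma SubProb.isFiniteMeasure {ν : Measure Plane} {R : ℝ} (h : SubProb ν R) :
    IsFiniteMeasure ν := ⟨h.mass.trans_lt ENNReal.one_lt_top⟩

section Conv

variable {ν : Measure Plane} {R : ℝ}

/-- The kernel sending `x` to the law of `T x y` when `y` has law `ν`. -/
noncomputable def mapKernel (ν : Measure Plane) [SFinite ν] (T : Plane × Plane → Plane)
    (hT : Measurable T) : Kernel Plane Plane where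
  toFun x := ν.map fun y => T (x, y)
  measurable' := by
    refine Measure.measurable_of_measurable_coe _ fun s hs => ?_
    have : ∀ x, ν.map (fun y => T (x, y)) s = ν (Prod.mk x ⁻¹' (T ⁻¹' s)) := fun x =>
      Measure.map_apply (hT.comp measurable_prodMk_left) hs
    simp only [this]
    exact measurable_measure_prodMk_left (hT hs)

/-- Convolution with a measure. -/
noncomputable def convAvg (h : SubProb ν R) : Avg :=
  have := h.isFiniteMeasure
  { ker := mapKernel ν (fun z => z.1 - z.2) (by fun_prop)
    adj := mapKernel ν (fun z => z.1 + z.2) (by fun_prop)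
    rad := R
    ker_mass := fun x => by
      rw [mapKernel, Kernel.coe_mk, Measure.map_apply (by fun_prop) MeasurableSet.univ]
      exact h.mass
    adj_mass := fun x => by
      rw [mapKernel, Kernel.coe_mk, Measure.map_apply (by fun_prop) MeasurableSet.univ]
      exact h.mass
    ker_rad := fun x => by
      rw [mapKernel, Kernel.coe_mk, ae_map_iff (by fun_prop)
        (measurableSet_le (by fun_prop) measurable_const)]
      filter_upwards [h.rad] with y hy
      simpa using hy
    adj_rad := fun x => by
      rw [mapKernel, Kernel.coe_mk, ae_map_iff (by fun_prop)
        (measurableSet_le (by fun_prop) measurable_const)]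
      filter_upwards [h.rad] with y hy
      simpa using hy
    dual := fun F hF => by
      simp only [mapKernel, Kernel.coe_mk]
      have e1 : ∀ x, ∫⁻ y, F (x, y) ∂ν.map (fun y => x - y) = ∫⁻ y, F (x, x - y) ∂ν := fun x =>
        lintegral_map (by fun_prop) (by fun_prop)
      have e2 : ∀ x, ∫⁻ y, F (y, x) ∂ν.map (fun y => x + y) = ∫⁻ y, F (x + y, x) ∂ν := fun x =>
        lintegral_map (by fun_prop) (by fun_prop)
      simp only [e1, e2]
      rw [lintegral_lintegral_swap (μ := volume) (ν := ν) (by fun_prop)]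
      conv_rhs => rw [lintegral_lintegral_swap (μ := volume) (ν := ν) (by fun_prop)]
      refine lintegral_congr fun y => ?_
      rw [← lintegral_add_right_eq_self (μ := volume) _ y]
      simp }

lemma convAvg_op (h : SubProb ν R) {f : Plane → ℝ} (hf : Measurable f) (x : Plane) :
    (convAvg h).op f x = ∫ y, f (x - y) ∂ν :=
  integral_map (φ := fun y => x - y) (by fun_prop) hf.aestronglyMeasurable

lemma convAvg_symm_op (h : SubProb ν R) {f : Plane → ℝ} (hf : Measurable f) (x : Plane) :
    (convAvg h).symm.op f x = ∫ y, f (x + y) ∂ν :=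
  integral_map (φ := fun y => x + y) (by fun_prop) hf.aestronglyMeasurable

lemma subProb_dirac (a : Plane) : SubProb (Measure.dirac a) ‖a‖ :=
  ⟨by simp, by rw [ae_dirac_iff (measurableSet_le (by fun_prop) measurable_const)]⟩

/-- Translation of functions on the plane. -/
noncomputable def shift (a : Plane) : Module.End ℝ TestFn := (convAvg (subProb_dirac a)).lin

@[simp] lemma shift_apply (a : Plane) (f : TestFn) (x : Plane) : shift a f x = f (x - a) := by
  rw [shift, Avg.lin_apply, convAvg_op _ f.measurable, integral_dirac]

lemma shift_zero (f : TestFn) : shift 0 f = f := by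
  ext x
  simp

lemma pair_shift_shift (a b : Plane) (f g : TestFn) :
    pair (shift a f) (shift b g) = pair f (shift (b - a) g) := by
  simp only [pair_apply, shift_apply]
  rw [← integral_add_right_eq_self _ a]
  simp [sub_sub_eq_add_sub]

lemma shift_convAvg (h : SubProb ν R) (a : Plane) (f : TestFn) :
    shift a ((convAvg h).lin f) = (convAvg h).lin (shift a f) := by
  ext x
  simp only [shift_apply, Avg.lin_apply]
  rw [convAvg_op h f.measurable, convAvg_op h (shift a f).measurable]
  simp [sub_right_comm]

lemma exists_norm_le (f : TestFn) : ∃ C, 0 ≤ C ∧ ∀ x, |f x| ≤ C := by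
  obtain ⟨-, C, hC⟩ := f.2
  exact ⟨C, (abs_nonneg _).trans (hC 0).1, fun x => (hC x).1⟩

lemma integrable_mul_shift (h : SubProb ν R) (f g : TestFn) :
    Integrable (Function.uncurry fun (x y : Plane) => f x * g (x - y)) (volume.prod ν) := by
  have := h.isFiniteMeasure
  obtain ⟨C, hC0, hC⟩ := exists_norm_le g
  refine Integrable.mono' (g := fun z => |f z.1| * C)
    ((f.integrable.abs.mul_prod (integrable_const C)))
    ((f.measurable.comp measurable_fst).mul
      (g.measurable.comp (measurable_fst.sub measurable_snd))).aestronglyMeasurable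
    (ae_of_all _ fun z => ?_)
  rw [Function.uncurry, Real.norm_eq_abs, abs_mul]
  gcongr
  exact hC _

/-- Testing against a convolution is an average of correlations. -/
lemma pair_convAvg (h : SubProb ν R) (f g : TestFn) :
    pair f ((convAvg h).lin g) = ∫ y, pair f (shift y g) ∂ν := by
  have := h.isFiniteMeasure
  simp only [pair_apply, shift_apply, Avg.lin_apply, convAvg_op h g.measurable,
    ← integral_const_mul]
  exact integral_integral_swap (integrable_mul_shift h f g)

lemma pair_convAvg_convAvg (h : SubProb ν R) (a : Plane) (f : TestFn) :
    pair ((convAvg h).lin f) (shift a ((convAvg h).lin f)) =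
      ∫ y, ∫ z, pair f (shift (y + a - z) f) ∂ν ∂ν := by
  rw [shift_convAvg, pair_convAvg]
  refine integral_congr_ae (ae_of_all _ fun y => ?_)
  dsimp only
  rw [pair_comm, pair_convAvg]
  refine integral_congr_ae (ae_of_all _ fun z => ?_)
  dsimp only
  rw [pair_comm, pair_shift_shift z]
  simp only [pair_apply, shift_apply]
  congr! 4
  abel

end Conv

open WithLp FourierTransform in
/-- Autocorrelations of smooth functions are cosine transforms of a finite measure. -/
lemma exists_spectral_measure (g : TestFn) (hg : ContDiff ℝ (⊤ : ℕ∞) g)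
    (hgc : HasCompactSupport g) :
    ∃ m : Measure Plane, IsFiniteMeasure m ∧ ∀ a : Plane,
      pair g (shift a g) = ∫ ξ, Real.cos (2 * Real.pi * (a.1 * ξ.1 + a.2 * ξ.2)) ∂m := by
  let E := WithLp 2 (ℝ × ℝ)
  let G : Plane → E → ℂ := fun a x => ((g (ofLp x - a) : ℝ) : ℂ)
  have hsmooth : ∀ a, ContDiff ℝ (⊤ : ℕ∞) (G a) := fun a =>
    Complex.ofRealCLM.contDiff.comp (hg.comp
      (((WithLp.prodContinuousLinearEquiv 2 ℝ ℝ ℝ).contDiff).sub contDiff_const))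
  have hcs : ∀ a, HasCompactSupport (G a) := fun a => by
    let e : E ≃ₜ Plane := (WithLp.prodContinuousLinearEquiv 2 ℝ ℝ ℝ).toHomeomorph.trans
      (Homeomorph.subRight a)
    have := (hgc.comp_homeomorph e)
    exact this.comp_left (g := fun r : ℝ => (r : ℂ)) Complex.ofReal_zero
  let S : Plane → SchwartzMap E ℂ := fun a => (hcs a).toSchwartzMap (hsmooth a)
  have hS : ∀ a x, S a x = ((g (ofLp x - a) : ℝ) : ℂ) := fun a x => rfl
  have hF : ∀ a ξ, 𝓕 (S a) ξ =
      Complex.exp (((-(2 * Real.pi * (a.1 * ξ.fst + a.2 * ξ.snd)) : ℝ) : ℂ) * Complex.I) *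
        𝓕 (S 0) ξ := by
    intro a ξ
    rw [SchwartzMap.fourier_coe, SchwartzMap.fourier_coe, Real.fourier_eq', Real.fourier_eq']
    rw [← integral_add_right_eq_self _ (toLp 2 a : E), ← integral_const_mul]
    refine integral_congr_ae (ae_of_all _ fun v => ?_)
    simp only [hS, ofLp_add, add_sub_cancel_right, sub_zero, inner_add_left, smul_eq_mul,
      ← mul_assoc, ← Complex.exp_add]
    congr 2
    have hin : inner ℝ (toLp 2 a : WithLp 2 (ℝ × ℝ)) ξ = a.1 * ξ.fst + a.2 * ξ.snd := by
      rw [WithLp.prod_inner_apply]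
      simp [mul_comm]
    rw [hin]
    push_cast
    ring
  let φ : E → ℝ := fun ξ => ‖𝓕 (S 0) ξ‖ ^ 2
  have hφm : Measurable φ := ((𝓕 (S 0)).continuous.norm.pow 2).measurable
  have hφi : Integrable φ := by
    have := ((𝓕 (S 0)).memLp 2 volume).integrable_norm_pow (by norm_num)
    simpa using this
  have hmp := WithLp.volume_preserving_ofLp ℝ ℝ
  have hemb : MeasurableEmbedding (ofLp : E → Plane) :=
    (MeasurableEquiv.toLp 2 (ℝ × ℝ)).symm.measurableEmbedding
  let m : Measure Plane := (volume.withDensity fun ξ : E => ENNReal.ofReal (φ ξ)).map ofLp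
  refine ⟨m, ?_, fun a => ?_⟩
  · have : IsFiniteMeasure (volume.withDensity fun ξ : E => ENNReal.ofReal (φ ξ)) :=
      isFiniteMeasure_withDensity_ofReal hφi.2
    exact Measure.isFiniteMeasure_map _ _
  · have h1 := SchwartzMap.integral_inner_fourier_fourier (S 0) (S a)
    have h2 : ∫ x, inner ℂ (S 0 x) (S a x) = ((pair g (shift a g) : ℝ) : ℂ) := by
      rw [pair_apply, ← hmp.integral_comp hemb, ← integral_complex_ofReal]
      refine integral_congr_ae (ae_of_all _ fun x => ?_)
      simp [hS, mul_comm]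
    have h3 : ∀ ξ, (inner ℂ (𝓕 (S 0) ξ) (𝓕 (S a) ξ)).re =
        φ ξ * Real.cos (2 * Real.pi * (a.1 * ξ.fst + a.2 * ξ.snd)) := by
      intro ξ
      rw [hF a ξ, RCLike.inner_apply, mul_assoc, Complex.mul_conj, Complex.normSq_eq_norm_sq,
        Complex.re_mul_ofReal, Complex.exp_ofReal_mul_I_re, Real.cos_neg, mul_comm]
    have h4 : pair g (shift a g) =
        ∫ ξ : E, φ ξ * Real.cos (2 * Real.pi * (a.1 * ξ.fst + a.2 * ξ.snd)) := by
      have hi : Integrable fun ξ => inner ℂ (𝓕 (S 0) ξ) (𝓕 (S a) ξ) :=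
        hφi.mono' ((𝓕 (S 0)).continuous.inner (𝓕 (S a)).continuous).aestronglyMeasurable
          (ae_of_all _ fun ξ => (norm_inner_le_norm _ _).trans (by
            rw [hF a ξ, norm_mul, Complex.norm_exp_ofReal_mul_I, one_mul, ← pow_two]))
      have := congrArg Complex.re (h1.trans h2)
      rw [Complex.ofReal_re] at this
      rw [← this]
      simp only [← h3]
      exact integral_re hi |>.symm
    rw [h4, hemb.integral_map, integral_withDensity_eq_integral_toReal_smul (by fun_prop)
      (ae_of_all _ fun _ => ENNReal.ofReal_lt_top)]
    refine integral_congr_ae (ae_of_all _ fun ξ => ?_)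
    simp only [smul_eq_mul]
    rw [ENNReal.toReal_ofReal (by positivity)]
    rfl

section Spectral

variable {ν : Measure Plane} {R : ℝ}

/-- The squared modulus of the Fourier transform of a measure. -/
noncomputable def fourierSq (ν : Measure Plane) (ξ : Plane) : ℝ :=
  (∫ y, Real.cos (2 * Real.pi * (y.1 * ξ.1 + y.2 * ξ.2)) ∂ν) ^ 2 +
    (∫ y, Real.sin (2 * Real.pi * (y.1 * ξ.1 + y.2 * ξ.2)) ∂ν) ^ 2

lemma integral_cos_sub [IsFiniteMeasure ν] (a ξ : Plane) :
    ∫ y, ∫ z, Real.cos (2 * Real.pi *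
      ((y.1 + a.1 - z.1) * ξ.1 + (y.2 + a.2 - z.2) * ξ.2)) ∂ν ∂ν =
      Real.cos (2 * Real.pi * (a.1 * ξ.1 + a.2 * ξ.2)) * fourierSq ν ξ := by
  set θ : Plane → ℝ := fun y => 2 * Real.pi * (y.1 * ξ.1 + y.2 * ξ.2) with hθ
  have hθm : Measurable θ := by fun_prop
  have ic : Integrable (fun y => Real.cos (θ y)) ν :=
    Integrable.of_bound (C := 1) (by fun_prop) (ae_of_all _ fun _ => Real.abs_cos_le_one _)
  have is : Integrable (fun y => Real.sin (θ y)) ν :=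
    Integrable.of_bound (C := 1) (by fun_prop) (ae_of_all _ fun _ => Real.abs_sin_le_one _)
  set c := ∫ y, Real.cos (θ y) ∂ν with hc
  set s := ∫ y, Real.sin (θ y) ∂ν with hs
  have e : ∀ y z : Plane, Real.cos (2 * Real.pi *
      ((y.1 + a.1 - z.1) * ξ.1 + (y.2 + a.2 - z.2) * ξ.2)) =
      Real.cos (θ y + θ a) * Real.cos (θ z) + Real.sin (θ y + θ a) * Real.sin (θ z) := by
    intro y z
    rw [← Real.cos_sub]
    congr 1
    simp only [hθ]
    ring
  have e2 : ∀ y, ∫ z, Real.cos (2 * Real.pi *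
      ((y.1 + a.1 - z.1) * ξ.1 + (y.2 + a.2 - z.2) * ξ.2)) ∂ν =
      (Real.cos (θ a) * c + Real.sin (θ a) * s) * Real.cos (θ y) +
        (Real.cos (θ a) * s - Real.sin (θ a) * c) * Real.sin (θ y) := by
    intro y
    simp only [e]
    rw [integral_add (ic.const_mul _) (is.const_mul _), integral_const_mul, integral_const_mul,
      ← hc, ← hs, Real.cos_add, Real.sin_add]
    ring
  simp only [e2]
  rw [integral_add (ic.const_mul _) (is.const_mul _), integral_const_mul, integral_const_mul,
    ← hc, ← hs]
  change _ = Real.cos (θ a) * (c ^ 2 + s ^ 2)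
  ring

/-- `L²` modulus of continuity of a convolution, for smooth functions. -/
lemma wnorm_sub_shift_le_of_smooth (h : SubProb ν R) (a : Plane) {ε : ℝ}
    (hε : ∀ ξ : Plane, (1 - Real.cos (2 * Real.pi * (a.1 * ξ.1 + a.2 * ξ.2))) * fourierSq ν ξ ≤ ε)
    (g : TestFn) (hg : ContDiff ℝ (⊤ : ℕ∞) g) (hgc : HasCompactSupport g) :
    wnorm (fun _ => 1) ((convAvg h).lin g - shift a ((convAvg h).lin g)) ≤
      2 * ε * wnorm (fun _ => 1) g := by
  have := h.isFiniteMeasure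
  obtain ⟨m, hm, hR⟩ := exists_spectral_measure g hg hgc
  have hw : ∀ f : TestFn, wnorm (fun _ => 1) f = pair f f := fun f => by
    simp [wnorm, pair_apply, pow_two]
  have hmass : wnorm (fun _ => 1) g = m.real Set.univ := by
    have := hR 0
    rw [shift_zero] at this
    rw [hw, this]
    simp
  have hcorr : ∀ b, pair ((convAvg h).lin g) (shift b ((convAvg h).lin g)) =
      ∫ ξ, Real.cos (2 * Real.pi * (b.1 * ξ.1 + b.2 * ξ.2)) * fourierSq ν ξ ∂m := by
    intro b
    rw [pair_convAvg_convAvg]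
    simp only [hR, Prod.fst_add, Prod.snd_add, Prod.fst_sub, Prod.snd_sub, ← integral_cos_sub]
    have i2 : Integrable (fun p : (Plane × Plane) × Plane => Real.cos (2 * Real.pi *
      ((p.1.1.1 + b.1 - p.1.2.1) * p.2.1 + (p.1.1.2 + b.2 - p.1.2.2) * p.2.2)))
      ((ν.prod ν).prod m) :=
      Integrable.of_bound (C := 1) (by fun_prop) (ae_of_all _ fun _ => Real.abs_cos_le_one _)
    have j1 := integral_integral (μ := ν) (ν := ν) (f := fun y z => ∫ ξ, Real.cos (2 * Real.pi *
      ((y.1 + b.1 - z.1) * ξ.1 + (y.2 + b.2 - z.2) * ξ.2)) ∂m) i2.integral_prod_left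
    rw [j1]
    rw [integral_integral_swap i2]
    refine integral_congr_ae (ae_of_all _ fun ξ => ?_)
    dsimp only
    exact (integral_integral (μ := ν) (ν := ν) (f := fun y z => Real.cos (2 * Real.pi *
      ((y.1 + b.1 - z.1) * ξ.1 + (y.2 + b.2 - z.2) * ξ.2)))
      (Integrable.of_bound (C := 1) (by fun_prop)
        (ae_of_all _ fun _ => Real.abs_cos_le_one _))).symm
  have hFm : Measurable (fourierSq ν) := by
    unfold fourierSq
    refine Measurable.add (Measurable.pow_const ?_ 2) (Measurable.pow_const ?_ 2)
    · exact (StronglyMeasurable.integral_prod_right (f := fun ξ y : Plane =>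
        Real.cos (2 * Real.pi * (y.1 * ξ.1 + y.2 * ξ.2)))
        (by fun_prop : Measurable _).stronglyMeasurable).measurable
    · exact (StronglyMeasurable.integral_prod_right (f := fun ξ y : Plane =>
        Real.sin (2 * Real.pi * (y.1 * ξ.1 + y.2 * ξ.2)))
        (by fun_prop : Measurable _).stronglyMeasurable).measurable
  have hFb : ∀ ξ, |fourierSq ν ξ| ≤ 2 := by
    intro ξ
    have hν : ν.real Set.univ ≤ 1 :=
      ENNReal.toReal_le_of_le_ofReal zero_le_one (by simpa using h.mass)
    have b1 : |∫ y, Real.cos (2 * Real.pi * (y.1 * ξ.1 + y.2 * ξ.2)) ∂ν| ≤ 1 := by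
      rw [← Real.norm_eq_abs]
      exact (norm_integral_le_of_norm_le_const (C := 1) (ae_of_all _ fun y =>
        Real.abs_cos_le_one _)).trans (by simpa using hν)
    have b2 : |∫ y, Real.sin (2 * Real.pi * (y.1 * ξ.1 + y.2 * ξ.2)) ∂ν| ≤ 1 := by
      rw [← Real.norm_eq_abs]
      exact (norm_integral_le_of_norm_le_const (C := 1) (ae_of_all _ fun y =>
        Real.abs_sin_le_one _)).trans (by simpa using hν)
    rw [fourierSq, abs_of_nonneg (by positivity)]
    have := (sq_le_one_iff_abs_le_one _).2 b1
    have := (sq_le_one_iff_abs_le_one _).2 b2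
    linarith
  have ib : ∀ b : Plane, Integrable (fun ξ : Plane =>
      Real.cos (2 * Real.pi * (b.1 * ξ.1 + b.2 * ξ.2)) * fourierSq ν ξ) m := fun b =>
    Integrable.of_bound (C := 1 * 2) (by fun_prop) (ae_of_all _ fun ξ => by
      rw [Real.norm_eq_abs, abs_mul]
      exact mul_le_mul (Real.abs_cos_le_one _) (hFb ξ) (abs_nonneg _) zero_le_one)
  set u := (convAvg h).lin g with hu
  have e1 : wnorm (fun _ => 1) (u - shift a u) = 2 * (pair u (shift 0 u) - pair u (shift a u)) := by
    have h1 : pair (shift a u) (shift a u) = pair u (shift 0 u) := by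
      rw [pair_shift_shift, sub_self]
    rw [hw]
    simp only [map_sub, LinearMap.sub_apply, h1, shift_zero, pair_comm (shift a u) u]
    ring
  rw [e1, hcorr, hcorr, ← integral_sub (ib 0) (ib a), mul_assoc]
  gcongr
  calc _ ≤ ∫ _, ε ∂m := by
        refine integral_mono ((ib 0).sub (ib a)) (integrable_const _) fun ξ => ?_
        refine le_trans (le_of_eq ?_) (hε ξ)
        simp
        ring
    _ = _ := by rw [hmass]; simp [mul_comm]

lemma wnorm_sub_shift_self_le (a : Plane) (f : TestFn) :
    wnorm (fun _ => 1) (f - shift a f) ≤ 4 * wnorm (fun _ => 1) f := by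
  have h := wnorm_sub_le (IsWeight.one) f (shift a f)
  have h2 : wnorm (fun _ => 1) (shift a f) ≤ wnorm (fun _ => 1) f := wnorm_one_lin_le _ f
  linarith

lemma exists_smooth_wnorm_sub_le (f : TestFn) {δ : ℝ} (hδ : 0 < δ) :
    ∃ g : TestFn, ContDiff ℝ (⊤ : ℕ∞) g ∧ HasCompactSupport g ∧
      wnorm (fun _ => 1) (f - g) ≤ δ := by
  have hf : MemLp (f : Plane → ℝ) 2 volume :=
    (memLp_two_iff_integrable_sq f.measurable.aestronglyMeasurable).2
      (by simpa using f.integrable_sq_mul (LocBdd.const 1))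
  obtain ⟨g, hgc, hg, hfg⟩ := hf.exist_eLpNorm_sub_le (by norm_num) (by norm_num)
    (Real.sqrt_pos.2 hδ)
  obtain ⟨C, hC⟩ := hgc.exists_bound_of_continuous hg.continuous
  obtain ⟨R, hR⟩ := hgc.isCompact.isBounded.subset_closedBall 0
  let G : TestFn := ⟨g, hg.continuous.measurable, max C R, fun x =>
    ⟨(hC x).trans (le_max_left _ _), fun hx => by
      by_contra h
      have := hR (subset_tsupport g h)
      rw [mem_closedBall_zero_iff] at this
      exact absurd ((le_max_right C R).trans_lt hx) (not_lt.2 this)⟩⟩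
  refine ⟨G, hg, hgc, ?_⟩
  have hi : MemLp ((f - G : TestFn) : Plane → ℝ) 2 volume :=
    hf.sub (hg.continuous.memLp_of_hasCompactSupport hgc)
  have h1 := hi.eLpNorm_eq_integral_rpow_norm (by norm_num) (by norm_num)
  have h2 : eLpNorm ((f - G : TestFn) : Plane → ℝ) 2 volume ≤ ENNReal.ofReal (√δ) := hfg
  rw [h1, ENNReal.ofReal_le_ofReal_iff (Real.sqrt_nonneg _)] at h2
  simp only [ENNReal.toReal_ofNat, Real.rpow_two, ← one_div, ← Real.sqrt_eq_rpow] at h2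
  have h3 := (Real.sqrt_le_sqrt_iff hδ.le).1 h2
  simpa [wnorm] using h3

/-- `L²` modulus of continuity of a convolution. -/
lemma wnorm_sub_shift_le (h : SubProb ν R) (a : Plane) {ε : ℝ} (hε0 : 0 ≤ ε)
    (hε : ∀ ξ : Plane, (1 - Real.cos (2 * Real.pi * (a.1 * ξ.1 + a.2 * ξ.2))) * fourierSq ν ξ ≤ ε)
    (f : TestFn) :
    wnorm (fun _ => 1) ((convAvg h).lin f - shift a ((convAvg h).lin f)) ≤
      8 * ε * wnorm (fun _ => 1) f := by
  refine le_of_forall_pos_le_add fun δ hδ => ?_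
  obtain ⟨g, hg, hgc, hfg⟩ := exists_smooth_wnorm_sub_le f
    (show 0 < δ / (8 * ε + 8) by positivity)
  have h1 := wnorm_sub_shift_le_of_smooth h a hε g hg hgc
  have h2 := wnorm_sub_shift_self_le a ((convAvg h).lin (f - g))
  have h3 := wnorm_one_lin_le (convAvg h) (f - g)
  have h4 : wnorm (fun _ => 1) g ≤ 2 * wnorm (fun _ => 1) f + 2 * wnorm (fun _ => 1) (f - g) := by
    have := wnorm_sub_le IsWeight.one f (f - g)
    rwa [sub_sub_cancel] at this
  have h5 := wnorm_add_le IsWeight.one ((convAvg h).lin g - shift a ((convAvg h).lin g))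
    ((convAvg h).lin (f - g) - shift a ((convAvg h).lin (f - g)))
  have e : (convAvg h).lin g - shift a ((convAvg h).lin g) +
      ((convAvg h).lin (f - g) - shift a ((convAvg h).lin (f - g))) =
      (convAvg h).lin f - shift a ((convAvg h).lin f) := by
    simp only [map_sub]
    abel
  rw [e] at h5
  have h6 : (8 * ε + 8) * wnorm (fun _ => 1) (f - g) ≤ δ := by
    rw [le_div_iff₀ (by positivity)] at hfg
    linarith
  have h7 := mul_le_mul_of_nonneg_left h4 hε0
  nlinarith

end Spectral

/-- Jensen's inequality for averaging operators. -/
lemma Avg.sq_op_le (A : Avg) {g : Plane → ℝ} (hg : LocBdd g) (x : Plane) :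
    A.op g x ^ 2 ≤ A.op (fun y => g y ^ 2) x := by
  have h := A.op_sq_le hg (LocBdd.const 1) (by simpa using hg.sq) (fun _ => one_pos) x
  simp only [div_one] at h
  refine h.trans (mul_le_of_le_one_right (A.op_nonneg (fun _ => sq_nonneg _) x) ?_)
  exact A.op_const_le zero_le_one x

/-- Pointwise form of the comparison of a function with its averages. -/
lemma Avg.ofReal_sq_op_le (A : Avg) {g : Plane → ℝ} (hg : LocBdd g) (x : Plane) :
    ENNReal.ofReal (A.op g x ^ 2) ≤ ∫⁻ y, ENNReal.ofReal (g y ^ 2) ∂A.ker x := by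
  rw [← ofReal_integral_eq_lintegral_ofReal (A.integrable hg.sq x)
    (ae_of_all _ fun _ => sq_nonneg _)]
  exact ENNReal.ofReal_le_ofReal (A.sq_op_le hg x)

lemma ofReal_wnorm_one (f : TestFn) :
    ENNReal.ofReal (wnorm (fun _ => 1) f) = ∫⁻ x, ENNReal.ofReal (f x ^ 2) := by
  simpa using ofReal_wnorm (LocBdd.const 1) (fun _ => zero_le_one) f

/-- The rectangle `[-2 ^ s.1, 2 ^ s.1] × [-2 ^ s.2, 2 ^ s.2]`. -/
def box (s : ℤ × ℤ) : Set Plane :=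
  Set.Icc (-2 ^ s.1) (2 ^ s.1) ×ˢ Set.Icc (-2 ^ s.2) (2 ^ s.2)

lemma measurableSet_box (s : ℤ × ℤ) : MeasurableSet (box s) :=
  measurableSet_Icc.prod measurableSet_Icc

lemma volume_box (s : ℤ × ℤ) : volume (box s) = ENNReal.ofReal (4 * area s) := by
  rw [box, Measure.volume_eq_prod, Measure.prod_prod, Real.volume_Icc, Real.volume_Icc,
    ← ENNReal.ofReal_mul (by have : (0 : ℝ) < 2 ^ s.1 := by positivity
                             linarith), area]
  congr 1
  ring

/-- Averaging over rectangles is close to the identity on functions with small `L²` modulus of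
continuity. -/
lemma wnorm_sub_cellAvg_le (s : ℤ × ℤ) (g : TestFn) {ε : ℝ} (hε : 0 ≤ ε)
    (h : ∀ a ∈ box s, wnorm (fun _ => 1) (g - shift a g) ≤ ε) :
    wnorm (fun _ => 1) (g - (cellAvg s).lin g) ≤ 4 * ε := by
  have hg := g.measurable
  rw [← ENNReal.ofReal_le_ofReal_iff (by positivity), ofReal_wnorm_one]
  calc ∫⁻ x, ENNReal.ofReal ((g - (cellAvg s).lin g : TestFn) x ^ 2)
      ≤ ∫⁻ x, ∫⁻ y, cellDensity s x y * ENNReal.ofReal ((g x - g y) ^ 2) := by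
        refine lintegral_mono fun x => ?_
        have e : (g - (cellAvg s).lin g : TestFn) x = (cellAvg s).op (fun y => g x - g y) x := by
          rw [Avg.op_sub _ (LocBdd.const _) g.locBdd, cellAvg_op_const]
          rfl
        dsimp only
        rw [e]
        refine ((cellAvg s).ofReal_sq_op_le ((LocBdd.const _).sub g.locBdd) x).trans (le_of_eq ?_)
        change ∫⁻ y, _ ∂(cellKernel s x) = _
        rw [cellKernel_apply, lintegral_withDensity_eq_lintegral_mul _
          (measurable_cellDensity s).of_uncurry_left (by fun_prop)]
        rfl
    _ = ∫⁻ x, ∫⁻ a, cellDensity s x (x - a) * ENNReal.ofReal ((g x - g (x - a)) ^ 2) := by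
        refine lintegral_congr fun x => ?_
        rw [lintegral_sub_left_eq_self (μ := volume)
          (fun y => cellDensity s x y * ENNReal.ofReal ((g x - g y) ^ 2)) x]
    _ ≤ ∫⁻ x, ∫⁻ a in box s, (ENNReal.ofReal (area s))⁻¹ *
          ENNReal.ofReal ((g x - g (x - a)) ^ 2) := by
        refine lintegral_mono fun x => ?_
        dsimp only
        rw [← lintegral_indicator (measurableSet_box s)]
        refine lintegral_mono fun a => ?_
        dsimp only
        by_cases hc : cell s x = cell s (x - a)
        · have hb := norm_sub_le_of_cell hc
          have : a ∈ box s := by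
            simp only [sub_sub_cancel_left, Prod.fst_neg, Prod.snd_neg, abs_neg, abs_le] at hb
            exact ⟨hb.1, hb.2⟩
          rw [Set.indicator_of_mem this]
          gcongr
          simp [cellDensity, hc]
        · simp [cellDensity, hc]
    _ = ∫⁻ a in box s, (ENNReal.ofReal (area s))⁻¹ *
          ENNReal.ofReal (wnorm (fun _ => 1) (g - shift a g)) := by
        rw [lintegral_lintegral_swap (by fun_prop)]
        refine lintegral_congr fun a => ?_
        rw [lintegral_const_mul _ (by fun_prop), ofReal_wnorm_one]
        simp
    _ ≤ ∫⁻ a in box s, (ENNReal.ofReal (area s))⁻¹ * ENNReal.ofReal ε := by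
        refine setLIntegral_mono measurable_const fun a ha => ?_
        gcongr
        exact h a ha
    _ = ENNReal.ofReal (4 * ε) := by
        have := area_pos s
        rw [setLIntegral_const, volume_box, ← ENNReal.ofReal_inv_of_pos this,
          ← ENNReal.ofReal_mul (by positivity), ← ENNReal.ofReal_mul (by positivity)]
        congr 1
        field_simp

section Conv

variable {ν : Measure Plane} {R : ℝ}

/-- A convolution is close to a multiple of the identity on functions that vary little along the
support of the measure. -/
lemma wnorm_convAvg_sub_smul_le (h : SubProb ν R) (g : TestFn) {ε : ℝ} (hε : 0 ≤ ε)
    (hy : ∀ᵐ y ∂ν, wnorm (fun _ => 1) (g - shift y g) ≤ ε) :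
    wnorm (fun _ => 1) ((convAvg h).lin g - ν.real Set.univ • g) ≤ ε := by
  have := h.isFiniteMeasure
  have hg := g.measurable
  rw [← ENNReal.ofReal_le_ofReal_iff (by positivity), ofReal_wnorm_one]
  calc ∫⁻ x, ENNReal.ofReal (((convAvg h).lin g - ν.real Set.univ • g : TestFn) x ^ 2)
      ≤ ∫⁻ x, ∫⁻ y, ENNReal.ofReal ((g (x - y) - g x) ^ 2) ∂ν := by
        refine lintegral_mono fun x => ?_
        have e : ((convAvg h).lin g - ν.real Set.univ • g : TestFn) x =
            (convAvg h).op (fun y => g y - g x) x := by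
          rw [Avg.op_sub _ g.locBdd (LocBdd.const _)]
          have : (convAvg h).op (fun _ => g x) x = ν.real Set.univ * g x := by
            rw [convAvg_op h measurable_const, integral_const, smul_eq_mul]
          rw [this]
          rfl
        dsimp only
        rw [e]
        refine ((convAvg h).ofReal_sq_op_le (g.locBdd.sub (LocBdd.const _)) x).trans (le_of_eq ?_)
        exact lintegral_map (g := fun y => x - y) (by fun_prop) (by fun_prop)
    _ = ∫⁻ y, ENNReal.ofReal (wnorm (fun _ => 1) (g - shift y g)) ∂ν := by
        rw [lintegral_lintegral_swap (by fun_prop)]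
        refine lintegral_congr fun y => ?_
        rw [ofReal_wnorm_one]
        refine lintegral_congr fun x => ?_
        rw [← neg_sq]
        simp
    _ ≤ ∫⁻ _, ENNReal.ofReal ε ∂ν :=
        lintegral_mono_ae (hy.mono fun y h => ENNReal.ofReal_le_ofReal h)
    _ ≤ ENNReal.ofReal ε := by
        rw [lintegral_const]
        exact mul_le_of_le_one_right' h.mass

lemma SubProb.neg (h : SubProb ν R) : SubProb (ν.map fun y => -y) R :=
  ⟨by rw [Measure.map_apply measurable_neg MeasurableSet.univ]; exact h.mass, by
    rw [ae_map_iff (by fun_prop) (measurableSet_le (by fun_prop) measurable_const)]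
    simpa using h.rad⟩

lemma convAvg_symm_lin (h : SubProb ν R) : (convAvg h).symm.lin = (convAvg h.neg).lin := by
  refine LinearMap.ext fun f => Subtype.ext (funext fun x => ?_)
  rw [Avg.lin_apply, Avg.lin_apply, convAvg_symm_op h f.measurable,
    convAvg_op h.neg f.measurable]
  have hf : Measurable fun y => f (x - y) := f.measurable.comp (by fun_prop)
  rw [integral_map (by fun_prop) hf.aestronglyMeasurable]
  simp

lemma fourierSq_neg (ξ : Plane) : fourierSq (ν.map fun y => -y) ξ = fourierSq ν ξ := by
  unfold fourierSq
  rw [integral_map (by fun_prop) (by fun_prop), integral_map (by fun_prop) (by fun_prop)]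
  have e : ∀ y : Plane, 2 * Real.pi * ((-y).1 * ξ.1 + (-y).2 * ξ.2) =
      -(2 * Real.pi * (y.1 * ξ.1 + y.2 * ξ.2)) := fun y => by
    simp only [Prod.fst_neg, Prod.snd_neg]
    ring
  simp only [e, Real.cos_neg, Real.sin_neg, integral_neg, neg_sq]

end Conv

lemma exists_Ico_of_floor_ne (a k : ℤ) (y : ℝ) : ∃ c : ℝ, ∀ u : ℝ,
    k = ⌊u / 2 ^ a⌋ → ⌊(u - y) / 2 ^ a⌋ ≠ k → u ∈ Set.Ico c (c + |y|) := by
  have hp : (0 : ℝ) < 2 ^ a := by positivity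
  have hk : ∀ v : ℝ, ⌊v / 2 ^ a⌋ = k ↔ (k : ℝ) * 2 ^ a ≤ v ∧ v < (k + 1) * 2 ^ a := by
    intro v
    rw [Int.floor_eq_iff, le_div_iff₀ hp, div_lt_iff₀ hp]
  rcases le_total 0 y with hy | hy
  · refine ⟨k * 2 ^ a, fun u h1 h2 => ?_⟩
    have h1 := (hk u).1 h1.symm
    rw [ne_eq, hk, not_and_or, not_le, not_lt] at h2
    rw [abs_of_nonneg hy]
    refine ⟨h1.1, ?_⟩
    rcases h2 with h2 | h2 <;> linarith
  · refine ⟨(k + 1) * 2 ^ a + y, fun u h1 h2 => ?_⟩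
    have h1 := (hk u).1 h1.symm
    rw [ne_eq, hk, not_and_or, not_le, not_lt] at h2
    rw [abs_of_nonpos hy]
    refine ⟨?_, by linarith⟩
    rcases h2 with h2 | h2 <;> linarith

/-- The set of points moved to another rectangle by a translation. -/
def crossing (s : ℤ × ℤ) (y : Plane) : Set Plane := {x | cell s (x - y) ≠ cell s x}

lemma measurableSet_crossing (s : ℤ × ℤ) (y : Plane) : MeasurableSet (crossing s y) :=
  (measurableSet_eq_fun ((measurable_cell s).comp (measurable_id.sub_const y))
    (measurable_cell s)).compl

/-- The proportion of a rectangle that leaves it under a translation. -/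
noncomputable def frac (s : ℤ × ℤ) (y : Plane) : ℝ := |y.1| / 2 ^ s.1 + |y.2| / 2 ^ s.2

lemma frac_nonneg (s : ℤ × ℤ) (y : Plane) : 0 ≤ frac s y := by unfold frac; positivity

lemma frac_neg (s : ℤ × ℤ) (y : Plane) : frac s (-y) = frac s y := by simp [frac]

lemma locBdd_crossing (s : ℤ × ℤ) (y : Plane) :
    LocBdd ((crossing s y).indicator fun _ => (1 : ℝ)) :=
  LocBdd.of_bdd (C := 1) (measurable_const.indicator (measurableSet_crossing s y)) fun x => by
    by_cases h : x ∈ crossing s y <;> simp [h]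

lemma volume_crossing_inter_cell_le (s : ℤ × ℤ) (x y : Plane) :
    volume (crossing s y ∩ {z | cell s x = cell s z}) ≤
      ENNReal.ofReal (area s) * ENNReal.ofReal (frac s y) := by
  obtain ⟨c, hc⟩ := exists_Ico_of_floor_ne s.1 (cell s x).1 y.1
  obtain ⟨d, hd⟩ := exists_Ico_of_floor_ne s.2 (cell s x).2 y.2
  have hsub : crossing s y ∩ {z | cell s x = cell s z} ⊆
      Set.Ico c (c + |y.1|) ×ˢ Set.Ico ((cell s x).2 * 2 ^ s.2 : ℝ) (((cell s x).2 + 1) * 2 ^ s.2) ∪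
      Set.Ico ((cell s x).1 * 2 ^ s.1 : ℝ) (((cell s x).1 + 1) * 2 ^ s.1) ×ˢ
        Set.Ico d (d + |y.2|) := by
    rintro z ⟨h1, h2⟩
    have e1 : (cell s x).1 = ⌊z.1 / 2 ^ s.1⌋ := congrArg Prod.fst h2
    have e2 : (cell s x).2 = ⌊z.2 / 2 ^ s.2⌋ := congrArg Prod.snd h2
    have k1 : ∀ (a k : ℤ) (u : ℝ), k = ⌊u / 2 ^ a⌋ →
        u ∈ Set.Ico (k * 2 ^ a : ℝ) ((k + 1) * 2 ^ a) := by
      intro a k u h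
      have hp : (0 : ℝ) < 2 ^ a := by positivity
      have := Int.floor_eq_iff.1 h.symm
      rwa [le_div_iff₀ hp, div_lt_iff₀ hp] at this
    by_cases h3 : ⌊(z.1 - y.1) / 2 ^ s.1⌋ = (cell s x).1
    · right
      refine ⟨k1 _ _ _ e1, hd _ e2 fun h4 => h1 ?_⟩
      have h2' : cell s x = cell s z := h2
      rw [← h2']
      exact Prod.ext h3 h4
    · exact Or.inl ⟨hc _ e1 h3, k1 _ _ _ e2⟩
  refine (measure_mono hsub).trans ((measure_union_le _ _).trans ?_)
  rw [Measure.volume_eq_prod, Measure.prod_prod, Measure.prod_prod]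
  simp only [Real.volume_Ico]
  have p1 : (0 : ℝ) < 2 ^ s.1 := by positivity
  have p2 : (0 : ℝ) < 2 ^ s.2 := by positivity
  rw [← ENNReal.ofReal_mul (by simp), ← ENNReal.ofReal_mul (by linarith),
    ← ENNReal.ofReal_add (mul_nonneg (by simp) (by linarith)) (mul_nonneg (by linarith) (by simp)),
    ← ENNReal.ofReal_mul (area_pos s).le]
  refine ENNReal.ofReal_le_ofReal (le_of_eq ?_)
  rw [area, frac]
  field_simp
  ring

lemma cellAvg_op_crossing_le (s : ℤ × ℤ) (x y : Plane) :
    (cellAvg s).op ((crossing s y).indicator fun _ => 1) x ≤ frac s y := by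
  have hm : MeasurableSet {z | cell s x = cell s z} :=
    measurableSet_eq_fun measurable_const (measurable_cell s)
  rw [Avg.op]
  change ∫ z, _ ∂(cellKernel s x) ≤ _
  rw [integral_indicator_const _ (measurableSet_crossing s y), smul_eq_mul, mul_one]
  refine ENNReal.toReal_le_of_le_ofReal (frac_nonneg _ _) ?_
  rw [cellKernel_apply, withDensity_apply _ (measurableSet_crossing s y), cellDensity_eq,
    lintegral_indicator hm, setLIntegral_const, Measure.restrict_apply hm, Set.inter_comm]
  refine (mul_le_mul_right (volume_crossing_inter_cell_le s x y) _).trans (le_of_eq ?_)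
  rw [← mul_assoc, ENNReal.inv_mul_cancel (by simpa using area_pos s) ENNReal.ofReal_ne_top,
    one_mul]

lemma integral_sq_mul_crossing_le {s : ℤ × ℤ} {g : TestFn} (hg : CellConst s g) (y : Plane) :
    ∫ x, g x ^ 2 * (crossing s y).indicator (fun _ => (1 : ℝ)) x ≤
      frac s y * wnorm (fun _ => 1) g := by
  let φ : TestFn := ⟨_, g.sq_mul_mem (LocBdd.const 1)⟩
  have hφ : ∀ x, φ x = g x ^ 2 := fun x => mul_one _
  have h1 := integral_mul_cellAvg (φ := φ) (s := s)
    (fun a b h => by rw [hφ, hφ, hg a b h]) (locBdd_crossing s y)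
  simp only [hφ] at h1
  rw [← h1, wnorm, ← integral_const_mul]
  refine integral_mono (g.integrable_sq_mul ((cellAvg s).op_locBdd (locBdd_crossing s y)))
    ((g.integrable_sq_mul (LocBdd.const 1)).const_mul _) fun x => ?_
  have := mul_le_mul_of_nonneg_left (cellAvg_op_crossing_le s x y) (sq_nonneg (g x))
  dsimp only
  linarith

/-- Functions constant on rectangles have small `L²` modulus of continuity at smaller scales. -/
lemma wnorm_sub_shift_le_of_cellConst {s : ℤ × ℤ} {g : TestFn} (hg : CellConst s g) (y : Plane) :
    wnorm (fun _ => 1) (g - shift y g) ≤ 4 * frac s y * wnorm (fun _ => 1) g := by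
  have h1 := integral_sq_mul_crossing_le hg y
  have h2 := integral_sq_mul_crossing_le hg (-y)
  have i1 := g.integrable_sq_mul (locBdd_crossing s y)
  have i2 := g.integrable_sq_mul (locBdd_crossing s (-y))
  rw [← integral_sub_right_eq_self _ y] at h2
  have i2' := i2.comp_sub_right y
  rw [frac_neg] at h2
  have h3 : wnorm (fun _ => 1) (g - shift y g) ≤
      ∫ x, (2 * (g x ^ 2 * (crossing s y).indicator (fun _ => (1 : ℝ)) x) +
        2 * (g (x - y) ^ 2 * (crossing s (-y)).indicator (fun _ => (1 : ℝ)) (x - y))) := by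
    rw [wnorm]
    refine integral_mono (TestFn.integrable_sq_mul _ (LocBdd.const 1))
      ((i1.const_mul 2).add (i2'.const_mul 2)) fun x => ?_
    dsimp only
    rw [TestFn.sub_apply, shift_apply]
    by_cases hc : cell s (x - y) = cell s x
    · rw [hg _ _ hc]
      have : 0 ≤ (crossing s (-y)).indicator (fun _ => (1 : ℝ)) (x - y) :=
        Set.indicator_nonneg (fun _ _ => zero_le_one) _
      have : 0 ≤ (crossing s y).indicator (fun _ => (1 : ℝ)) x :=
        Set.indicator_nonneg (fun _ _ => zero_le_one) _
      rw [sub_self, zero_pow two_ne_zero, zero_mul]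
      positivity
    · have m1 : x ∈ crossing s y := hc
      have m2 : x - y ∈ crossing s (-y) := by
        simpa [crossing, eq_comm] using hc
      rw [Set.indicator_of_mem m1, Set.indicator_of_mem m2]
      nlinarith [sq_nonneg (g x + g (x - y))]
  rw [integral_add (i1.const_mul 2) (i2'.const_mul 2), integral_const_mul, integral_const_mul] at h3
  linarith

/-- A van der Corput estimate for phases with nonnegative second derivative. -/
lemma abs_integral_cos_le {T l κ θ : ℝ} (hT : 0 < T) (hl : 0 < l) (hκ : 0 ≤ κ)
    {φ φ' φ'' : ℝ → ℝ} (h1 : ∀ t ∈ Set.Icc T (2 * T), HasDerivAt φ (φ' t) t)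
    (h2 : ∀ t ∈ Set.Icc T (2 * T), HasDerivAt φ' (φ'' t) t)
    (h0 : ∀ t ∈ Set.Icc T (2 * T), 0 ≤ φ'' t)
    (hle : ∀ t ∈ Set.Icc T (2 * T), l ≤ φ'' t + κ * (φ' t ^ 2 + l)) :
    |∫ t in T..2 * T, t⁻¹ * Real.cos (φ t + θ)| ≤ 8 / (T * √l) + κ := by
  set r := √l with hr
  have hr0 : 0 < r := Real.sqrt_pos.2 hl
  have hrl : l = r ^ 2 := (Real.sq_sqrt hl.le).symm
  set H : ℝ → ℝ := fun t => Real.sin (φ t + θ) * (φ' t / (φ' t ^ 2 + l)) * t⁻¹ with hH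
  have hG : ∀ x : ℝ, |x / (x ^ 2 + l)| ≤ (2 * r)⁻¹ := by
    intro x
    rw [abs_div, abs_of_pos (show 0 < x ^ 2 + l by positivity), div_le_iff₀ (by positivity),
      inv_mul_eq_div, le_div_iff₀ (by positivity), hrl, ← sq_abs]
    nlinarith [sq_nonneg (|x| - r)]
  have hHb : ∀ t ∈ Set.Icc T (2 * T), |H t| ≤ (2 * r)⁻¹ * T⁻¹ := by
    intro t ht
    have htp : 0 < t := hT.trans_le ht.1
    simp only [hH]
    rw [abs_mul, abs_mul, abs_inv, abs_of_pos htp]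
    have := mul_le_mul (Real.abs_sin_le_one (φ t + θ)) (hG (φ' t)) (abs_nonneg _) zero_le_one
    rw [one_mul] at this
    exact mul_le_mul this (inv_anti₀ hT ht.1) (by positivity) (by positivity)
  set H' : ℝ → ℝ := fun t => (Real.cos (φ t + θ) * φ' t * (φ' t / (φ' t ^ 2 + l)) +
    Real.sin (φ t + θ) * (φ'' t * (l - φ' t ^ 2) / (φ' t ^ 2 + l) ^ 2)) * t⁻¹ +
    Real.sin (φ t + θ) * (φ' t / (φ' t ^ 2 + l)) * (-(t ^ 2)⁻¹) with hH'
  have dH : ∀ t ∈ Set.Icc T (2 * T), HasDerivAt H (H' t) t := by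
    intro t ht
    have htp : 0 < t := hT.trans_le ht.1
    have d1 := ((h1 t ht).add_const θ).sin
    have d2 := (h2 t ht).div (((h2 t ht).pow 2).add_const l)
      (by rw [Pi.pow_apply]; positivity)
    refine ((d1.mul d2).mul (hasDerivAt_inv htp.ne')).congr_deriv ?_
    simp only [hH', Pi.mul_apply, Pi.div_apply, Pi.pow_apply]
    have : φ' t ^ 2 + l ≠ 0 := by positivity
    congr 2
    field_simp
    push_cast
    ring
  have hcφ : ContinuousOn φ (Set.Icc T (2 * T)) := fun t ht =>
    (h1 t ht).continuousAt.continuousWithinAt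
  have hT2 : T ≤ 2 * T := by linarith
  set I : ℝ → ℝ := fun t => t⁻¹ * Real.cos (φ t + θ) with hI
  have hIc : ContinuousOn I (Set.Icc T (2 * T)) := by
    refine (continuousOn_inv₀.mono fun t ht => (hT.trans_le ht.1).ne').mul
      (Real.continuous_cos.comp_continuousOn (hcφ.add continuousOn_const))
  have hIi : IntervalIntegrable I volume T (2 * T) :=
    (hIc.mono (by rw [Set.uIcc_of_le hT2])).intervalIntegrable
  set F : ℝ → ℝ := fun t => (∫ s in T..t, I s) - (H t - H T) with hF
  set B : ℝ → ℝ := fun t => 2 / (T * r) * (Real.arctan (φ' t / r) - Real.arctan (φ' T / r)) +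
    (κ / T + 1 / (2 * r * T ^ 2)) * (t - T) with hB
  set B' : ℝ → ℝ := fun t => 2 / (T * r) * (φ'' t / r / (1 + (φ' t / r) ^ 2)) +
    (κ / T + 1 / (2 * r * T ^ 2)) with hB'
  have dB : ∀ t ∈ Set.Icc T (2 * T), HasDerivAt B (B' t) t := by
    intro t ht
    have d1 := (((h2 t ht).div_const r).arctan.sub_const (Real.arctan (φ' T / r))).const_mul
      (2 / (T * r))
    have d2 := ((hasDerivAt_id t).sub_const T).const_mul (κ / T + 1 / (2 * r * T ^ 2))
    refine (d1.add d2).congr_deriv ?_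
    simp only [hB']
    ring
  have dF : ∀ t ∈ Set.Ico T (2 * T), HasDerivWithinAt F (I t - H' t) (Set.Ici t) t := by
    intro t ht
    have htI : t ∈ Set.Icc T (2 * T) := Set.Ico_subset_Icc_self ht
    have d1 : HasDerivWithinAt (fun t => ∫ s in T..t, I s) (I t) (Set.Ici t) t := by
      refine intervalIntegral.integral_hasDerivWithinAt_right
        (hIi.mono_set (by rw [Set.uIcc_of_le hT2, Set.uIcc_of_le ht.1]
                          exact Set.Icc_subset_Icc_right ht.2.le)) (t := Set.Ioi t) ?_ ?_
      · refine ⟨Set.Icc t (2 * T), ?_, ?_⟩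
        · exact mem_of_superset (Ioc_mem_nhdsGT ht.2) Set.Ioc_subset_Icc_self
        · exact (hIc.mono (Set.Icc_subset_Icc_left ht.1)).aestronglyMeasurable measurableSet_Icc
      · have := (hIc.mono (Set.Icc_subset_Icc_left ht.1)) t ⟨le_rfl, ht.2.le⟩
        exact this.mono_of_mem_nhdsWithin
          (mem_of_superset (Ioc_mem_nhdsGT ht.2) Set.Ioc_subset_Icc_self)
    exact d1.sub ((dH t htI).hasDerivWithinAt.sub_const (H T))
  have cF : ContinuousOn F (Set.Icc T (2 * T)) := by
    refine ContinuousOn.sub ?_ (ContinuousOn.sub (fun t ht =>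
      (dH t ht).continuousAt.continuousWithinAt) continuousOn_const)
    have := intervalIntegral.continuousOn_primitive_interval'
      hIi (Set.left_mem_uIcc (a := T) (b := 2 * T))
    rwa [Set.uIcc_of_le hT2] at this
  have bound : ∀ t ∈ Set.Ico T (2 * T), ‖I t - H' t‖ ≤ B' t := by
    intro t ht
    have htI : t ∈ Set.Icc T (2 * T) := Set.Ico_subset_Icc_self ht
    have htp : 0 < t := hT.trans_le ht.1
    set D := φ' t ^ 2 + l with hD
    have hD0 : 0 < D := by positivity
    have e1 : I t - H' t = (l / D * Real.cos (φ t + θ) -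
        Real.sin (φ t + θ) * (φ'' t * (l - φ' t ^ 2) / D ^ 2) +
        Real.sin (φ t + θ) * (φ' t / D) * t⁻¹) * t⁻¹ := by
      simp only [hI, hH', ← hD]
      field_simp
      rw [hD]
      ring
    have b1 : |l / D * Real.cos (φ t + θ)| ≤ φ'' t / D + κ := by
      rw [abs_mul, abs_of_pos (by positivity : 0 < l / D)]
      refine (mul_le_of_le_one_right (by positivity) (Real.abs_cos_le_one _)).trans ?_
      rw [div_le_iff₀ hD0, add_mul, div_mul_cancel₀ _ hD0.ne']
      exact hle t htI
    have b2 : |Real.sin (φ t + θ) * (φ'' t * (l - φ' t ^ 2) / D ^ 2)| ≤ φ'' t / D := by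
      rw [abs_mul]
      refine (mul_le_of_le_one_left (abs_nonneg _) (Real.abs_sin_le_one _)).trans ?_
      rw [abs_div, abs_mul, abs_of_nonneg (h0 t htI), abs_of_pos (by positivity : 0 < D ^ 2),
        div_le_div_iff₀ (by positivity) hD0]
      have : |l - φ' t ^ 2| ≤ D := by
        rw [abs_le]
        constructor <;> nlinarith [sq_nonneg (φ' t)]
      have h3 := mul_le_mul_of_nonneg_left this (mul_nonneg (h0 t htI) hD0.le)
      nlinarith
    have b3 : |Real.sin (φ t + θ) * (φ' t / D) * t⁻¹| ≤ (2 * r)⁻¹ * T⁻¹ := hHb t htI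
    have b4 : |l / D * Real.cos (φ t + θ) -
        Real.sin (φ t + θ) * (φ'' t * (l - φ' t ^ 2) / D ^ 2) +
        Real.sin (φ t + θ) * (φ' t / D) * t⁻¹| ≤ 2 * (φ'' t / D) + κ + (2 * r)⁻¹ * T⁻¹ := by
      refine (abs_add_le _ _).trans (add_le_add ((abs_sub _ _).trans ?_) b3)
      linarith
    have hpos : 0 ≤ 2 * (φ'' t / D) + κ + (2 * r)⁻¹ * T⁻¹ := (abs_nonneg _).trans b4
    rw [Real.norm_eq_abs, e1, abs_mul, abs_inv, abs_of_pos htp]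
    refine (mul_le_mul b4 (inv_anti₀ hT ht.1) (by positivity) hpos).trans (le_of_eq ?_)
    simp only [hB', hD, hrl]
    field_simp
    ring
  have main := image_norm_le_of_norm_deriv_right_le_deriv_boundary' cF dF
    (B := B) (B' := B') (by simp [hF, hB]) (fun t ht => (dB t ht).continuousAt.continuousWithinAt)
    (fun t ht => (dB t (Set.Ico_subset_Icc_self ht)).hasDerivWithinAt) bound
    (Set.right_mem_Icc.2 hT2)
  have b1 := hHb T ⟨le_rfl, hT2⟩
  have b2 := hHb (2 * T) ⟨hT2, le_rfl⟩
  have hat : Real.arctan (φ' (2 * T) / r) - Real.arctan (φ' T / r) ≤ 3.15 := by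
    have := Real.arctan_lt_pi_div_two (φ' (2 * T) / r)
    have := Real.neg_pi_div_two_lt_arctan (φ' T / r)
    have := Real.pi_lt_d2
    linarith
  have hBT : B (2 * T) ≤ 2 / (T * r) * 3.15 + κ + 1 / (2 * r * T) := by
    have h3 := mul_le_mul_of_nonneg_left hat (by positivity : 0 ≤ 2 / (T * r))
    have e : (κ / T + 1 / (2 * r * T ^ 2)) * (2 * T - T) = κ + 1 / (2 * r * T) := by
      field_simp
      ring
    simp only [hB, e]
    linarith
  have e : ∫ s in T..2 * T, I s = F (2 * T) + H (2 * T) - H T := by simp only [hF]; ring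
  rw [e]
  rw [Real.norm_eq_abs] at main
  have h3 : |F (2 * T) + H (2 * T) - H T| ≤ |F (2 * T)| + |H (2 * T)| + |H T| :=
    (abs_sub _ _).trans (add_le_add_left (abs_add_le _ _) _)
  have e2 : (2 * r)⁻¹ * T⁻¹ = 1 / (T * r) * (1 / 2) := by field_simp
  have e3 : 1 / (2 * r * T) = 1 / (T * r) * (1 / 2) := by field_simp
  have e4 : 2 / (T * r) = 1 / (T * r) * 2 := by field_simp
  have e5 : 8 / (T * r) = 1 / (T * r) * 8 := by field_simp
  have : 0 < 1 / (T * r) := by positivity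
  rw [e2] at b1 b2
  rw [e3, e4] at hBT
  rw [e5]
  linarith

/-- Odd convex curves satisfying the growth condition `γ' ≤ C₀ t γ''`. -/
structure Curve (γ : ℝ → ℝ) (C₀ : ℝ) : Prop where
  cont : Continuous γ
  const_pos : 0 < C₀
  pos : ∀ t, 0 < t → 0 < γ t
  deriv1 : ∀ t, 0 < t → HasDerivAt γ (deriv γ t) t
  deriv2 : ∀ t, 0 < t → HasDerivAt (deriv γ) (deriv (deriv γ) t) t
  growth : ∀ t, 0 < t → deriv γ t ≤ C₀ * t * deriv (deriv γ) t
  slope : ∀ s t, 0 < s → s ≤ t → γ s * t ≤ s * γ t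
  le_deriv : ∀ t, 0 < t → γ t ≤ t * deriv γ t

/-- The constant in the oscillatory integral estimates along a curve. -/
noncomputable def oscConst (C₀ : ℝ) : ℝ := (16 * √C₀ + C₀⁻¹ + 1) ^ 2

namespace Curve

variable {γ : ℝ → ℝ} {C₀ : ℝ}

lemma deriv_pos (h : Curve γ C₀) {t : ℝ} (ht : 0 < t) : 0 < deriv γ t :=
  pos_of_mul_pos_right ((h.pos t ht).trans_le (h.le_deriv t ht)) ht.le

lemma deriv_div_le (h : Curve γ C₀) {t : ℝ} (ht : 0 < t) :
    deriv γ t / (C₀ * t) ≤ deriv (deriv γ) t := by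
  have := h.const_pos
  rw [div_le_iff₀ (by positivity), mul_comm]
  exact h.growth t ht

lemma div_le_deriv (h : Curve γ C₀) {T t : ℝ} (hT : 0 < T) (ht : T ≤ t) :
    γ T / T ≤ deriv γ t := by
  have h1 := h.slope T t hT ht
  have h2 := h.le_deriv t (hT.trans_le ht)
  have htp := hT.trans_le ht
  rw [div_le_iff₀ hT]
  refine le_of_mul_le_mul_right ?_ htp
  nlinarith [mul_le_mul_of_nonneg_left h2 hT.le]

lemma abs_integral_inv_mul_le {T : ℝ} (hT : 0 < T) {F : ℝ → ℝ} (hF1 : ∀ t, |F t| ≤ 1) :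
    |∫ t in T..2 * T, t⁻¹ * F t| ≤ 1 := by
  have := intervalIntegral.norm_integral_le_of_norm_le_const (a := T) (b := 2 * T) (C := T⁻¹)
    (f := fun t => t⁻¹ * F t) fun t ht => by
      rw [Set.uIoc_of_le (by linarith)] at ht
      rw [Real.norm_eq_abs, abs_mul, abs_inv, abs_of_pos (hT.trans ht.1)]
      exact (mul_le_of_le_one_right (by have := hT.trans ht.1; positivity) (hF1 t)).trans
        (inv_anti₀ hT ht.1.le)
  rw [Real.norm_eq_abs] at this
  refine this.trans (le_of_eq ?_)
  rw [abs_of_pos (by linarith)]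
  field_simp
  ring

lemma oscillation_le_aux (h : Curve γ C₀) {T : ℝ} (hT : 0 < T) (a b θ : ℝ) (hb : 0 ≤ b) :
    |a| * T * (∫ t in T..2 * T, t⁻¹ * Real.cos (a * t + b * γ t + θ)) ^ 2 ≤ oscConst C₀ ∧
    |b| * γ T * (∫ t in T..2 * T, t⁻¹ * Real.cos (a * t + b * γ t + θ)) ^ 2 ≤ oscConst C₀ := by
  set I := ∫ t in T..2 * T, t⁻¹ * Real.cos (a * t + b * γ t + θ) with hI
  have hC := h.const_pos
  have hI1 : |I| ≤ 1 := abs_integral_inv_mul_le hT fun t => Real.abs_cos_le_one _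
  have hI2 : I ^ 2 ≤ 1 := (sq_le_one_iff_abs_le_one I).2 hI1
  have hK : 256 * C₀ ≤ oscConst C₀ := by
    have h1 : (16 * √C₀) ^ 2 = 256 * C₀ := by rw [mul_pow, Real.sq_sqrt hC.le]; norm_num
    rw [← h1, oscConst]
    gcongr
    have : 0 < C₀⁻¹ := by positivity
    linarith
  have hK1 : 1 ≤ oscConst C₀ := by
    rw [oscConst]
    exact one_le_pow₀ (by have : 0 < C₀⁻¹ := by positivity
                          have := Real.sqrt_nonneg C₀
                          linarith)
  have d1 : ∀ t ∈ Set.Icc T (2 * T), HasDerivAt (fun t => a * t + b * γ t)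
      (a + b * deriv γ t) t := fun t ht => by
    have htp : 0 < t := hT.trans_le ht.1
    exact HasDerivAt.congr_deriv
      (((hasDerivAt_id t).const_mul a).add ((h.deriv1 t htp).const_mul b)) (by simp)
  have d2 : ∀ t ∈ Set.Icc T (2 * T), HasDerivAt (fun t => a + b * deriv γ t)
      (b * deriv (deriv γ) t) t := fun t ht => by
    have htp : 0 < t := hT.trans_le ht.1
    simpa using ((h.deriv2 t htp).const_mul b).const_add a
  have d0 : ∀ t ∈ Set.Icc T (2 * T), 0 ≤ b * deriv (deriv γ) t := fun t ht => by
    have htp : 0 < t := hT.trans_le ht.1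
    exact mul_nonneg hb (le_trans (by have := h.deriv_pos htp; positivity) (h.deriv_div_le htp))
  constructor
  · rcases le_or_gt (|a| * T) 1 with ha | ha
    · have := mul_le_mul ha hI2 (sq_nonneg _) zero_le_one
      linarith
    · have ha0 : 0 < |a| := pos_of_mul_pos_left (zero_lt_one.trans ha) hT.le
      have key := abs_integral_cos_le (θ := θ) hT
        (l := |a| / (4 * C₀ * T)) (κ := (C₀ * (|a| * T))⁻¹)
        (by positivity) (by positivity) d1 d2 d0 fun t ht => by
          have htp : 0 < t := hT.trans_le ht.1
          rcases le_or_gt (|a| / 2) |a + b * deriv γ t| with h1 | h1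
          · have h2 : |a| ^ 2 / 4 ≤ (a + b * deriv γ t) ^ 2 := by
              rw [← sq_abs (a + b * deriv γ t)]
              nlinarith
            have h3 : |a| / (4 * C₀ * T) = (C₀ * (|a| * T))⁻¹ * (|a| ^ 2 / 4) := by
              field_simp
            rw [h3]
            have h4 : 0 ≤ (C₀ * (|a| * T))⁻¹ := by positivity
            have h5 : (C₀ * (|a| * T))⁻¹ * (|a| ^ 2 / 4) ≤
              (C₀ * (|a| * T))⁻¹ * ((a + b * deriv γ t) ^ 2 +
                (C₀ * (|a| * T))⁻¹ * (|a| ^ 2 / 4)) := by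
              refine mul_le_mul_of_nonneg_left (h2.trans ?_) h4
              have : 0 ≤ (C₀ * (|a| * T))⁻¹ * (|a| ^ 2 / 4) := by positivity
              linarith
            have := d0 t ht
            linarith
          · have h2 : |a| / 2 ≤ b * deriv γ t := by
              have h3 : 0 ≤ b * deriv γ t := mul_nonneg hb (h.deriv_pos htp).le
              have h4 := abs_sub (a + b * deriv γ t) (b * deriv γ t)
              rw [add_sub_cancel_right, abs_of_nonneg h3] at h4
              linarith
            have h3 := mul_le_mul_of_nonneg_left (h.deriv_div_le htp) hb
            have h4 : |a| / (4 * C₀ * T) ≤ b * (deriv γ t / (C₀ * t)) := by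
              rw [← mul_div_assoc, div_le_div_iff₀ (by positivity)
        (by positivity)]
              have h5 : C₀ * t ≤ C₀ * (2 * T) := mul_le_mul_of_nonneg_left ht.2 hC.le
              have h6 : |a| * (C₀ * t) ≤ |a| * (C₀ * (2 * T)) :=
                mul_le_mul_of_nonneg_left h5 ha0.le
              have h7 := mul_le_mul_of_nonneg_right h2 (by positivity : 0 ≤ 4 * C₀ * T)
              linarith
            have : 0 ≤ (C₀ * (|a| * T))⁻¹ * ((a + b * deriv γ t) ^ 2 + |a| / (4 * C₀ * T)) := by
              positivity
            linarith
      have hs : 0 < √(|a| * T) := Real.sqrt_pos.2 (by linarith)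
      have hss : √(|a| * T) ^ 2 = |a| * T := Real.sq_sqrt (by positivity)
      have hs1 : 1 ≤ √(|a| * T) := Real.one_le_sqrt.2 ha.le
      have e1 : T * √(|a| / (4 * C₀ * T)) = √(|a| * T) / (2 * √C₀) := by
        have : |a| / (4 * C₀ * T) = |a| * T / (C₀ * (2 * T) ^ 2) := by
          field_simp
          norm_num
        rw [this, Real.sqrt_div (by positivity), Real.sqrt_mul hC.le,
          Real.sqrt_sq (by positivity)]
        field_simp
      have hsC : 0 < √C₀ := Real.sqrt_pos.2 hC
      have e2 : 8 / (T * √(|a| / (4 * C₀ * T))) + (C₀ * (|a| * T))⁻¹ ≤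
          (16 * √C₀ + C₀⁻¹ + 1) / √(|a| * T) := by
        rw [e1]
        have h1 : 8 / (√(|a| * T) / (2 * √C₀)) = 16 * √C₀ / √(|a| * T) := by
          field_simp
          norm_num
        have h2 : (C₀ * (|a| * T))⁻¹ ≤ C₀⁻¹ / √(|a| * T) := by
          rw [mul_inv, div_eq_mul_inv]
          refine mul_le_mul_of_nonneg_left (inv_anti₀ hs ?_) (by positivity)
          nlinarith
        rw [h1, add_div, add_div]
        have : 0 ≤ 1 / √(|a| * T) := by positivity
        linarith
      have e3 : |I| * √(|a| * T) ≤ 16 * √C₀ + C₀⁻¹ + 1 := by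
        rw [← le_div_iff₀ hs]
        exact key.trans e2
      rw [oscConst]
      calc |a| * T * I ^ 2 = (|I| * √(|a| * T)) ^ 2 := by rw [mul_pow, sq_abs, hss]; ring
        _ ≤ _ := by gcongr
  · rcases hb.eq_or_lt with rfl | hb
    · simp only [abs_zero, zero_mul]
      linarith
    · have hγ := h.pos T hT
      have key := abs_integral_cos_le (θ := θ) hT
        (l := b * γ T / (2 * C₀ * T ^ 2)) (κ := 0)
        (by positivity) le_rfl d1 d2 d0 fun t ht => by
          have htp : 0 < t := hT.trans_le ht.1
          rw [zero_mul, add_zero, mul_div_assoc]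
          refine mul_le_mul_of_nonneg_left ((le_trans ?_ (h.deriv_div_le htp))) hb.le
          have h1 := h.div_le_deriv hT ht.1
          calc γ T / (2 * C₀ * T ^ 2) = (γ T / T) / (C₀ * (2 * T)) := by field_simp
            _ ≤ _ := div_le_div₀ (h.deriv_pos htp).le h1 (by positivity)
              (mul_le_mul_of_nonneg_left ht.2 hC.le)
      rw [add_zero] at key
      have e1 : (8 / (T * √(b * γ T / (2 * C₀ * T ^ 2)))) ^ 2 = 128 * C₀ / (b * γ T) := by
        rw [div_pow, mul_pow, Real.sq_sqrt (by positivity)]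
        field_simp
        norm_num
      have e2 : I ^ 2 ≤ 128 * C₀ / (b * γ T) := by
        rw [← e1, ← sq_abs I]
        gcongr
      rw [le_div_iff₀ (by positivity)] at e2
      rw [abs_of_pos hb]
      linarith

lemma oscillation_le (h : Curve γ C₀) {T : ℝ} (hT : 0 < T) (a b θ : ℝ) :
    |a| * T * (∫ t in T..2 * T, t⁻¹ * Real.cos (a * t + b * γ t + θ)) ^ 2 ≤ oscConst C₀ ∧
    |b| * γ T * (∫ t in T..2 * T, t⁻¹ * Real.cos (a * t + b * γ t + θ)) ^ 2 ≤ oscConst C₀ := by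
  rcases le_total 0 b with hb | hb
  · exact oscillation_le_aux h hT a b θ hb
  · have := oscillation_le_aux h hT (-a) (-b) (-θ) (by linarith)
    have e : ∀ t, -a * t + -b * γ t + -θ = -(a * t + b * γ t + θ) := fun t => by ring
    simpa only [e, Real.cos_neg, abs_neg] using this

end Curve

/-- The measure `dt / t` on the piece `T < t ≤ 2 T` of the curve. -/
noncomputable def curveMeasure (γ : ℝ → ℝ) (T : ℝ) : Measure Plane :=
  ((volume.restrict (Set.Ioc T (2 * T))).withDensity fun t => ENNReal.ofReal t⁻¹).map
    fun t => (t, γ t)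

namespace Curve

variable {γ : ℝ → ℝ} {C₀ T : ℝ}

lemma integral_curveMeasure (h : Curve γ C₀) (hT : 0 < T) {F : Plane → ℝ} (hF : Measurable F) :
    ∫ y, F y ∂curveMeasure γ T = ∫ t in T..2 * T, t⁻¹ * F (t, γ t) := by
  have hm : Measurable fun t : ℝ => (t, γ t) := by have := h.cont; fun_prop
  rw [curveMeasure, integral_map hm.aemeasurable hF.aestronglyMeasurable,
    integral_withDensity_eq_integral_toReal_smul (by fun_prop)
      (ae_of_all _ fun _ => ENNReal.ofReal_lt_top), intervalIntegral.integral_of_le (by linarith)]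
  refine setIntegral_congr_fun measurableSet_Ioc fun t ht => ?_
  have : 0 < t := hT.trans ht.1
  simp only [smul_eq_mul]
  rw [ENNReal.toReal_ofReal (by positivity)]

lemma ae_curveMeasure (h : Curve γ C₀) :
    ∀ᵐ y ∂curveMeasure γ T, ∃ t ∈ Set.Ioc T (2 * T), y = (t, γ t) := by
  have hm : Measurable fun t : ℝ => (t, γ t) := by have := h.cont; fun_prop
  have hs : MeasurableSet {y : Plane | y.1 ∈ Set.Ioc T (2 * T) ∧ y.2 = γ y.1} :=
    (measurable_fst measurableSet_Ioc).inter
      (measurableSet_eq_fun measurable_snd (h.cont.measurable.comp measurable_fst))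
  have : ∀ᵐ y ∂curveMeasure γ T, y ∈ {y : Plane | y.1 ∈ Set.Ioc T (2 * T) ∧ y.2 = γ y.1} := by
    refine (ae_map_iff hm.aemeasurable hs).2 ?_
    refine (withDensity_absolutelyContinuous _ _).ae_le ?_
    filter_upwards [ae_restrict_mem measurableSet_Ioc] with t ht using ⟨ht, rfl⟩
  filter_upwards [this] with y hy using ⟨y.1, hy.1, Prod.ext rfl hy.2⟩

lemma monotoneOn (h : Curve γ C₀) {s t : ℝ} (hs : 0 < s) (hst : s ≤ t) : γ s ≤ γ t := by
  have h1 := h.slope s t hs hst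
  have h2 := h.pos t (hs.trans_le hst)
  have := mul_le_mul_of_nonneg_right hst h2.le
  nlinarith [hs.trans_le hst]

lemma ae_abs_le (h : Curve γ C₀) (hT : 0 < T) :
    ∀ᵐ y ∂curveMeasure γ T, |y.1| ≤ 2 * T ∧ |y.2| ≤ γ (2 * T) := by
  filter_upwards [h.ae_curveMeasure] with y ⟨t, ht, e⟩
  have htp : 0 < t := hT.trans ht.1
  rw [e, abs_of_pos htp, abs_of_pos (h.pos t htp)]
  exact ⟨ht.2, h.monotoneOn htp ht.2⟩

lemma subProb (h : Curve γ C₀) (hT : 0 < T) :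
    SubProb (curveMeasure γ T) (max (2 * T) (γ (2 * T))) := by
  have hm : Measurable fun t : ℝ => (t, γ t) := by have := h.cont; fun_prop
  refine ⟨?_, ?_⟩
  · rw [curveMeasure, Measure.map_apply hm MeasurableSet.univ, Set.preimage_univ,
      withDensity_apply _ MeasurableSet.univ, Measure.restrict_univ]
    calc ∫⁻ t in Set.Ioc T (2 * T), ENNReal.ofReal t⁻¹
        ≤ ∫⁻ _ in Set.Ioc T (2 * T), ENNReal.ofReal T⁻¹ :=
          setLIntegral_mono measurable_const fun t ht =>
            ENNReal.ofReal_le_ofReal (inv_anti₀ hT ht.1.le)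
      _ ≤ 1 := by
          rw [setLIntegral_const, Real.volume_Ioc, ← ENNReal.ofReal_mul (by positivity),
            ENNReal.ofReal_le_one]
          refine le_of_eq ?_
          field_simp
          ring
  · filter_upwards [h.ae_abs_le hT] with y hy
    exact max_le_max hy.1 hy.2

lemma fourierSq_le (h : Curve γ C₀) (hT : 0 < T) (ξ : Plane) :
    |2 * Real.pi * ξ.1| * T * fourierSq (curveMeasure γ T) ξ ≤ 2 * oscConst C₀ ∧
    |2 * Real.pi * ξ.2| * γ T * fourierSq (curveMeasure γ T) ξ ≤ 2 * oscConst C₀ := by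
  have h1 := h.oscillation_le hT (2 * Real.pi * ξ.1) (2 * Real.pi * ξ.2) 0
  have h2 := h.oscillation_le hT (2 * Real.pi * ξ.1) (2 * Real.pi * ξ.2) (-(Real.pi / 2))
  rw [fourierSq, h.integral_curveMeasure hT (by fun_prop), h.integral_curveMeasure hT (by fun_prop)]
  have e : ∀ t, 2 * Real.pi * (t * ξ.1 + γ t * ξ.2) =
      2 * Real.pi * ξ.1 * t + 2 * Real.pi * ξ.2 * γ t := fun t => by ring
  simp only [e]
  simp only [← sub_eq_add_neg, Real.cos_sub_pi_div_two, add_zero] at h1 h2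
  constructor <;> linarith [h1.1, h1.2, h2.1, h2.2]

lemma one_sub_cos_mul_fourierSq_le (h : Curve γ C₀) (hT : 0 < T) (a ξ : Plane) :
    (1 - Real.cos (2 * Real.pi * (a.1 * ξ.1 + a.2 * ξ.2))) * fourierSq (curveMeasure γ T) ξ ≤
      2 * oscConst C₀ * (|a.1| / T + |a.2| / γ T) := by
  have h1 := h.fourierSq_le hT ξ
  have hγ := h.pos T hT
  set F := fourierSq (curveMeasure γ T) ξ with hF
  have hF0 : 0 ≤ F := by rw [hF, fourierSq]; positivity
  have hcos : ∀ x : ℝ, 1 - Real.cos x ≤ |x| := by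
    intro x
    have h2 := Real.one_sub_sq_div_two_le_cos (x := x)
    have h3 := Real.neg_one_le_cos x
    rw [← sq_abs] at h2
    rcases le_total |x| 2 with h4 | h4 <;> nlinarith [abs_nonneg x]
  have h2 : |2 * Real.pi * (a.1 * ξ.1 + a.2 * ξ.2)| ≤
      |a.1| * |2 * Real.pi * ξ.1| + |a.2| * |2 * Real.pi * ξ.2| := by
    rw [← abs_mul, ← abs_mul]
    refine le_trans (le_of_eq ?_) (abs_add_le _ _)
    congr 1
    ring
  have h3 := mul_le_mul_of_nonneg_right ((hcos _).trans h2) hF0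
  have e1 : |a.1| * |2 * Real.pi * ξ.1| * F = |a.1| / T * (|2 * Real.pi * ξ.1| * T * F) := by
    field_simp
  have e2 : |a.2| * |2 * Real.pi * ξ.2| * F = |a.2| / γ T * (|2 * Real.pi * ξ.2| * γ T * F) := by
    field_simp
  have h4 := mul_le_mul_of_nonneg_left h1.1 (by positivity : 0 ≤ |a.1| / T)
  have h5 := mul_le_mul_of_nonneg_left h1.2 (by positivity : 0 ≤ |a.2| / γ T)
  rw [add_mul] at h3
  linarith

end Curve

section

/-- The exponent of the smallest power of two dominating `γ (2 ^ k)`. -/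
noncomputable def height (γ : ℝ → ℝ) (k : ℤ) : ℤ := Int.clog 2 (γ (2 ^ k))

/-- The dyadic rectangle adapted to the piece of the curve at scale `2 ^ k`. -/
noncomputable def rect (γ : ℝ → ℝ) (k : ℤ) : ℤ × ℤ := (k, height γ k)

/-- Measures with the size and the Fourier decay of a piece of the curve at scale `2 ^ j`. -/
structure Adapted (γ : ℝ → ℝ) (K : ℝ) (j : ℤ) (ν : Measure Plane) (R : ℝ) : Prop where
  sub : SubProb ν R
  fourier : ∀ a ξ : Plane, (1 - Real.cos (2 * Real.pi * (a.1 * ξ.1 + a.2 * ξ.2))) *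
    fourierSq ν ξ ≤ 2 * K * (|a.1| / 2 ^ j + |a.2| / γ (2 ^ j))
  range : ∀ᵐ y ∂ν, |y.1| ≤ 2 * 2 ^ j ∧ |y.2| ≤ γ (2 * 2 ^ j)

variable {γ : ℝ → ℝ} {C₀ K R : ℝ} {j k : ℤ} {ν : Measure Plane}

lemma oscConst_nonneg (C₀ : ℝ) : 0 ≤ oscConst C₀ := sq_nonneg _

lemma Curve.adapted (h : Curve γ C₀) (j : ℤ) :
    Adapted γ (oscConst C₀) j (curveMeasure γ (2 ^ j)) (max (2 * 2 ^ j) (γ (2 * 2 ^ j))) :=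
  ⟨h.subProb (by positivity), h.one_sub_cos_mul_fourierSq_le (by positivity),
    h.ae_abs_le (by positivity)⟩

lemma Adapted.neg (h : Adapted γ K j ν R) : Adapted γ K j (ν.map fun y => -y) R := by
  refine ⟨h.sub.neg, fun a ξ => by rw [fourierSq_neg]; exact h.fourier a ξ, ?_⟩
  have h1 : MeasurableSet {y : Plane | |y.1| ≤ 2 * 2 ^ j} :=
    measurableSet_le (by fun_prop) measurable_const
  have h2 : MeasurableSet {y : Plane | |y.2| ≤ γ (2 * 2 ^ j)} :=
    measurableSet_le (by fun_prop) measurable_const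
  refine (ae_map_iff measurable_neg.aemeasurable (h1.inter h2)).2 ?_
  filter_upwards [h.range] with y hy
  change |(-y).1| ≤ 2 * 2 ^ j ∧ |(-y).2| ≤ γ (2 * 2 ^ j)
  simpa using hy

section height

lemma le_two_zpow_height (γ : ℝ → ℝ) (k : ℤ) : γ (2 ^ k) ≤ 2 ^ height γ k := by
  simpa [height] using Int.self_le_zpow_clog one_lt_two (γ (2 ^ k))

lemma Curve.two_zpow_height_le (h : Curve γ C₀) (k : ℤ) :
    (2 : ℝ) ^ height γ k ≤ 2 * γ (2 ^ k) := by
  have := Int.zpow_pred_clog_lt_self one_lt_two (h.pos (2 ^ k) (by positivity))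
  rw [zpow_sub_one₀ (by norm_num)] at this
  push_cast at this
  change (2 : ℝ) ^ height γ k * 2⁻¹ < _ at this
  linarith

lemma Curve.height_mono (h : Curve γ C₀) : Monotone (height γ) := fun k l hkl =>
  Int.clog_mono_right (h.pos _ (by positivity))
    (h.monotoneOn (by positivity) (zpow_le_zpow_right₀ one_le_two hkl))

lemma Curve.rect_mono (h : Curve γ C₀) : Monotone (rect γ) := fun _ _ hkl =>
  ⟨hkl, h.height_mono hkl⟩

end height

lemma Adapted.wnorm_sub_cellAvg_lin_le (h : Curve γ C₀) (hν : Adapted γ K j ν R) (hK : 0 ≤ K)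
    (hkj : k ≤ j) (f : TestFn) :
    wnorm (fun _ => 1)
        ((convAvg hν.sub).lin f - (cellAvg (rect γ k)).lin ((convAvg hν.sub).lin f)) ≤
      192 * K * 2 ^ (k - j) * wnorm (fun _ => 1) f := by
  have hN := wnorm_nonneg (w := fun _ => 1) (fun _ => zero_le_one) f
  have h2 : (0 : ℝ) < 2 ^ (k - j) := by positivity
  refine (wnorm_sub_cellAvg_le (rect γ k) _
    (ε := 48 * K * 2 ^ (k - j) * wnorm (fun _ => 1) f) (by positivity) fun a ha => ?_).trans
    (le_of_eq (by ring))
  have hγ := h.pos (2 ^ j) (by positivity)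
  have hb : |a.1| / 2 ^ j + |a.2| / γ (2 ^ j) ≤ 3 * 2 ^ (k - j) := by
    obtain ⟨h1, h3⟩ := ha
    have ha1 : |a.1| ≤ 2 ^ k := abs_le.2 ⟨h1.1, h1.2⟩
    have ha2 : |a.2| ≤ 2 ^ height γ k := abs_le.2 ⟨h3.1, h3.2⟩
    have h4 := h.slope (2 ^ k) (2 ^ j) (by positivity) (zpow_le_zpow_right₀ one_le_two hkj)
    have h5 := h.two_zpow_height_le k
    have e1 : |a.1| / 2 ^ j ≤ 2 ^ (k - j) := by
      rw [zpow_sub₀ two_ne_zero]; gcongr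
    have e2 : |a.2| / γ (2 ^ j) ≤ 2 * 2 ^ (k - j) := by
      have hj : (0 : ℝ) < 2 ^ j := by positivity
      rw [zpow_sub₀ two_ne_zero, div_le_iff₀ hγ]
      have : γ (2 ^ k) ≤ 2 ^ k / 2 ^ j * γ (2 ^ j) := by
        rw [div_mul_eq_mul_div, le_div_iff₀ hj]; exact h4
      linarith
    linarith
  refine (wnorm_sub_shift_le hν.sub a (ε := 6 * K * 2 ^ (k - j)) (by positivity) (fun ξ => ?_)
    f).trans (le_of_eq (by ring))
  refine (hν.fourier a ξ).trans ?_
  nlinarith [mul_le_mul_of_nonneg_left hb hK]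

lemma Adapted.wnorm_lin_sub_cellAvg_le (h : Curve γ C₀) (hν : Adapted γ K j ν R) (hK : 0 < K)
    (hkj : k ≤ j) (f : TestFn) :
    wnorm (fun _ => 1) ((convAvg hν.sub).lin (f - (cellAvg (rect γ k)).lin f)) ≤
      192 * K * 2 ^ (k - j) * wnorm (fun _ => 1) f := by
  refine wnorm_one_le_of_adj (T := (convAvg hν.sub).lin * (1 - (cellAvg (rect γ k)).lin))
    (S := (1 - (cellAvg (rect γ k)).lin) * (convAvg hν.sub).symm.lin) (by positivity)
    (fun f g => ?_) (fun f => ?_) f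
  · simp only [Module.End.mul_apply, LinearMap.sub_apply, Module.End.one_apply, map_sub,
      LinearMap.sub_apply]
    rw [pair_lin (cellAvg (rect γ k)), cellAvg_symm, pair_lin (convAvg hν.sub).symm,
      pair_lin (convAvg hν.sub).symm]
    rfl
  · rw [convAvg_symm_lin]
    exact hν.neg.wnorm_sub_cellAvg_lin_le h hK.le hkj f

lemma Adapted.wnorm_lin_sub_smul_le (h : Curve γ C₀) (hν : Adapted γ K j ν R)
    (hkj : j + 1 ≤ k) {g : TestFn} (hg : CellConst (rect γ k) g) :
    wnorm (fun _ => 1) ((convAvg hν.sub).lin g - ν.real Set.univ • g) ≤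
      16 * 2 ^ (j - k) * wnorm (fun _ => 1) g := by
  have hN := wnorm_nonneg (w := fun _ => 1) (fun _ => zero_le_one) g
  refine wnorm_convAvg_sub_smul_le hν.sub g (by positivity) ?_
  filter_upwards [hν.range] with y hy
  refine (wnorm_sub_shift_le_of_cellConst hg y).trans ?_
  refine mul_le_mul_of_nonneg_right ?_ hN
  have hp : (0 : ℝ) < 2 ^ height γ k := by positivity
  have hk : (0 : ℝ) < 2 ^ k := by positivity
  have h1 : |y.1| / 2 ^ k ≤ 2 * 2 ^ (j - k) := by
    rw [zpow_sub₀ two_ne_zero, ← mul_div_assoc]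
    exact div_le_div_of_nonneg_right hy.1 (by positivity)
  have h2 : |y.2| / 2 ^ height γ k ≤ 2 * 2 ^ (j - k) := by
    have e : (2 : ℝ) * 2 ^ j = 2 ^ (j + 1) := by rw [zpow_add_one₀ two_ne_zero, mul_comm]
    have h4 := h.slope (2 * 2 ^ j) (2 ^ k) (by positivity)
      (e ▸ zpow_le_zpow_right₀ one_le_two hkj)
    have h5 := le_two_zpow_height γ k
    rw [div_le_iff₀ hp, zpow_sub₀ two_ne_zero]
    have h6 : γ (2 * 2 ^ j) ≤ 2 * 2 ^ j / 2 ^ k * γ (2 ^ k) := by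
      rw [div_mul_eq_mul_div, le_div_iff₀ hk]; exact h4
    have h7 : 2 * 2 ^ j / 2 ^ k * γ (2 ^ k) ≤ 2 * (2 ^ j / 2 ^ k) * 2 ^ height γ k := by
      rw [mul_div_assoc]
      gcongr
    exact hy.2.trans (h6.trans h7)
  have h3 : frac (rect γ k) y = |y.1| / 2 ^ k + |y.2| / 2 ^ height γ k := rfl
  rw [h3]
  linarith

/-- The difference between an adapted average and the corresponding multiple of the conditional
expectation on rectangles of the same scale. -/
noncomputable def Adapted.error (hν : Adapted γ K j ν R) : Module.End ℝ TestFn :=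
  (convAvg hν.sub).lin - ν.real Set.univ • (cellAvg (rect γ j)).lin

lemma Adapted.error_apply (hν : Adapted γ K j ν R) (f : TestFn) :
    hν.error f = (convAvg hν.sub).lin f - ν.real Set.univ • (cellAvg (rect γ j)).lin f := rfl

lemma SubProb.real_le_one (h : SubProb ν R) : ν.real Set.univ ≤ 1 := by
  simpa [Measure.real] using ENNReal.toReal_mono ENNReal.one_ne_top h.mass

lemma Adapted.wnorm_error_le (hν : Adapted γ K j ν R) (g : TestFn) :
    wnorm (fun _ => 1) (hν.error g) ≤ 4 * wnorm (fun _ => 1) g := by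
  rw [hν.error_apply]
  refine (wnorm_sub_le IsWeight.one _ _).trans ?_
  rw [wnorm_smul]
  have h1 := wnorm_one_lin_le (convAvg hν.sub) g
  have h2 := wnorm_one_lin_le (cellAvg (rect γ j)) g
  have h3 := hν.sub.real_le_one
  have h4 : 0 ≤ ν.real Set.univ := measureReal_nonneg
  have h5 := wnorm_nonneg (w := fun _ => 1) (fun _ => zero_le_one) ((cellAvg (rect γ j)).lin g)
  have h6 : ν.real Set.univ ^ 2 * wnorm (fun _ => 1) ((cellAvg (rect γ j)).lin g) ≤
      wnorm (fun _ => 1) ((cellAvg (rect γ j)).lin g) :=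
    mul_le_of_le_one_left h5 (pow_le_one₀ h4 h3)
  linarith

lemma Adapted.wnorm_error_le_of_eq_zero (h : Curve γ C₀) (hν : Adapted γ K j ν R) (hK : 0 < K)
    (hkj : k ≤ j) {g : TestFn} (hg : (cellAvg (rect γ k)).lin g = 0) :
    wnorm (fun _ => 1) (hν.error g) ≤ 192 * K * 2 ^ (k - j) * wnorm (fun _ => 1) g := by
  have h1 := hν.wnorm_lin_sub_cellAvg_le h hK hkj g
  rw [hg, sub_zero] at h1
  rwa [hν.error_apply, ← cellAvg_lin_comp_of_ge (h.rect_mono hkj), hg, map_zero, smul_zero,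
    sub_zero]

lemma Adapted.wnorm_error_le_of_cellConst (h : Curve γ C₀) (hν : Adapted γ K j ν R)
    (hkj : j + 1 ≤ k) {g : TestFn} (hg : CellConst (rect γ k) g) :
    wnorm (fun _ => 1) (hν.error g) ≤ 16 * 2 ^ (j - k) * wnorm (fun _ => 1) g := by
  have h1 : (cellAvg (rect γ j)).lin g = g :=
    Subtype.ext (cellAvg_op_of_const (hg.mono (h.rect_mono (by omega))))
  rw [hν.error_apply, h1]
  exact hν.wnorm_lin_sub_smul_le h hkj hg

lemma Adapted.skew_eq (hν : Adapted γ K j ν R) :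
    (convAvg hν.sub).lin - (convAvg hν.sub).symm.lin = hν.error - hν.neg.error := by
  have : (ν.map fun y : Plane => -y).real Set.univ = ν.real Set.univ := by
    rw [Measure.real, Measure.map_apply measurable_neg MeasurableSet.univ, Set.preimage_univ]
    rfl
  rw [convAvg_symm_lin, Adapted.error, Adapted.error, this]
  abel

section Chain

variable {F : ℕ → ℤ × ℤ} {n : ℕ → ℕ} {N : ℕ}

lemma Adapted.wnorm_error_stopDiff_le (h : Curve γ C₀) (hK : 0 < K) (hF : ∀ i, F i ≤ F (i + 1))
    (hn : Monotone n) {L : ℕ} {z : ℤ} (hFn : ∀ i ≤ L, F (n i) = rect γ (z + i)) {l : ℕ} (hl : l < L)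
    (hν : Adapted γ K (z + l) ν R) {i : ℕ} (hi : i < L + 2) (f : TestFn) :
    wnorm (fun _ => 1) (hν.error (stopDiff F n L i f)) ≤
      (192 * K + 32) * (1 / 2) ^ ((i - l) + (l - i)) * wnorm (fun _ => 1) (stopDiff F n L i f) := by
  set g := stopDiff F n L i f with hg
  have hN := wnorm_nonneg (w := fun _ => 1) (fun _ => zero_le_one) g
  rcases lt_trichotomy i (l + 1) with hil | hil | hil
  · have h1 : (cellAvg (rect γ (z + i))).lin g = 0 := by
      rw [← hFn i (by omega), ← stopAvg_succ (K := L) (by omega), hg, stopAvg_succ_stopDiff hF hn]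
    refine (hν.wnorm_error_le_of_eq_zero h hK (by omega) h1).trans ?_
    have e : (z + i : ℤ) - (z + l) = -((i - l) + (l - i) : ℕ) := by omega
    rw [e, zpow_neg, zpow_natCast, one_div, inv_pow]
    gcongr
    linarith
  · refine (hν.wnorm_error_le g).trans ?_
    have e : (i - l) + (l - i) = 1 := by omega
    rw [e]
    gcongr
    linarith
  · obtain ⟨i', rfl⟩ : ∃ i', i = i' + 1 := ⟨i - 1, by omega⟩
    have h1 : CellConst (rect γ (z + i')) g := by
      rw [hg, ← stopAvg_stopDiff hF hn, stopAvg_succ (by omega), hFn i' (by omega)]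
      exact cellConst_op _ _
    refine (hν.wnorm_error_le_of_cellConst h (by omega) h1).trans ?_
    have e : (z + l : ℤ) - (z + i') = -((i' + 1 - l) + (l - (i' + 1)) : ℕ) + 1 := by omega
    rw [e, zpow_add_one₀ two_ne_zero, zpow_neg, zpow_natCast, one_div, inv_pow]
    refine mul_le_mul_of_nonneg_right ?_ hN
    have : (0:ℝ) ≤ (2 ^ ((i' + 1 - l) + (l - (i' + 1))))⁻¹ := by positivity
    nlinarith

end Chain

end

section

/-- An increasing family of rectangles can be refined so that areas at most double at each step. -/
lemma exists_refinement (S : ℕ → ℤ × ℤ) (h1 : ∀ j, (S (j + 1)).1 = (S j).1 + 1)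
    (h2 : ∀ j, (S j).2 ≤ (S (j + 1)).2) :
    ∃ (F : ℕ → ℤ × ℤ) (n : ℕ → ℕ), (∀ i, F i ≤ F (i + 1)) ∧
      (∀ i, area (F (i + 1)) ≤ 2 * area (F i)) ∧ n 0 = 0 ∧ Monotone n ∧ ∀ j, F (n j) = S j := by
  set b : ℤ := (S 0).1 + (S 0).2 with hb
  have hsum : ∀ j, b + j ≤ (S j).1 + (S j).2 := fun j => by
    induction j with
    | zero => simp [hb]
    | succ j ih => have := h1 j; have := h2 j; push_cast; omega
  set n : ℕ → ℕ := fun j => ((S j).1 + (S j).2 - b).toNat with hn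
  have hnj : ∀ j, (n j : ℤ) = (S j).1 + (S j).2 - b := fun j => by
    have := hsum j
    simp only [hn]
    omega
  have hmono : StrictMono n := strictMono_nat_of_lt_succ fun j => by
    have := h1 j; have := h2 j; have := hnj j; have := hnj (j + 1); omega
  have hex : ∀ i, ∃ j, i ≤ n j := fun i => ⟨i, hmono.le_apply⟩
  set κ : ℕ → ℕ := fun i => Nat.find (hex i) with hκ
  have hκle : ∀ i, i ≤ n (κ i) := fun i => Nat.find_spec (hex i)
  have hκn : ∀ j, κ (n j) = j := fun j => by
    rw [hκ, Nat.find_eq_iff]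
    exact ⟨le_rfl, fun m hm => not_le.2 (hmono hm)⟩
  have hstep : ∀ i, κ (i + 1) = κ i ∨ (κ (i + 1) = κ i + 1 ∧ i = n (κ i)) := fun i => by
    rcases (hκle i).lt_or_eq with h | h
    · left
      rw [hκ, Nat.find_eq_iff]
      exact ⟨h, fun m hm hm' => Nat.find_min (hex i) hm (by omega)⟩
    · right
      refine ⟨?_, h⟩
      conv_lhs => rw [hκ]
      rw [Nat.find_eq_iff]
      have hκi := hmono (Nat.lt_succ_self (κ i))
      simp only [Nat.succ_eq_add_one] at hκi
      refine ⟨by omega,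
        fun m hm => ?_⟩
      have := hmono.monotone (Nat.lt_succ_iff.1 hm)
      omega
  set F : ℕ → ℤ × ℤ := fun i => ((S (κ i)).1, b + i - (S (κ i)).1) with hF
  have hone : ∀ i, F (i + 1) = ((F i).1, (F i).2 + 1) ∨ F (i + 1) = ((F i).1 + 1, (F i).2) := by
    intro i
    rcases hstep i with h | ⟨h, -⟩
    · left
      simp only [hF, h, Prod.mk.injEq, true_and]
      push_cast
      ring
    · right
      simp only [hF, h, h1, Prod.mk.injEq, true_and]
      push_cast
      ring
  refine ⟨F, n, fun i => ?_, fun i => ?_, ?_, hmono.monotone, fun j => ?_⟩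
  · rcases hone i with h | h <;> rw [h] <;> constructor <;> simp
  · rcases hone i with h | h <;>
      (rw [h]; simp only [area, zpow_add_one₀ (two_ne_zero (α := ℝ))]; linarith)
  · simp [hn, hb]
  · have := hnj j
    ext <;> simp only [hF, hκn] <;> omega

variable {γ : ℝ → ℝ} {C₀ : ℝ}

/-- The piece of the averages along the curve at scale `2 ^ j`. -/
noncomputable def Curve.piece (h : Curve γ C₀) (j : ℤ) : Avg := convAvg (h.adapted j).sub

/-- A finite chain of rectangles adapted to the scales `2 ^ z, …, 2 ^ (z + L)` of the curve. -/
structure Frame (h : Curve γ C₀) (z : ℤ) (L : ℕ) where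
  F : ℕ → ℤ × ℤ
  n : ℕ → ℕ
  step : ∀ i, F i ≤ F (i + 1)
  area_le : ∀ i, area (F (i + 1)) ≤ 2 * area (F i)
  zero : n 0 = 0
  mono : Monotone n
  eq_rect : ∀ j : ℕ, F (n j) = rect γ (z + j)

lemma Curve.nonempty_frame (h : Curve γ C₀) (z : ℤ) (L : ℕ) : Nonempty (Frame h z L) := by
  obtain ⟨F, n, h1, h2, h3, h4, h5⟩ := exists_refinement (fun j : ℕ => rect γ (z + j))
    (fun j => by simp [rect, add_assoc]) (fun j => h.height_mono (by push_cast; omega))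
  exact ⟨⟨F, n, h1, h2, h3, h4, h5⟩⟩

namespace Frame

variable {h : Curve γ C₀} {z : ℤ} {L : ℕ} (P : Frame h z L)

/-- The averaging operators attached to a frame. -/
def family : Set Avg :=
  {A | (∃ i ≤ P.n L, A = cellAvg (P.F i)) ∨
    ∃ j < L, A = h.piece (z + j) ∨ A = (h.piece (z + j)).symm}

lemma isChain : IsChain P.family P.F P.n L :=
  ⟨P.step, P.area_le, fun i hi => Or.inl ⟨i, hi, rfl⟩, P.zero, P.mono⟩

lemma wnorm_error_le {R : ℝ} {ν : Measure Plane} {l : ℕ} (hl : l < L)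
    (hν : Adapted γ (oscConst C₀) (z + l) ν R) {i : ℕ} (hi : i < L + 2) (f : TestFn) :
    wnorm (fun _ => 1) (hν.error (stopDiff P.F P.n L i f)) ≤
      (192 * oscConst C₀ + 32) * (1 / 2) ^ ((i - l) + (l - i)) *
        wnorm (fun _ => 1) (stopDiff P.F P.n L i f) := by
  have hK : 0 < oscConst C₀ := by
    have := h.const_pos
    rw [oscConst]
    positivity
  exact hν.wnorm_error_stopDiff_le h hK P.step P.mono (fun i _ => P.eq_rect i) hl hi f

lemma wnorm_stopDiff_le (i : ℕ) (f : TestFn) :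
    wnorm (fun _ => 1) (stopDiff P.F P.n L i f) ≤ 4 * wnorm (fun _ => 1) f := by
  have h1 : IsA1 P.family 1 (fun _ => (1 : ℝ)) := IsA1.one le_rfl
  simpa using P.isChain.wnorm_stopDiff_le le_rfl h1 h1 i f

/-- The weighted estimate for the truncated Hilbert transform, uniformly in the truncation. -/
lemma wnorm_sum_skew_le : ∃ M : ℝ → ℝ → ℝ, (∀ C₀ C, 0 ≤ M C₀ C) ∧
    ∀ (γ : ℝ → ℝ) (C₀ : ℝ) (h : Curve γ C₀) (z : ℤ) (L : ℕ) (P : Frame h z L) (C : ℝ)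
      (U V : Plane → ℝ), 1 ≤ C → IsA1 P.family C U → IsA1 P.family C V → ∀ f,
      wnorm (ratioWeight U V) (∑ j ∈ Finset.range L,
        ((h.piece (z + j)).lin - (h.piece (z + j)).symm.lin) f) ≤
        M C₀ C * wnorm (ratioWeight U V) f := by
  set r : ℝ := (1 / 2) ^ (1 / 20 : ℝ) with hr
  have hr0 : 0 < r := by positivity
  have hr1 : r < 1 := Real.rpow_lt_one (by norm_num) (by norm_num) (by norm_num)
  have hr20 : r ^ 20 = 1 / 2 := by
    rw [hr, ← Real.rpow_natCast, ← Real.rpow_mul (by norm_num)]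
    norm_num
  refine ⟨fun C₀ C => max 0 ((2 * (1 - r)⁻¹) ^ 4 * (200000 * C ^ 8) ^ 2 *
    ((4 * (16 * (192 * oscConst C₀ + 32))) ^ (1 / 5 : ℝ) * (64 * C ^ 6) ^ (4 / 5 : ℝ))),
    fun _ _ => le_max_left _ _, fun γ C₀ h z L P C U V hC hU hV f => ?_⟩
  have hK := oscConst_nonneg C₀
  refine (P.isChain.wnorm_sum_skew_le (A := fun j => h.piece (z + j)) (fun j hj =>
    ⟨Or.inr ⟨j, hj, Or.inl rfl⟩, Or.inr ⟨j, hj, Or.inr rfl⟩⟩) hr0 hr1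
    (C₁ := 16 * (192 * oscConst C₀ + 32)) (by positivity) (fun i hi j hj g => ?_) hC hU hV f).trans
    (mul_le_mul_of_nonneg_right (le_max_right _ _) (wnorm_nonneg (fun x =>
      ((isWeight_ratioWeight hU.weight hV.weight).pos x).le) f))
  rw [Curve.piece, (h.adapted _).skew_eq, LinearMap.sub_apply]
  have h1 := P.wnorm_error_le hj (h.adapted (z + j)) hi g
  have h2 := P.wnorm_error_le hj (h.adapted (z + j)).neg hi g
  have h3 := P.wnorm_stopDiff_le i g
  refine (wnorm_sub_le IsWeight.one _ _).trans ?_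
  rw [← pow_mul, mul_comm _ 20, pow_mul, hr20]
  set a : ℝ := (192 * oscConst C₀ + 32) * (1 / 2) ^ ((i - j) + (j - i)) with ha
  have ha0 : 0 ≤ a := by positivity
  have h4 := mul_le_mul_of_nonneg_left h3 ha0
  have e : 16 * (192 * oscConst C₀ + 32) * (1 / 2) ^ ((i - j) + (j - i)) = 16 * a := by
    rw [ha]; ring
  rw [e]
  linarith

end Frame

end

/-- The pointwise maximum of two test functions. -/
noncomputable def TestFn.sup (f g : TestFn) : TestFn := ⟨fun x => max (f x) (g x), by
  obtain ⟨hf, R, hR⟩ := f.2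
  obtain ⟨hg, S, hS⟩ := g.2
  refine ⟨hf.max hg, max R S, fun x => ⟨abs_max_le_max_abs_abs.trans
    (max_le_max (hR x).1 (hS x).1), fun hx => ?_⟩⟩
  simp [(hR x).2 ((le_max_left _ _).trans_lt hx), (hS x).2 ((le_max_right _ _).trans_lt hx)]⟩

@[simp] lemma TestFn.sup_apply (f g : TestFn) (x : Plane) : f.sup g x = max (f x) (g x) := rfl

section Doob

variable (F : ℕ → ℤ × ℤ) (m : ℕ) (u : TestFn)

/-- Running maxima of the conditional expectations along a chain, starting from the coarsest. -/
noncomputable def runMax : ℕ → TestFn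
  | 0 => (cellAvg (F m)).lin u
  | k + 1 => (runMax k).sup ((cellAvg (F (m - (k + 1)))).lin u)

variable {F m u}

lemma cellConst_runMax (hF : ∀ i, F i ≤ F (i + 1)) (k : ℕ) :
    CellConst (F (m - k)) (runMax F m u k) := by
  induction k with
  | zero => exact cellConst_op _ _
  | succ k ih =>
    intro x y hxy
    have h1 := ih.mono (monotone_nat_of_le_succ hF (show m - (k + 1) ≤ m - k by omega)) x y hxy
    have h2 : (cellAvg (F (m - (k + 1)))).op u x = (cellAvg (F (m - (k + 1)))).op u y :=
      cellConst_op _ _ x y hxy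
    simp only [runMax, TestFn.sup_apply, h1, Avg.lin_apply, h2]

lemma le_runMax {k i : ℕ} (hi : i ≤ k) (x : Plane) :
    (cellAvg (F (m - i))).op u x ≤ runMax F m u k x := by
  induction k with
  | zero => rw [Nat.le_zero.1 hi]; exact le_rfl
  | succ k ih =>
    rcases hi.lt_or_eq with h | rfl
    · exact (ih (by omega)).trans (le_max_left _ _)
    · exact le_max_right _ _

lemma wnorm_runMax_le_aux (hF : ∀ i, F i ≤ F (i + 1)) (k : ℕ) :
    wnorm (fun _ => 1) (runMax F m u k) ≤ 2 * pair (runMax F m u k) u := by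
  induction k with
  | zero =>
    have h1 : pair ((cellAvg (F m)).lin u) u = wnorm (fun _ => 1) ((cellAvg (F m)).lin u) := by
      have := integral_mul_cellAvg (φ := (cellAvg (F m)).lin u) (cellConst_op (F m) u) u.locBdd
      rw [pair_apply, ← this, wnorm]
      simp [pow_two]
    have h2 := wnorm_nonneg (w := fun _ => 1) (fun _ => zero_le_one) ((cellAvg (F m)).lin u)
    simp only [runMax, h1]
    linarith
  | succ k ih =>
    set M := runMax F m u k with hM
    set M' := runMax F m u (k + 1) with hM'
    set v := (cellAvg (F (m - (k + 1)))).lin u with hv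
    have hc : CellConst (F (m - (k + 1))) (M' - M) := by
      have h1 := cellConst_runMax (m := m) (u := u) hF (k + 1)
      have h2 := (cellConst_runMax (m := m) (u := u) hF k).mono
        (monotone_nat_of_le_succ hF (show m - (k + 1) ≤ m - k by omega))
      intro x y hxy
      exact congrArg₂ (· - ·) (h1 x y hxy) (h2 x y hxy)
    have h1 : pair (M' - M) v = pair (M' - M) u := integral_mul_cellAvg hc u.locBdd
    have h2 : wnorm (fun _ => 1) M' ≤ wnorm (fun _ => 1) M + 2 * pair (M' - M) v := by
      rw [wnorm, wnorm, pair_apply, ← integral_const_mul,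
        ← integral_add (M.integrable_sq_mul (LocBdd.const 1))
          (((M' - M).integrable_mul v.locBdd).const_mul 2)]
      refine integral_mono (M'.integrable_sq_mul (LocBdd.const 1))
        ((M.integrable_sq_mul (LocBdd.const 1)).add
          (((M' - M).integrable_mul v.locBdd).const_mul 2)) fun x => ?_
      have e : M' x = max (M x) (v x) := rfl
      simp only [mul_one, TestFn.sub_apply, e]
      rcases le_total (M x) (v x) with h | h
      · rw [max_eq_right h]; nlinarith
      · rw [max_eq_left h]; nlinarith
    rw [h1, map_sub, LinearMap.sub_apply] at h2
    linarith

/-- Doob's maximal inequality for a chain of conditional expectations. -/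
lemma wnorm_runMax_le (hF : ∀ i, F i ≤ F (i + 1)) (k : ℕ) :
    wnorm (fun _ => 1) (runMax F m u k) ≤ 4 * wnorm (fun _ => 1) u := by
  have h1 := wnorm_runMax_le_aux (m := m) (u := u) hF k
  have h2 := pair_le IsWeight.one two_pos (runMax F m u k) u
  simp only [inv_one] at h2
  linarith

end Doob

/-- The pointwise maximum of a function and finitely many of its averages. -/
noncomputable def maxList (l : List Avg) (u : TestFn) : TestFn :=
  l.foldr (fun A g => (A.lin u).sup g) u

section maxList

variable {l : List Avg} {u : TestFn} {x : Plane}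

lemma le_maxList : u x ≤ maxList l u x := by
  induction l with
  | nil => exact le_rfl
  | cons A l ih => exact ih.trans (le_max_right _ _)

lemma op_le_maxList {A : Avg} (hA : A ∈ l) : A.op u x ≤ maxList l u x := by
  induction l with
  | nil => simp at hA
  | cons B l ih =>
    rcases List.mem_cons.1 hA with rfl | h
    · exact le_max_left _ _
    · exact (ih h).trans (le_max_right _ _)

lemma maxList_le {b : ℝ} (h0 : u x ≤ b) (h : ∀ A ∈ l, A.op u x ≤ b) : maxList l u x ≤ b := by
  induction l with
  | nil => exact h0
  | cons B l ih =>
    exact max_le (h B (by simp)) (ih fun A hA => h A (by simp [hA]))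

end maxList

namespace Frame

variable {γ : ℝ → ℝ} {C₀ : ℝ} {h : Curve γ C₀} {z : ℤ} {L : ℕ} (P : Frame h z L)

/-- Square function estimate for the differences between the pieces of the averages along the
curve and conditional expectations. -/
lemma sum_wnorm_error_le : ∃ M : ℝ → ℝ, (∀ C₀, 0 ≤ M C₀) ∧
    ∀ (γ : ℝ → ℝ) (C₀ : ℝ) (h : Curve γ C₀) (z : ℤ) (L : ℕ), Frame h z L →
      ∀ (ν : ℕ → Measure Plane) (R : ℕ → ℝ)
        (hν : ∀ l : ℕ, Adapted γ (oscConst C₀) (z + l) (ν l) (R l)) (f : TestFn),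
      ∑ l ∈ Finset.range L, wnorm (fun _ => 1) ((hν l).error f) ≤
        M C₀ * wnorm (fun _ => 1) f := by
  set r : ℝ := (1 / 2) ^ (1 / 2 : ℝ) with hr
  have hr0 : 0 < r := by positivity
  have hr1 : r < 1 := Real.rpow_lt_one (by norm_num) (by norm_num) (by norm_num)
  have hr2 : r * r = 1 / 2 := by
    rw [hr, ← Real.rpow_add (by norm_num)]
    norm_num
  have hS : 0 < 2 * (1 - r)⁻¹ := mul_pos two_pos (inv_pos.2 (by linarith))
  set S := 2 * (1 - r)⁻¹ with hSdef
  refine ⟨fun C₀ => S * ((192 * oscConst C₀ + 32) * (S * 200000)), fun C₀ => by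
    have := oscConst_nonneg C₀; positivity, fun γ C₀ h z L P ν R hν f => ?_⟩
  have hK := oscConst_nonneg C₀
  set C₁ := 192 * oscConst C₀ + 32 with hC₁
  set D := fun i => stopDiff P.F P.n L i f with hD
  have hsum : ∑ i ∈ Finset.range (L + 2), D i = f := sum_stopDiff f
  have hDn : ∑ i ∈ Finset.range (L + 2), wnorm (fun _ => 1) (D i) ≤
      200000 * wnorm (fun _ => 1) f := by
    have h1 : IsA1 P.family 1 (fun _ => (1 : ℝ)) := IsA1.one le_rfl
    have h2 := P.isChain.sum_wnorm_stopDiff_le le_rfl h1 h1 f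
    have e : ratioWeight (fun _ => 1) (fun _ => 1) = fun _ => 1 := by
      ext x
      simp [ratioWeight]
    simpa [e] using h2
  have hN0 : ∀ g, 0 ≤ wnorm (fun _ => 1) g := wnorm_nonneg fun _ => zero_le_one
  set d : ℕ → ℕ → ℝ := fun i l => r ^ ((i - l) + (l - i)) with hd
  have hd0 : ∀ i l, 0 < d i l := fun i l => by positivity
  have hdcol : ∀ l, ∑ i ∈ Finset.range (L + 2), d i l ≤ S := fun l => by
    have := sum_pow_dist_le hr0 hr1 l (L + 2)
    simpa only [hd, add_comm] using this
  have hkey : ∀ l ∈ Finset.range L, wnorm (fun _ => 1) ((hν l).error f) ≤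
      S * ∑ i ∈ Finset.range (L + 2), C₁ * d i l * wnorm (fun _ => 1) (D i) := by
    intro l hl
    set g := fun i => (hν l).error (D i) with hg
    have hpt : ∀ x, (hν l).error f x ^ 2 ≤
        S * ∑ i ∈ Finset.range (L + 2), (d i l)⁻¹ * g i x ^ 2 := by
      intro x
      have e : (hν l).error f x = ∑ i ∈ Finset.range (L + 2), g i x := by
        rw [← TestFn.sum_apply, hg, ← map_sum, hsum]
      rw [e]
      have h1 := Finset.sum_sq_le_sum_mul_sum_of_sq_le_mul (Finset.range (L + 2))
        (r := fun i => g i x) (f := fun i => d i l) (g := fun i => (d i l)⁻¹ * g i x ^ 2)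
        (fun i _ => (hd0 i l).le) (fun i _ => by have := hd0 i l; positivity) (fun i _ => by
          have := (hd0 i l).ne'
          exact (by field_simp : g i x ^ 2 = d i l * ((d i l)⁻¹ * g i x ^ 2)).le)
      refine h1.trans (mul_le_mul_of_nonneg_right (hdcol l) ?_)
      exact Finset.sum_nonneg fun i _ => by have := hd0 i l; positivity
    have hi_int : ∀ i ∈ Finset.range (L + 2), Integrable fun x => (d i l)⁻¹ * (g i x ^ 2 * 1) :=
      fun i _ => ((g i).integrable_sq_mul (LocBdd.const 1)).const_mul _
    calc wnorm (fun _ => 1) ((hν l).error f)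
        ≤ ∫ x, S * ∑ i ∈ Finset.range (L + 2), (d i l)⁻¹ * (g i x ^ 2 * 1) := by
          refine integral_mono (TestFn.integrable_sq_mul _ (LocBdd.const 1))
            ((integrable_finsetSum _ hi_int).const_mul S) fun x => ?_
          simpa using hpt x
      _ = S * ∑ i ∈ Finset.range (L + 2), (d i l)⁻¹ * wnorm (fun _ => 1) (g i) := by
          rw [integral_const_mul, integral_finsetSum _ hi_int]
          simp only [integral_const_mul]
          rfl
      _ ≤ _ := by
          refine mul_le_mul_of_nonneg_left (Finset.sum_le_sum fun i hi => ?_) hS.le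
          have h1 := P.wnorm_error_le (Finset.mem_range.1 hl) (hν l) (Finset.mem_range.1 hi) f
          have h2 := mul_le_mul_of_nonneg_left h1 (inv_pos.2 (hd0 i l)).le
          refine h2.trans (le_of_eq ?_)
          rw [← hr2, mul_pow]
          have := (hd0 i l).ne'
          change (d i l)⁻¹ * (C₁ * (d i l * d i l) * wnorm (fun _ => 1) (D i)) = _
          field_simp
  refine (Finset.sum_le_sum hkey).trans ?_
  rw [← Finset.mul_sum, Finset.sum_comm, mul_assoc S]
  refine mul_le_mul_of_nonneg_left ?_ hS.le
  calc _ = ∑ i ∈ Finset.range (L + 2), C₁ * ((∑ l ∈ Finset.range L, d i l) *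
        wnorm (fun _ => 1) (D i)) := by
        refine Finset.sum_congr rfl fun i _ => ?_
        rw [Finset.sum_mul, Finset.mul_sum]
        exact Finset.sum_congr rfl fun l _ => by ring
    _ ≤ ∑ i ∈ Finset.range (L + 2), C₁ * (S * wnorm (fun _ => 1) (D i)) := by
        gcongr with i hi
        · exact hN0 _
        · exact sum_pow_dist_le hr0 hr1 i L
    _ = C₁ * (S * ∑ i ∈ Finset.range (L + 2), wnorm (fun _ => 1) (D i)) := by
        rw [Finset.mul_sum, Finset.mul_sum]
    _ ≤ C₁ * (S * (200000 * wnorm (fun _ => 1) f)) := by gcongr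
    _ = _ := by ring

/-- The list of averaging operators attached to a frame. -/
noncomputable def list : List Avg :=
  (List.range (P.n L + 1)).map (fun i => cellAvg (P.F i)) ++
    ((List.range L).map (fun j : ℕ => h.piece (z + j)) ++
      (List.range L).map fun j : ℕ => (h.piece (z + j)).symm)

lemma mem_list {A : Avg} : A ∈ P.list ↔ A ∈ P.family := by
  simp only [list, family, List.mem_append, List.mem_map, List.mem_range, Set.mem_ofPred_eq]
  constructor
  · rintro (⟨i, hi, rfl⟩ | ⟨j, hj, rfl⟩ | ⟨j, hj, rfl⟩)
    · exact Or.inl ⟨i, by omega, rfl⟩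
    · exact Or.inr ⟨j, hj, Or.inl rfl⟩
    · exact Or.inr ⟨j, hj, Or.inr rfl⟩
  · rintro (⟨i, hi, rfl⟩ | ⟨j, hj, rfl | rfl⟩)
    · exact Or.inl ⟨i, by omega, rfl⟩
    · exact Or.inr (Or.inl ⟨j, hj, rfl⟩)
    · exact Or.inr (Or.inr ⟨j, hj, rfl⟩)

lemma wnorm_maxList_le : ∃ M : ℝ → ℝ, (∀ C₀, 1 ≤ M C₀) ∧
    ∀ (γ : ℝ → ℝ) (C₀ : ℝ) (h : Curve γ C₀) (z : ℤ) (L : ℕ) (P : Frame h z L) (u : TestFn),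
      (∀ x, 0 ≤ u x) →
      wnorm (fun _ => 1) (maxList P.list u) ≤ M C₀ * wnorm (fun _ => 1) u := by
  obtain ⟨M, hM0, hM⟩ := sum_wnorm_error_le
  refine ⟨fun C₀ => 9 + 4 * M C₀, fun C₀ => by linarith [hM0 C₀], fun γ C₀ h z L P u hu => ?_⟩
  set G := runMax P.F (P.n L) u (P.n L) with hG
  have hE : ∀ i ≤ P.n L, ∀ x, (cellAvg (P.F i)).op u x ≤ G x := fun i hi x => by
    have := le_runMax (F := P.F) (m := P.n L) (u := u) (show P.n L - i ≤ P.n L by omega) x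
    rwa [show P.n L - (P.n L - i) = i by omega] at this
  set e₁ := fun l : ℕ => (h.adapted (z + l)).error u with he₁
  set e₂ := fun l : ℕ => (h.adapted (z + l)).neg.error u with he₂
  have h1 := hM γ C₀ h z L P _ _ (fun l => h.adapted (z + l)) u
  have h2 := hM γ C₀ h z L P _ _ (fun l => (h.adapted (z + l)).neg) u
  have h3 := wnorm_runMax_le (F := P.F) (m := P.n L) (u := u) P.step (P.n L)
  have hG0 : ∀ x, 0 ≤ G x := fun x => (Avg.op_nonneg _ hu x).trans (hE 0 (Nat.zero_le _) x)
  have hpiece : ∀ {j : ℤ} {R : ℝ} {ν : Measure Plane} (hν : Adapted γ (oscConst C₀) j ν R) (l : ℕ),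
      l < L → j = z + l → ∀ x, (convAvg hν.sub).op u x ≤ G x + |hν.error u x| := by
    rintro j R ν hν l hl rfl x
    have e : (convAvg hν.sub).op u x = ν.real Set.univ * (cellAvg (rect γ (z + l))).op u x +
        hν.error u x := by
      rw [hν.error_apply, TestFn.sub_apply, TestFn.smul_apply, Avg.lin_apply, Avg.lin_apply]
      ring
    have h4 := hE (P.n l) (P.mono hl.le) x
    rw [P.eq_rect] at h4
    have h5 : ν.real Set.univ * (cellAvg (rect γ (z + l))).op u x ≤
        (cellAvg (rect γ (z + l))).op u x :=
      mul_le_of_le_one_left (Avg.op_nonneg _ hu x) hν.sub.real_le_one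
    rw [e]
    linarith [le_abs_self (hν.error u x)]
  set Q : Plane → ℝ := fun x => ∑ l ∈ Finset.range L, e₁ l x ^ 2 * 1 +
    ∑ l ∈ Finset.range L, e₂ l x ^ 2 * 1 with hQ
  have hQ0 : ∀ x, 0 ≤ Q x := fun x => add_nonneg
    (Finset.sum_nonneg fun l _ => by positivity) (Finset.sum_nonneg fun l _ => by positivity)
  have hQ1 : ∀ l < L, ∀ x, e₁ l x ^ 2 ≤ Q x := fun l hl x => by
    have a := Finset.single_le_sum (f := fun l => e₁ l x ^ 2 * 1) (fun i _ => by positivity)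
      (Finset.mem_range.2 hl)
    have b : 0 ≤ ∑ l ∈ Finset.range L, e₂ l x ^ 2 * 1 :=
      Finset.sum_nonneg fun l _ => by positivity
    simp only [mul_one, hQ] at a b ⊢
    linarith
  have hQ2 : ∀ l < L, ∀ x, e₂ l x ^ 2 ≤ Q x := fun l hl x => by
    have a := Finset.single_le_sum (f := fun l => e₂ l x ^ 2 * 1) (fun i _ => by positivity)
      (Finset.mem_range.2 hl)
    have b : 0 ≤ ∑ l ∈ Finset.range L, e₁ l x ^ 2 * 1 :=
      Finset.sum_nonneg fun l _ => by positivity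
    simp only [mul_one, hQ] at a b ⊢
    linarith
  have hpt : ∀ x, maxList P.list u x ^ 2 ≤ u x ^ 2 * 1 + (2 * (G x ^ 2 * 1) + 2 * Q x) := by
    intro x
    have hs : ∀ {t e : ℝ}, t ≤ G x + |e| → e ^ 2 ≤ Q x →
        t ≤ √(u x ^ 2 * 1 + (2 * (G x ^ 2 * 1) + 2 * Q x)) := fun {t e} ht he => by
      refine Real.le_sqrt_of_sq_le ?_ |> ht.trans
      nlinarith [sq_nonneg (u x), sq_abs e, sq_nonneg (G x - |e|)]
    have h4 : maxList P.list u x ≤ √(u x ^ 2 * 1 + (2 * (G x ^ 2 * 1) + 2 * Q x)) := by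
      refine maxList_le (Real.le_sqrt_of_sq_le ?_) fun A hA => ?_
      · nlinarith [sq_nonneg (G x), hQ0 x]
      · rcases P.mem_list.1 hA with ⟨i, hi, rfl⟩ | ⟨j, hj, rfl | rfl⟩
        · exact hs (e := 0) (by simpa using hE i hi x) (by simpa using hQ0 x)
        · exact hs (hpiece (h.adapted (z + j)) j hj rfl x) (hQ1 j hj x)
        · have h6 : (h.piece (z + j)).symm.op u = (convAvg (h.adapted (z + j)).neg.sub).op u :=
            congrArg Subtype.val (LinearMap.congr_fun (convAvg_symm_lin (h.adapted (z + j)).sub) u)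
          rw [h6]
          exact hs (hpiece (h.adapted (z + j)).neg j hj rfl x) (hQ2 j hj x)
    have h7 : 0 ≤ maxList P.list u x := (hu x).trans le_maxList
    exact (Real.le_sqrt h7 (by have := hQ0 x; positivity)).1 h4
  have i1 : ∀ f : TestFn, Integrable fun x => f x ^ 2 * (1 : ℝ) := fun f =>
    f.integrable_sq_mul (LocBdd.const 1)
  have iQ1 := integrable_finsetSum (μ := (volume : Measure Plane)) (Finset.range L)
    fun l _ => i1 (e₁ l)
  have iQ2 := integrable_finsetSum (μ := (volume : Measure Plane)) (Finset.range L)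
    fun l _ => i1 (e₂ l)
  have iQ : Integrable Q := iQ1.add iQ2
  have iGQ : Integrable fun x => 2 * (G x ^ 2 * 1) + 2 * Q x :=
    ((i1 G).const_mul 2).add (iQ.const_mul 2)
  have eQ : ∫ x, Q x = ∑ l ∈ Finset.range L, wnorm (fun _ => 1) (e₁ l) +
      ∑ l ∈ Finset.range L, wnorm (fun _ => 1) (e₂ l) := by
    simp only [hQ]
    rw [integral_add iQ1 iQ2, integral_finsetSum _ fun l _ => i1 (e₁ l),
      integral_finsetSum _ fun l _ => i1 (e₂ l)]
    rfl
  calc wnorm (fun _ => 1) (maxList P.list u)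
      ≤ ∫ x, (u x ^ 2 * 1 + (2 * (G x ^ 2 * 1) + 2 * Q x)) :=
        integral_mono (i1 _) ((i1 u).add iGQ)
          fun x => by simpa using hpt x
    _ = wnorm (fun _ => 1) u + (2 * wnorm (fun _ => 1) G +
        2 * (∑ l ∈ Finset.range L, wnorm (fun _ => 1) (e₁ l) +
          ∑ l ∈ Finset.range L, wnorm (fun _ => 1) (e₂ l))) := by
        rw [integral_add (i1 u) iGQ, integral_add ((i1 G).const_mul 2) (iQ.const_mul 2),
          integral_const_mul, integral_const_mul, eQ]
        rfl
    _ ≤ _ := by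
        linarith

end Frame

/-- A slowly varying square integrable weight. -/
noncomputable def bump (ρ : ℝ) (x : Plane) : ℝ := ((ρ + ‖x‖) ^ 2)⁻¹

section bump

variable {ρ : ℝ}

lemma isWeight_bump (hρ : 1 ≤ ρ) : IsWeight (bump ρ) := by
  have h1 : LocBdd fun x : Plane => (ρ + ‖x‖) ^ 2 := by
    refine ⟨by fun_prop, fun R => ⟨(ρ + R) ^ 2, fun x hx => ?_⟩⟩
    have := norm_nonneg x
    rw [abs_of_nonneg (by positivity)]
    gcongr
  have h2 : ∀ x : Plane, 1 ≤ (ρ + ‖x‖) ^ 2 := fun x => by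
    have := norm_nonneg x
    nlinarith
  refine ⟨fun x => inv_pos.2 (by linarith [h2 x]), ?_, ?_⟩
  · refine LocBdd.of_bdd (C := 1) h1.meas.inv fun x => ?_
    rw [abs_of_nonneg (inv_nonneg.2 (by linarith [h2 x]))]
    exact inv_le_one_of_one_le₀ (h2 x)
  · simpa [bump] using h1

lemma op_bump_le (hρ : 1 ≤ ρ) {A : Avg} (hA : A.rad ≤ ρ) (x : Plane) :
    A.op (bump ρ) x ≤ 4 * bump ρ x := by
  have h0 : 0 ≤ 4 * bump ρ x := mul_nonneg (by norm_num) ((isWeight_bump hρ).pos x).le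
  have h1 : ∀ᵐ y ∂A.ker x, bump ρ y ≤ 4 * bump ρ x := by
    filter_upwards [A.ker_rad x] with y hy
    have h2 : ‖x‖ ≤ ‖y‖ + ρ := by
      have := norm_sub_norm_le x y
      rw [norm_sub_rev] at this
      linarith
    have h3 := norm_nonneg x
    have h4 := norm_nonneg y
    rw [bump, bump, ← div_eq_mul_inv, ← one_div, div_le_div_iff₀ (by positivity)
        (by positivity)]
    nlinarith
  refine (integral_mono_ae (A.integrable (isWeight_bump hρ).loc x)
    (integrable_const (4 * bump ρ x)) h1).trans ?_
  exact A.op_const_le h0 x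

lemma integrable_sq_bump (hρ : 1 ≤ ρ) : Integrable fun x => bump ρ x ^ 2 := by
  have h := integrable_one_add_norm (E := Plane) (μ := volume) (r := 4) (by
    simp; norm_num)
  refine h.mono' ((isWeight_bump hρ).loc.meas.pow_const 2).aestronglyMeasurable
    (Eventually.of_forall fun x => ?_)
  have h0 := norm_nonneg x
  rw [Real.norm_of_nonneg (sq_nonneg _), Real.rpow_neg (by positivity), bump, inv_pow, ← pow_mul]
  rw [show (4 : ℝ) = ((4 : ℕ) : ℝ) by norm_num, Real.rpow_natCast]
  gcongr

end bump

section Majorant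

variable {l : List Avg} {B : ℝ} {u : TestFn}

lemma iterate_maxList_nonneg (hu : ∀ x, 0 ≤ u x) (m : ℕ) (x : Plane) :
    0 ≤ (maxList l)^[m] u x := by
  induction m generalizing x with
  | zero => exact hu x
  | succ m ih =>
    rw [Function.iterate_succ_apply']
    exact (ih x).trans le_maxList

lemma iterate_maxList_le {S : ℝ} (hS : 0 ≤ S) (hu : ∀ x, u x ≤ S) (m : ℕ) (x : Plane) :
    (maxList l)^[m] u x ≤ S := by
  induction m generalizing x with
  | zero => exact hu x
  | succ m ih =>
    rw [Function.iterate_succ_apply']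
    exact maxList_le (ih x) fun A _ => A.op_le_of_le (TestFn.locBdd _) hS ih x

lemma wnorm_iterate_maxList_le (hl : ∀ u : TestFn, (∀ x, 0 ≤ u x) →
      wnorm (fun _ => 1) (maxList l u) ≤ B ^ 2 * wnorm (fun _ => 1) u)
    (hu : ∀ x, 0 ≤ u x) (m : ℕ) :
    wnorm (fun _ => 1) ((maxList l)^[m] u) ≤ (B ^ m) ^ 2 * wnorm (fun _ => 1) u := by
  induction m with
  | zero => simp
  | succ m ih =>
    rw [Function.iterate_succ_apply']
    refine (hl _ (iterate_maxList_nonneg hu m)).trans ?_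
    calc _ ≤ B ^ 2 * ((B ^ m) ^ 2 * wnorm (fun _ => 1) u) := by gcongr
      _ = _ := by ring

/-- The Rubio de Francia algorithm. -/
lemma exists_series_majorant (hB : 1 ≤ B) (hl : ∀ u : TestFn, (∀ x, 0 ≤ u x) →
      wnorm (fun _ => 1) (maxList l u) ≤ B ^ 2 * wnorm (fun _ => 1) u)
    (hu : ∀ x, 0 ≤ u x) :
    ∃ U : Plane → ℝ, LocBdd U ∧ (∀ x, u x ≤ U x) ∧ (∀ A ∈ l, ∀ x, A.op U x ≤ 2 * B * U x) ∧
      Integrable (fun x => U x ^ 2) ∧ ∫ x, U x ^ 2 ≤ 4 * wnorm (fun _ => 1) u := by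
  obtain ⟨S, hS0, hS⟩ := exists_norm_le u
  have hB0 : 0 < B := by linarith
  set T : ℕ → TestFn := fun m => (maxList l)^[m] u with hT
  set c : ℕ → ℝ := fun m => ((2 * B) ^ m)⁻¹ with hc
  have hT0 : ∀ m x, 0 ≤ T m x := fun m x => iterate_maxList_nonneg hu m x
  have hTS : ∀ m x, T m x ≤ S := fun m x =>
    iterate_maxList_le hS0 (fun x => (le_abs_self _).trans (hS x)) m x
  have hc0 : ∀ m, 0 < c m := fun m => by positivity
  have hc1 : ∀ m, c m ≤ (1 / 2) ^ m := fun m => by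
    simp only [hc, one_div, ← inv_pow]
    gcongr
    linarith
  have hcS : ∀ m x, c m * T m x ≤ (1 / 2) ^ m * S := fun m x =>
    mul_le_mul (hc1 m) (hTS m x) (hT0 m x) (by positivity)
  have hgeo : Summable fun m : ℕ => (1 / 2 : ℝ) ^ m * S := summable_geometric_two.mul_right S
  have hsum : ∀ x, Summable fun m => c m * T m x := fun x =>
    hgeo.of_nonneg_of_le (fun m => mul_nonneg (hc0 m).le (hT0 m x)) fun m => hcS m x
  set U : Plane → ℝ := fun x => ∑' m, c m * T m x with hU
  set P : ℕ → TestFn := fun n => ∑ m ∈ Finset.range n, c m • T m with hP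
  have hPU : ∀ x, Tendsto (fun n => P n x) atTop (𝓝 (U x)) := fun x => by
    have := (hsum x).hasSum.tendsto_sum_nat
    simpa only [hP, TestFn.sum_apply, TestFn.smul_apply] using this
  have hUm : Measurable U := measurable_of_tendsto_metrizable (fun n => (P n).measurable)
    (tendsto_pi_nhds.2 hPU)
  have hU0 : ∀ x, 0 ≤ U x := fun x => tsum_nonneg fun m => mul_nonneg (hc0 m).le (hT0 m x)
  have hUl : LocBdd U := LocBdd.of_bdd (C := ∑' m : ℕ, (1 / 2 : ℝ) ^ m * S) hUm fun x => by
    rw [abs_of_nonneg (hU0 x)]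
    exact (hsum x).tsum_le_tsum (fun m => hcS m x) hgeo
  have hPn : ∀ n, wnorm (fun _ => 1) (P n) ≤ 4 * wnorm (fun _ => 1) u := by
    intro n
    have hs : ∑ m ∈ Finset.range n, (1 / 2 : ℝ) ^ m ≤ 2 :=
      (summable_geometric_two.sum_le_tsum _ (fun m _ => by positivity)).trans
        tsum_geometric_two.le
    have hpt : ∀ x, P n x ^ 2 * 1 ≤
        2 * ∑ m ∈ Finset.range n, (1 / 2) ^ m * ((B ^ m)⁻¹ ^ 2 * (T m x ^ 2 * 1)) := by
      intro x
      have h1 := Finset.sum_sq_le_sum_mul_sum_of_sq_le_mul (Finset.range n)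
        (r := fun m => c m * T m x) (f := fun m => (1 / 2 : ℝ) ^ m)
        (g := fun m => (1 / 2) ^ m * ((B ^ m)⁻¹ ^ 2 * (T m x ^ 2 * 1)))
        (fun m _ => by positivity) (fun m _ => by positivity) (fun m _ => by
          refine le_of_eq ?_
          simp only [hc, mul_pow, mul_inv, one_div, inv_pow]
          ring)
      simp only [hP, TestFn.sum_apply, TestFn.smul_apply, mul_one] at h1 ⊢
      refine h1.trans (mul_le_mul_of_nonneg_right hs (Finset.sum_nonneg fun m _ => ?_))
      positivity
    have hi_int : ∀ m ∈ Finset.range n, Integrable fun x =>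
        (1 / 2 : ℝ) ^ m * ((B ^ m)⁻¹ ^ 2 * (T m x ^ 2 * 1)) := fun m _ =>
      (((T m).integrable_sq_mul (LocBdd.const 1)).const_mul _).const_mul _
    calc wnorm (fun _ => 1) (P n)
        ≤ ∫ x, 2 * ∑ m ∈ Finset.range n, (1 / 2) ^ m * ((B ^ m)⁻¹ ^ 2 * (T m x ^ 2 * 1)) :=
          integral_mono ((P n).integrable_sq_mul (LocBdd.const 1))
            ((integrable_finsetSum _ hi_int).const_mul 2) hpt
      _ = 2 * ∑ m ∈ Finset.range n, (1 / 2) ^ m *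
            ((B ^ m)⁻¹ ^ 2 * wnorm (fun _ => 1) (T m)) := by
          rw [integral_const_mul, integral_finsetSum _ hi_int]
          simp only [integral_const_mul]
          rfl
      _ ≤ 2 * ∑ m ∈ Finset.range n, (1 / 2) ^ m * wnorm (fun _ => 1) u := by
          gcongr with m
          have h1 := wnorm_iterate_maxList_le hl hu m
          have h2 := mul_le_mul_of_nonneg_left h1 (sq_nonneg (B ^ m)⁻¹)
          refine h2.trans (le_of_eq ?_)
          field_simp
      _ ≤ 2 * (2 * wnorm (fun _ => 1) u) := by
          rw [← Finset.sum_mul]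
          have := wnorm_nonneg (w := fun _ => 1) (fun _ => zero_le_one) u
          gcongr
      _ = _ := by ring
  have hw0 := wnorm_nonneg (w := fun _ => 1) (fun _ => zero_le_one) u
  have hlint : ∫⁻ x, ENNReal.ofReal (U x ^ 2) ≤ ENNReal.ofReal (4 * wnorm (fun _ => 1) u) := by
    have h1 : ∀ x, ENNReal.ofReal (U x ^ 2) =
        liminf (fun n => ENNReal.ofReal (P n x ^ 2 * 1)) atTop := fun x => by
      have := (ENNReal.continuous_ofReal.tendsto _).comp ((hPU x).pow 2)
      simp only [mul_one]
      exact this.liminf_eq.symm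
    simp only [h1]
    refine (lintegral_liminf_le fun n => ?_).trans ?_
    · exact ((P n).measurable.pow_const 2 |>.mul_const 1).ennreal_ofReal
    · refine liminf_le_of_frequently_le' (Frequently.of_forall fun n => ?_)
      rw [← ofReal_wnorm (LocBdd.const 1) (fun _ => zero_le_one)]
      exact ENNReal.ofReal_le_ofReal (hPn n)
  have hUi : Integrable fun x => U x ^ 2 := by
    refine ⟨(hUm.pow_const 2).aestronglyMeasurable, ?_⟩
    rw [hasFiniteIntegral_iff_ofReal (Eventually.of_forall fun x => sq_nonneg _)]
    exact hlint.trans_lt ENNReal.ofReal_lt_top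
  refine ⟨U, hUl, fun x => ?_, fun A hA x => ?_, hUi, ?_⟩
  · have := (hsum x).le_tsum 0 fun m _ => mul_nonneg (hc0 m).le (hT0 m x)
    simpa [hc, hT] using this
  · have h1 : HasSum (fun m => ∫ y, c m * T m y ∂A.ker x) (∫ y, ∑' m, c m * T m y ∂A.ker x) := by
      refine hasSum_integral_of_summable_integral_norm
        (fun m => (A.integrable (T m).locBdd x).const_mul _) ?_
      refine hgeo.of_nonneg_of_le (fun m => integral_nonneg fun y => norm_nonneg _) fun m => ?_
      refine (integral_mono (A.integrable (T m).locBdd x |>.const_mul _ |>.norm)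
        (integrable_const ((1 / 2 : ℝ) ^ m * S)) fun y => ?_).trans
          (A.op_const_le (by positivity) x)
      simp only [Real.norm_of_nonneg (mul_nonneg (hc0 m).le (hT0 m y))]
      exact hcS m y
    have h2 : ∀ m, ∫ y, c m * T m y ∂A.ker x ≤ 2 * B * (c (m + 1) * T (m + 1) x) := fun m => by
      have h3 : A.op (T m) x ≤ T (m + 1) x := by
        simp only [hT, Function.iterate_succ_apply']
        exact op_le_maxList hA
      rw [integral_const_mul, ← mul_assoc]
      have h4 : 2 * B * c (m + 1) = c m := by
        simp only [hc, pow_succ]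
        field_simp
      rw [h4]
      exact mul_le_mul_of_nonneg_left h3 (hc0 m).le
    have h5 := (summable_nat_add_iff 1).2 (hsum x)
    have h6 : ∑' m, c (m + 1) * T (m + 1) x ≤ U x := by
      have := (hsum x).tsum_eq_zero_add
      have h7 := mul_nonneg (hc0 0).le (hT0 0 x)
      simp only [hU]
      linarith
    calc A.op U x = ∑' m, ∫ y, c m * T m y ∂A.ker x := h1.tsum_eq.symm
      _ ≤ ∑' m, 2 * B * (c (m + 1) * T (m + 1) x) :=
          h1.summable.tsum_le_tsum h2 (h5.mul_left _)
      _ = 2 * B * ∑' m, c (m + 1) * T (m + 1) x := tsum_mul_left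
      _ ≤ 2 * B * U x := by gcongr
  · have := ofReal_integral_eq_lintegral_ofReal hUi (Eventually.of_forall fun x => sq_nonneg _)
    rw [← this] at hlint
    exact (ENNReal.ofReal_le_ofReal_iff (by positivity)).1 hlint

lemma exists_isA1_majorant (hB : 1 ≤ B) (hl : ∀ u : TestFn, (∀ x, 0 ≤ u x) →
      wnorm (fun _ => 1) (maxList l u) ≤ B ^ 2 * wnorm (fun _ => 1) u)
    (hu : ∀ x, 0 ≤ u x) {η : ℝ} (hη : 0 < η) :
    ∃ U : Plane → ℝ, IsA1 {A | A ∈ l} (4 * B) U ∧ (∀ x, u x ≤ U x) ∧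
      Integrable (fun x => U x ^ 2) ∧ ∫ x, U x ^ 2 ≤ 8 * wnorm (fun _ => 1) u + η := by
  obtain ⟨S, hS, huS, hSA, hSi, hSn⟩ := exists_series_majorant hB hl hu
  obtain ⟨ρ, hρ, hlρ⟩ : ∃ ρ : ℝ, 1 ≤ ρ ∧ ∀ A ∈ l, A.rad ≤ ρ := by
    clear hl hSA
    induction l with
    | nil => exact ⟨1, le_rfl, by simp⟩
    | cons A l ih =>
      obtain ⟨ρ, hρ, h⟩ := ih
      refine ⟨max A.rad ρ, hρ.trans (le_max_right _ _), fun A' hA' => ?_⟩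
      rcases List.mem_cons.1 hA' with rfl | h'
      · exact le_max_left _ _
      · exact (h _ h').trans (le_max_right _ _)
  have hφ := isWeight_bump hρ
  set K := ∫ x, bump ρ x ^ 2 with hK
  have hK0 : 0 ≤ K := integral_nonneg fun x => sq_nonneg _
  set ε := √(η / (2 * (K + 1))) with hε
  have hε0 : 0 < ε := Real.sqrt_pos.2 (by positivity)
  have hεK : 2 * ε ^ 2 * K ≤ η := by
    rw [hε, Real.sq_sqrt (by positivity)]
    rw [show 2 * (η / (2 * (K + 1))) * K = η * (K / (K + 1)) by field_simp]
    exact mul_le_of_le_one_right hη.le ((div_le_one (by positivity)).2 (by linarith))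
  have hS0 : ∀ x, 0 ≤ S x := fun x => (hu x).trans (huS x)
  have hφ0 : ∀ x, 0 < ε * bump ρ x := fun x => mul_pos hε0 (hφ.pos x)
  have hUl : LocBdd fun x => S x + ε * bump ρ x := hS.add (hφ.loc.const_mul ε)
  have hdom : Integrable fun x => 2 * S x ^ 2 + 2 * ε ^ 2 * bump ρ x ^ 2 :=
    (hSi.const_mul 2).add ((integrable_sq_bump hρ).const_mul _)
  have hle : ∀ x, (S x + ε * bump ρ x) ^ 2 ≤ 2 * S x ^ 2 + 2 * ε ^ 2 * bump ρ x ^ 2 := fun x => by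
    nlinarith [sq_nonneg (S x - ε * bump ρ x)]
  have hUi : Integrable fun x => (S x + ε * bump ρ x) ^ 2 := by
    refine hdom.mono' (hUl.meas.pow_const 2).aestronglyMeasurable (Eventually.of_forall fun x => ?_)
    rw [Real.norm_of_nonneg (sq_nonneg _)]
    exact hle x
  refine ⟨fun x => S x + ε * bump ρ x, ⟨⟨fun x => ?_, hUl, ?_⟩, fun A hA x => ?_⟩, fun x => ?_,
    hUi, ?_⟩
  · linarith [hS0 x, hφ0 x]
  · refine (hφ.loc_inv.const_mul ε⁻¹).mono hUl.meas.inv fun x => ?_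
    rw [abs_of_pos (inv_pos.2 (by linarith [hS0 x, hφ0 x])), ← mul_inv]
    exact inv_anti₀ (hφ0 x) (by linarith [hS0 x])
  · rw [A.op_add hS (hφ.loc.const_mul ε), A.op_const_mul]
    have h1 := hSA A hA x
    have h2 := op_bump_le hρ (hlρ A hA) x
    have h3 := hφ0 x
    have h4 := hS0 x
    nlinarith [mul_le_mul_of_nonneg_left h2 hε0.le, mul_le_mul_of_nonneg_right hB h3.le,
      mul_nonneg (by linarith : (0:ℝ) ≤ B) h4]
  · linarith [huS x, hφ0 x]
  · refine (integral_mono hUi hdom hle).trans ?_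
    rw [integral_add (hSi.const_mul 2) ((integrable_sq_bump hρ).const_mul _), integral_const_mul,
      integral_const_mul]
    linarith

end Majorant

/-- Majorants relative to the averaging operators attached to a frame. -/
lemma Frame.exists_majorant : ∃ K : ℝ → ℝ, (∀ C₀, 1 ≤ K C₀) ∧
    ∀ (γ : ℝ → ℝ) (C₀ : ℝ) (h : Curve γ C₀) (z : ℤ) (L : ℕ) (P : Frame h z L) (u : TestFn),
      (∀ x, 0 ≤ u x) → ∀ η > 0, ∃ U : Plane → ℝ, IsA1 P.family (K C₀) U ∧ (∀ x, u x ≤ U x) ∧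
        Integrable (fun x => U x ^ 2) ∧ ∫ x, U x ^ 2 ≤ 8 * wnorm (fun _ => 1) u + η := by
  obtain ⟨M, hM1, hM⟩ := Frame.wnorm_maxList_le
  have hs : ∀ C₀, 1 ≤ √(M C₀) := fun C₀ => Real.one_le_sqrt.2 (hM1 C₀)
  refine ⟨fun C₀ => 4 * √(M C₀), fun C₀ => by linarith [hs C₀],
    fun γ C₀ h z L P u hu η hη => ?_⟩
  have h1 := exists_isA1_majorant (l := P.list) (hs C₀) (fun u hu => by
    rw [Real.sq_sqrt (by linarith [hM1 C₀])]
    exact hM γ C₀ h z L P u hu) hu hη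
  have h2 : {A | A ∈ P.list} = P.family := Set.ext fun A => P.mem_list
  rwa [h2] at h1

/-- Square integrable majorants in the class `A₁` exist for all nonnegative test functions. -/
def HasMajorants (𝒜 : Set Avg) (K : ℝ) : Prop :=
  ∀ u : TestFn, (∀ x, 0 ≤ u x) → ∀ η > 0, ∃ U : Plane → ℝ, IsA1 𝒜 K U ∧ (∀ x, u x ≤ U x) ∧
    Integrable (fun x => U x ^ 2) ∧ ∫ x, U x ^ 2 ≤ 8 * wnorm (fun _ => 1) u + η

lemma TestFn.rpow_mem (A : TestFn) (hA : ∀ x, 0 ≤ A x) {r : ℝ} (hr : 0 < r) :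
    (fun x => A x ^ r) ∈ testFunctions := by
  obtain ⟨hm, R, hR⟩ := A.2
  have hR0 : 0 ≤ R := (abs_nonneg _).trans (hR 0).1
  refine ⟨hm.pow_const r, max R (R ^ r), fun x => ⟨?_, fun hx => ?_⟩⟩
  · rw [abs_of_nonneg (Real.rpow_nonneg (hA x) r)]
    exact (Real.rpow_le_rpow (hA x) ((le_abs_self _).trans (hR x).1) hr.le).trans (le_max_right _ _)
  · have : (A : Plane → ℝ) x = 0 := (hR x).2 ((le_max_left _ _).trans_lt hx)
    simp only [this, Real.zero_rpow hr.ne']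

lemma rpow_mul_rpow_le_add {a b θ δ : ℝ} (ha : 0 ≤ a) (hb : 0 ≤ b) (hθ : 0 < θ) (hθ1 : θ ≤ 1)
    (hδ : 0 < δ) : a ^ θ * b ^ (1 - θ) ≤ δ⁻¹ ^ ((1 - θ) / θ) * a + δ * b := by
  set Λ := δ⁻¹ ^ ((1 - θ) / θ) with hΛ
  have hΛ0 : 0 < Λ := Real.rpow_pos_of_pos (inv_pos.2 hδ) _
  have h1 := Real.geom_mean_le_arith_mean2_weighted hθ.le (sub_nonneg.2 hθ1)
    (mul_nonneg hΛ0.le ha) (mul_nonneg hδ.le hb) (by ring)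
  have h2 : Λ ^ θ * δ ^ (1 - θ) = 1 := by
    rw [hΛ, ← Real.rpow_mul (inv_nonneg.2 hδ.le), div_mul_cancel₀ _ hθ.ne',
      Real.inv_rpow hδ.le]
    exact inv_mul_cancel₀ (Real.rpow_pos_of_pos hδ _).ne'
  have h3 : (Λ * a) ^ θ * (δ * b) ^ (1 - θ) = a ^ θ * b ^ (1 - θ) := by
    rw [Real.mul_rpow hΛ0.le ha, Real.mul_rpow hδ.le hb]
    linear_combination (a ^ θ * b ^ (1 - θ)) * h2
  rw [h3] at h1
  have h4 : θ * (Λ * a) ≤ Λ * a := mul_le_of_le_one_left (by positivity) hθ1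
  have h5 : (1 - θ) * (δ * b) ≤ δ * b := mul_le_of_le_one_left (by positivity) (by linarith)
  linarith

/-- The constant in the extrapolation lemma. -/
noncomputable def extraConst (s r N : ℝ) : ℝ := 2 * N * (16 * N) ^ ((r - s) / s) + N + 8

lemma extraConst_ge (s r : ℝ) {N : ℝ} (hN : 1 ≤ N) : 1 ≤ extraConst s r N := by
  have : 0 ≤ 2 * N * (16 * N) ^ ((r - s) / s) := by positivity
  rw [extraConst]
  linarith

/-- Extrapolation from the exponent `s` to the exponent `r`. -/
lemma extrapolate {𝒜 : Set Avg} {K : ℝ} (hmaj : HasMajorants 𝒜 K) {s r N : ℝ} (hs : 0 < s)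
    (hr : 0 < r) (hN : 1 ≤ N) {A B : TestFn} (hA : ∀ x, 0 ≤ A x) (hB : ∀ x, 0 ≤ B x)
    {w : Plane → ℝ} (hw : IsWeight w)
    (H : ∀ R, IsA1 𝒜 K R → ∫ x, B x ^ s * (R x ^ (2 * (r - s) / r) * w x ^ (s / r)) ≤
      N * ∫ x, A x ^ s * (R x ^ (2 * (r - s) / r) * w x ^ (s / r))) :
    ∫ x, B x ^ r * w x ≤ extraConst s r N * ∫ x, A x ^ r * w x := by
  have hN0 : 0 < N := by linarith
  have hi_int : ∀ (D : TestFn), (∀ x, 0 ≤ D x) → ∀ {a : ℝ}, 0 < a → ∀ {v : Plane → ℝ}, IsWeight v →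
      Integrable fun x => D x ^ a * v x := fun D hD a ha v hv =>
    TestFn.integrable_of_mem (TestFn.mul_mem (D.rpow_mem hD ha) hv.loc)
  have hsq : ∀ (D : TestFn), (∀ x, 0 ≤ D x) → ∃ u : TestFn, (∀ x, 0 ≤ u x) ∧
      (∀ x, u x = D x ^ (r / 2) * w x ^ (1 / 2 : ℝ)) ∧
      wnorm (fun _ => 1) u = ∫ x, D x ^ r * w x := fun D hD => by
    refine ⟨⟨_, TestFn.mul_mem (D.rpow_mem hD (half_pos hr)) (hw.rpow (1 / 2)).loc⟩,
      fun x => mul_nonneg (Real.rpow_nonneg (hD x) _) (Real.rpow_nonneg (hw.pos x).le _),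
      fun x => rfl, ?_⟩
    refine integral_congr_ae (Eventually.of_forall fun x => ?_)
    change (D x ^ (r / 2) * w x ^ (1 / 2 : ℝ)) ^ 2 * 1 = _
    rw [mul_one, mul_pow, ← Real.rpow_natCast, ← Real.rpow_natCast, ← Real.rpow_mul (hD x),
      ← Real.rpow_mul (hw.pos x).le]
    norm_num
  set IA := ∫ x, A x ^ r * w x with hIA
  set IB := ∫ x, B x ^ r * w x with hIB
  have hIA0 : 0 ≤ IA := integral_nonneg fun x =>
    mul_nonneg (Real.rpow_nonneg (hA x) _) (hw.pos x).le
  set σ := 2 * (r - s) / r with hσ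
  have hWt : ∀ {R : Plane → ℝ}, IsA1 𝒜 K R → IsWeight fun x => R x ^ σ * w x ^ (s / r) :=
    fun hR => (hR.weight.rpow σ).mul (hw.rpow (s / r))
  have hE0 : 0 ≤ 2 * N * (16 * N) ^ ((r - s) / s) := by positivity
  rcases le_total s r with hsr | hsr
  · obtain ⟨u, hu0, hu, hun⟩ := hsq B hB
    set Λ := (16 * N) ^ ((r - s) / s) with hΛ
    have key : ∀ η > 0, IB ≤ 2 * N * Λ * IA + η := by
      intro η hη
      obtain ⟨R, hR, huR, hRi, hRn⟩ := hmaj u hu0 η hη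
      have hRp := hR.weight.pos
      have h1 : IB ≤ ∫ x, B x ^ s * (R x ^ σ * w x ^ (s / r)) := by
        refine integral_mono (hi_int B hB hr hw) (hi_int B hB hs (hWt hR)) fun x => ?_
        rcases (hB x).eq_or_lt with h0 | h0
        · simp only [← h0, Real.zero_rpow hr.ne', Real.zero_rpow hs.ne', zero_mul, le_refl]
        · have e : B x ^ r * w x = B x ^ s * (u x ^ σ * w x ^ (s / r)) := by
            rw [hu, Real.mul_rpow (by positivity) (Real.rpow_nonneg (hw.pos x).le _),
              ← Real.rpow_mul h0.le, ← Real.rpow_mul (hw.pos x).le, mul_assoc (B x ^ (r / 2 * σ)),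
              ← Real.rpow_add (hw.pos x), ← mul_assoc, ← Real.rpow_add h0]
            rw [show s + r / 2 * σ = r by rw [hσ]; field_simp; ring,
              show 1 / 2 * σ + s / r = 1 by rw [hσ]; field_simp; ring, Real.rpow_one]
          simp only [e]
          have h2 : u x ^ σ ≤ R x ^ σ := Real.rpow_le_rpow (hu0 x) (huR x)
            (div_nonneg (by linarith) hr.le)
          have h3 := Real.rpow_nonneg (hw.pos x).le (s / r)
          gcongr
      have hθ1 : s / r ≤ 1 := (div_le_one hr).2 hsr
      have h2 : ∫ x, A x ^ s * (R x ^ σ * w x ^ (s / r)) ≤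
          ∫ x, (Λ * (A x ^ r * w x) + (16 * N)⁻¹ * R x ^ 2) := by
        refine integral_mono (hi_int A hA hs (hWt hR))
          (((hi_int A hA hr hw).const_mul Λ).add (hRi.const_mul _)) fun x => ?_
        have h3 := rpow_mul_rpow_le_add (a := A x ^ r * w x) (b := R x ^ 2) (δ := (16 * N)⁻¹)
          (mul_nonneg (Real.rpow_nonneg (hA x) _) (hw.pos x).le) (sq_nonneg _)
          (div_pos hs hr) hθ1 (by positivity)
        rw [inv_inv, show (1 - s / r) / (s / r) = (r - s) / s by field_simp] at h3
        refine le_trans (le_of_eq ?_) h3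
        rw [Real.mul_rpow (Real.rpow_nonneg (hA x) _) (hw.pos x).le, ← Real.rpow_mul (hA x),
          mul_div_cancel₀ _ hr.ne', ← Real.rpow_natCast, ← Real.rpow_mul (hRp x).le,
          show ((2 : ℕ) : ℝ) * (1 - s / r) = σ by rw [hσ]; field_simp; push_cast; ring]
        ring
      rw [integral_add ((hi_int A hA hr hw).const_mul Λ) (hRi.const_mul _), integral_const_mul,
        integral_const_mul] at h2
      have h4 := H R hR
      have h5 := mul_le_mul_of_nonneg_left h2 hN0.le
      have h6 := mul_le_mul_of_nonneg_left hRn (show 0 ≤ N * (16 * N)⁻¹ by positivity)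
      have h7 : N * (16 * N)⁻¹ = 1 / 16 := by field_simp
      have h8 : N * (Λ * IA + (16 * N)⁻¹ * ∫ x, R x ^ 2) =
          N * Λ * IA + N * (16 * N)⁻¹ * ∫ x, R x ^ 2 := by ring
      rw [h8] at h5
      rw [h7] at h5 h6
      rw [hun] at h6
      linarith
    have := le_of_forall_pos_le_add key
    rw [extraConst]
    nlinarith
  · obtain ⟨u, hu0, hu, hun⟩ := hsq A hA
    have key : ∀ η > 0, IB ≤ (N + 8) * IA + η := by
      intro η hη
      obtain ⟨R, hR, huR, hRi, hRn⟩ := hmaj u hu0 η hη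
      have hRp := hR.weight.pos
      have h1 : ∫ x, A x ^ s * (R x ^ σ * w x ^ (s / r)) ≤ IA := by
        refine integral_mono (hi_int A hA hs (hWt hR)) (hi_int A hA hr hw) fun x => ?_
        rcases (hA x).eq_or_lt with h0 | h0
        · simp only [← h0, Real.zero_rpow hr.ne', Real.zero_rpow hs.ne', zero_mul, le_refl]
        · have e : A x ^ r * w x = A x ^ s * (u x ^ σ * w x ^ (s / r)) := by
            rw [hu, Real.mul_rpow (by positivity) (Real.rpow_nonneg (hw.pos x).le _),
              ← Real.rpow_mul h0.le, ← Real.rpow_mul (hw.pos x).le, mul_assoc (A x ^ (r / 2 * σ)),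
              ← Real.rpow_add (hw.pos x), ← mul_assoc, ← Real.rpow_add h0]
            rw [show s + r / 2 * σ = r by rw [hσ]; field_simp; ring,
              show 1 / 2 * σ + s / r = 1 by rw [hσ]; field_simp; ring, Real.rpow_one]
          have hux : 0 < u x := by
            rw [hu]
            exact mul_pos (Real.rpow_pos_of_pos h0 _) (Real.rpow_pos_of_pos (hw.pos x) _)
          simp only [e]
          have h2 : R x ^ σ ≤ u x ^ σ := Real.rpow_le_rpow_of_nonpos hux (huR x)
            (div_nonpos_of_nonpos_of_nonneg (by linarith) hr.le)
          have h3 := Real.rpow_nonneg (hw.pos x).le (s / r)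
          gcongr
      have hθ1 : r / s ≤ 1 := (div_le_one hs).2 hsr
      have h2 : IB ≤ ∫ x, (B x ^ s * (R x ^ σ * w x ^ (s / r)) + R x ^ 2) := by
        refine integral_mono (hi_int B hB hr hw) ((hi_int B hB hs (hWt hR)).add hRi) fun x => ?_
        have h3 := rpow_mul_rpow_le_add (a := B x ^ s * (R x ^ σ * w x ^ (s / r)))
          (b := R x ^ 2) (δ := 1)
          (mul_nonneg (Real.rpow_nonneg (hB x) _) ((hWt hR).pos x).le) (sq_nonneg _)
          (div_pos hr hs) hθ1 one_pos
        rw [inv_one, Real.one_rpow, one_mul, one_mul] at h3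
        refine le_trans (le_of_eq ?_) h3
        have hRs := Real.rpow_nonneg (hRp x).le σ
        have hws := Real.rpow_nonneg (hw.pos x).le (s / r)
        rw [Real.mul_rpow (Real.rpow_nonneg (hB x) _) (mul_nonneg hRs hws), Real.mul_rpow hRs hws,
          ← Real.rpow_mul (hB x), ← Real.rpow_mul (hRp x).le, ← Real.rpow_mul (hw.pos x).le,
          mul_div_cancel₀ _ hs.ne', show s / r * (r / s) = 1 by field_simp, Real.rpow_one,
          ← Real.rpow_natCast, ← Real.rpow_mul (hRp x).le]
        have h4 : R x ^ (σ * (r / s)) * R x ^ (((2 : ℕ) : ℝ) * (1 - r / s)) = 1 := by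
          rw [← Real.rpow_add (hRp x),
            show σ * (r / s) + ((2 : ℕ) : ℝ) * (1 - r / s) = 0 by
              rw [hσ]; field_simp; push_cast; ring, Real.rpow_zero]
        linear_combination (-(B x ^ r * w x)) * h4
      rw [integral_add (hi_int B hB hs (hWt hR)) hRi] at h2
      have h4 := H R hR
      have h5 := mul_le_mul_of_nonneg_left h1 hN0.le
      rw [hun] at hRn
      linarith
    have := le_of_forall_pos_le_add key
    rw [extraConst]
    nlinarith

/-- Domination of `B` by `A` in weighted `L²` norms, for all weights built from a class `A₁`. -/
def Dominated (𝒜 : Set Avg) (K N : ℝ) (A B : TestFn) : Prop :=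
  ∀ U V, IsA1 𝒜 K U → IsA1 𝒜 K V → wnorm (ratioWeight U V) B ≤ N * wnorm (ratioWeight U V) A

section Dominated

variable {𝒜 : Set Avg} {K N : ℝ} {A B : TestFn}

lemma Dominated.integral_le (h : Dominated 𝒜 K N A B) (hK : 1 ≤ K) {R W : Plane → ℝ}
    (hR : IsA1 𝒜 K R) (hW : IsA1 𝒜 K W) {s t : ℝ} (h1 : max s 0 + max t 0 ≤ 4 / 5)
    (h2 : max (-s) 0 + max (-t) 0 ≤ 4 / 5) :
    ∫ x, B x ^ 2 * (R x ^ s * W x ^ t) ≤ N * ∫ x, A x ^ 2 * (R x ^ s * W x ^ t) := by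
  have hU := IsA1.rpow_mul hK hR hW (s := 5 / 4 * max s 0) (t := 5 / 4 * max t 0)
    (by positivity) (by positivity) (by linarith)
  have hV := IsA1.rpow_mul hK hR hW (s := 5 / 4 * max (-s) 0) (t := 5 / 4 * max (-t) 0)
    (by positivity) (by positivity) (by linarith)
  have key : ∀ {y : ℝ}, 0 < y → ∀ s : ℝ,
      (y ^ (5 / 4 * max s 0)) ^ (4 / 5 : ℝ) / (y ^ (5 / 4 * max (-s) 0)) ^ (4 / 5 : ℝ) = y ^ s := by
    intro y hy s
    rw [← Real.rpow_mul hy.le, ← Real.rpow_mul hy.le, ← Real.rpow_sub hy]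
    congr 1
    rcases le_total s 0 with hs | hs
    · rw [max_eq_right hs, max_eq_left (by linarith)]; ring
    · rw [max_eq_left hs, max_eq_right (by linarith)]; ring
  have e : (fun x => R x ^ s * W x ^ t) = ratioWeight
      (fun x => R x ^ (5 / 4 * max s 0) * W x ^ (5 / 4 * max t 0))
      (fun x => R x ^ (5 / 4 * max (-s) 0) * W x ^ (5 / 4 * max (-t) 0)) := by
    ext x
    have hr := hR.weight.pos x
    have hw := hW.weight.pos x
    rw [ratioWeight, Real.div_rpow (by positivity) (by positivity),
      Real.mul_rpow (by positivity) (by positivity), Real.mul_rpow (by positivity) (by positivity),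
      mul_div_mul_comm, key hr, key hw]
  have := h _ _ hU hV
  rw [← e] at this
  exact this

lemma Dominated.integral_rpow_le (h : Dominated 𝒜 K N A B) (hmaj : HasMajorants 𝒜 K) (hK : 1 ≤ K)
    (hN : 1 ≤ N) (hA : ∀ x, 0 ≤ A x) (hB : ∀ x, 0 ≤ B x) {q c : ℝ} (hq : 0 < q)
    (h1 : max (2 * (q - 2) / q) 0 + max (c * (2 / q)) 0 ≤ 4 / 5)
    (h2 : max (-(2 * (q - 2) / q)) 0 + max (-(c * (2 / q))) 0 ≤ 4 / 5)
    {W : Plane → ℝ} (hW : IsA1 𝒜 K W) :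
    ∫ x, B x ^ q * W x ^ c ≤ extraConst 2 q N * ∫ x, A x ^ q * W x ^ c := by
  refine extrapolate hmaj two_pos hq hN hA hB (hW.weight.rpow c) fun R hR => ?_
  simp only [Real.rpow_two, ← Real.rpow_mul (hW.weight.pos _).le]
  exact h.integral_le hK hR hW h1 h2

lemma hasSum_integral_rpow_mul {F : ℕ → TestFn} {a : TestFn} (hF : ∀ n x, 0 ≤ F n x)
    (ha : ∀ x, 0 ≤ a x) {q : ℝ} (hq : 0 < q) (h : ∀ x, HasSum (fun n => F n x ^ q) (a x ^ q))
    {v : Plane → ℝ} (hv : IsWeight v) :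
    HasSum (fun n => ∫ x, F n x ^ q * v x) (∫ x, a x ^ q * v x) := by
  have hs : ∀ x, HasSum (fun n => F n x ^ q * v x) (a x ^ q * v x) := fun x => (h x).mul_right _
  refine hasSum_integral_of_dominated_convergence (fun n x => F n x ^ q * v x)
    (fun n => ?_) (fun n => Eventually.of_forall fun x => ?_)
    (Eventually.of_forall fun x => (hs x).summable) ?_ (Eventually.of_forall hs)
  · exact (((F n).measurable.pow_const q).mul hv.loc.meas).aestronglyMeasurable
  · exact (Real.norm_of_nonneg (mul_nonneg (Real.rpow_nonneg (hF n x) _) (hv.pos x).le)).le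
  · simp only [fun x => (hs x).tsum_eq]
    exact TestFn.integrable_of_mem (TestFn.mul_mem (a.rpow_mem ha hq) hv.loc)

/-- The vector-valued extrapolation theorem. -/
lemma integral_rpow_le_of_dominated (hmaj : HasMajorants 𝒜 K) (hK : 1 ≤ K) (hN : 1 ≤ N)
    {F G : ℕ → TestFn} {a b : TestFn} (hF : ∀ n x, 0 ≤ F n x) (hG : ∀ n x, 0 ≤ G n x)
    (ha : ∀ x, 0 ≤ a x) (hb : ∀ x, 0 ≤ b x) {p q : ℝ} (hq1 : 5 / 3 < q) (hq2 : q < 5 / 2)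
    (hp1 : 5 / 3 < p) (hp2 : p < 5 / 2)
    (hFa : ∀ x, HasSum (fun n => F n x ^ q) (a x ^ q))
    (hGb : ∀ x, HasSum (fun n => G n x ^ q) (b x ^ q))
    (h : ∀ n, Dominated 𝒜 K N (F n) (G n)) :
    ∫ x, b x ^ p ≤ extraConst q p (extraConst 2 q N) * ∫ x, a x ^ p := by
  have hq : 0 < q := by linarith
  have hp : 0 < p := by linarith
  have h4q : 8 / 5 ≤ 4 / q ∧ 4 / q ≤ 12 / 5 :=
    ⟨by rw [le_div_iff₀ hq]; linarith, by rw [div_le_iff₀ hq]; linarith⟩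
  have h4p : 8 / 5 ≤ 4 / p ∧ 4 / p ≤ 12 / 5 :=
    ⟨by rw [le_div_iff₀ hp]; linarith, by rw [div_le_iff₀ hp]; linarith⟩
  have e1 : 2 * (q - 2) / q = 2 - 4 / q := by field_simp; ring
  have e2 : 2 * (p - q) / p * (2 / q) = 4 / q - 4 / p := by field_simp; ring
  have := extrapolate hmaj hq hp (extraConst_ge 2 q hN) ha hb IsWeight.one fun R hR => by
    have hle := fun n => (h n).integral_rpow_le hmaj hK hN (hF n) (hG n) (c := 2 * (p - q) / p) hq
      (by
        rw [e1, e2]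
        rcases max_cases (2 - 4 / q) 0 with h3 | h3 <;>
        rcases max_cases (4 / q - 4 / p) 0 with h4 | h4 <;> linarith)
      (by
        rw [e1, e2]
        rcases max_cases (-(2 - 4 / q)) 0 with h3 | h3 <;>
        rcases max_cases (-(4 / q - 4 / p)) 0 with h4 | h4 <;> linarith) hR
    simp only [Real.one_rpow, mul_one]
    exact hasSum_le hle (hasSum_integral_rpow_mul hG hb hq hGb (hR.weight.rpow _))
      ((hasSum_integral_rpow_mul hF ha hq hFa (hR.weight.rpow _)).mul_left _)
  simpa using this

end Dominated

/-- The truncated Hilbert transform along the curve `(t, γ t)`. -/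
noncomputable def trunc {E : Type*} [NormedAddCommGroup E] [NormedSpace ℝ E] (γ : ℝ → ℝ)
    (f : Plane → E) (a b : ℝ) (x : Plane) : E :=
  ∫ t in a..b, t⁻¹ • (f (x - (t, γ t)) - f (x + (t, γ t)))

section trunc

variable {E : Type*} [NormedAddCommGroup E] [NormedSpace ℝ E] {γ : ℝ → ℝ} {f : Plane → E} {a b : ℝ}

lemma pos_of_mem_uIcc (ha : 0 < a) (hb : 0 < b) {t : ℝ} (ht : t ∈ Set.uIcc a b) : 0 < t :=
  (lt_min ha hb).trans_le ht.1

lemma intervalIntegrable_trunc (hγ : Continuous γ) (hf : Continuous f) (ha : 0 < a) (hb : 0 < b)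
    (x : Plane) :
    IntervalIntegrable (fun t => t⁻¹ • (f (x - (t, γ t)) - f (x + (t, γ t)))) volume a b := by
  refine ContinuousOn.intervalIntegrable ?_
  refine (continuousOn_id.inv₀ fun t ht => (pos_of_mem_uIcc ha hb ht).ne').smul ?_
  exact Continuous.continuousOn (by fun_prop)

lemma continuous_trunc (hγ : Continuous γ) (hf : Continuous f) (hfc : HasCompactSupport f)
    (ha : 0 < a) (hb : 0 < b) : Continuous (trunc γ f a b) := by
  obtain ⟨C, hC⟩ := hf.bounded_above_of_compact_support hfc
  refine intervalIntegral.continuous_of_dominated_interval (bound := fun _ => (min a b)⁻¹ * (C + C))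
    (fun x => (intervalIntegrable_trunc hγ hf ha hb x).def'.aestronglyMeasurable)
    (fun x => Eventually.of_forall fun t ht => ?_) intervalIntegrable_const
    (Eventually.of_forall fun t _ => by fun_prop)
  have h0 := pos_of_mem_uIcc ha hb (Set.uIoc_subset_uIcc ht)
  rw [norm_smul, norm_inv, Real.norm_of_nonneg h0.le]
  have h1 : min a b ≤ t := (Set.uIoc_subset_uIcc ht).1
  have h2 := lt_min ha hb
  refine mul_le_mul (inv_anti₀ h2 h1) ((norm_sub_le _ _).trans (add_le_add (hC _) (hC _)))
    (norm_nonneg _) (inv_nonneg.2 h2.le)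

lemma hasCompactSupport_trunc (hγ : Continuous γ) (hfc : HasCompactSupport f) :
    HasCompactSupport (trunc γ f a b) := by
  obtain ⟨R, hR⟩ := hfc.isCompact.isBounded.exists_norm_le
  have hc : Continuous fun t : ℝ => (t, γ t) := by fun_prop
  obtain ⟨S, hS⟩ := (isCompact_uIcc (a := a) (b := b)).exists_bound_of_continuousOn hc.continuousOn
  have hz : ∀ y : Plane, R < ‖y‖ → f y = 0 := fun y hy => by
    by_contra h
    exact hy.not_ge (hR y (subset_tsupport f h))
  refine HasCompactSupport.intro (isCompact_closedBall (0 : Plane) (R + S)) fun x hx => ?_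
  have hx' : R + S < ‖x‖ := by simpa using hx
  rw [trunc, intervalIntegral.integral_congr (g := fun _ => 0), intervalIntegral.integral_zero]
  intro t ht
  have h1 := hS t ht
  have h2 : R < ‖x - (t, γ t)‖ := by
    have := norm_sub_norm_le x (t, γ t)
    linarith
  have h3 : R < ‖x + (t, γ t)‖ := by
    have := norm_sub_norm_le x (-(t, γ t))
    rw [sub_neg_eq_add, norm_neg] at this
    linarith
  simp only [hz _ h2, hz _ h3, sub_self, smul_zero]

lemma map_trunc [CompleteSpace E] {E' : Type*} [NormedAddCommGroup E'] [NormedSpace ℝ E']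
    [CompleteSpace E'] (φ : E →L[ℝ] E') (hγ : Continuous γ) (hf : Continuous f) (ha : 0 < a)
    (hb : 0 < b) (x : Plane) : φ (trunc γ f a b x) = trunc γ (fun y => φ (f y)) a b x := by
  rw [trunc, ← ContinuousLinearMap.intervalIntegral_comp_comm φ
    (intervalIntegrable_trunc hγ hf ha hb x)]
  simp only [map_smul, map_sub, trunc]

lemma mem_testFunctions {g : Plane → ℝ} (hg : Continuous g) (hc : HasCompactSupport g) :
    g ∈ testFunctions := by
  obtain ⟨R, hR⟩ := hc.isCompact.isBounded.exists_norm_le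
  obtain ⟨C, hC⟩ := hg.bounded_above_of_compact_support hc
  refine ⟨hg.measurable, max C R, fun x => ⟨(hC x).trans (le_max_left _ _), fun hx => ?_⟩⟩
  by_contra h
  exact ((le_max_right C R).trans_lt hx).not_ge (hR x (subset_tsupport g h))

end trunc

section Curve

variable {γ : ℝ → ℝ} {C₀ : ℝ}

lemma Curve.trunc_eq_sum (h : Curve γ C₀) (f : TestFn) (hf : Continuous f) (z : ℤ) (L : ℕ)
    (x : Plane) : trunc γ f (2 ^ z) (2 ^ (z + L)) x =
      (∑ j ∈ Finset.range L, ((h.piece (z + j)).lin - (h.piece (z + j)).symm.lin) f) x := by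
  have hp : ∀ k : ℤ, (0 : ℝ) < 2 ^ k := fun k => by positivity
  have h1 := intervalIntegral.sum_integral_adjacent_intervals (n := L)
    (a := fun j : ℕ => (2 : ℝ) ^ (z + j))
    (fun j _ => intervalIntegrable_trunc h.cont hf (hp _) (hp _) x)
  rw [trunc, TestFn.sum_apply]
  simp only [Nat.cast_zero, add_zero] at h1
  rw [← h1]
  refine Finset.sum_congr rfl fun j _ => ?_
  have hm := f.measurable
  have e : (2 : ℝ) ^ (z + (j + 1 : ℕ)) = 2 * 2 ^ (z + j) := by
    rw [Nat.cast_add, Nat.cast_one, ← add_assoc, zpow_add_one₀ two_ne_zero, mul_comm]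
  rw [e, LinearMap.sub_apply, TestFn.sub_apply, Avg.lin_apply, Avg.lin_apply, Curve.piece,
    convAvg_op _ hm, convAvg_symm_op _ hm, h.integral_curveMeasure (hp _) (by fun_prop),
    h.integral_curveMeasure (hp _) (by fun_prop), ← intervalIntegral.integral_sub]
  · simp only [smul_eq_mul, mul_sub]
  · refine ContinuousOn.intervalIntegrable (ContinuousOn.mul (continuousOn_id.inv₀ fun t ht =>
      (pos_of_mem_uIcc (hp _) (by have := hp (z + j); positivity) ht).ne') ?_)
    have := h.cont
    exact Continuous.continuousOn (by fun_prop)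
  · refine ContinuousOn.intervalIntegrable (ContinuousOn.mul (continuousOn_id.inv₀ fun t ht =>
      (pos_of_mem_uIcc (hp _) (by have := hp (z + j); positivity) ht).ne') ?_)
    have := h.cont
    exact Continuous.continuousOn (by fun_prop)

end Curve

/-- The coordinate functionals on a sequence space, as real linear maps. -/
noncomputable def lpCoord (q : ℝ≥0∞) [Fact (1 ≤ q)] (n : ℕ) :
    lp (fun _ : ℕ => ℂ) q →L[ℝ] ℂ :=
  LinearMap.mkContinuous
    { toFun := fun f => f n
      map_add' := fun _ _ => rfl
      map_smul' := fun _ _ => rfl } 1 fun f => by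
    rw [one_mul]
    exact lp.norm_apply_le_norm (zero_lt_one.trans_le Fact.out).ne' f n

/-- The uniform `L^p` estimate for truncated Hilbert transforms of vector-valued functions. -/
lemma integral_norm_trunc_rpow_le : ∃ M : ℝ → ℝ → ℝ → ℝ, ∀ (γ : ℝ → ℝ) (C₀ : ℝ), Curve γ C₀ →
    ∀ (q p : ℝ) (Q : ℝ≥0∞), Q.toReal = q → 5 / 3 < q → q < 5 / 2 → 5 / 3 < p → p < 5 / 2 →
      ∀ [Fact (1 ≤ Q)] (f : Plane → lp (fun _ : ℕ => ℂ) Q), Continuous f → HasCompactSupport f →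
      ∀ (z : ℤ) (L : ℕ), ∫ x, ‖trunc γ f (2 ^ z) (2 ^ (z + L)) x‖ ^ p ≤
        M C₀ q p * ∫ x, ‖f x‖ ^ p := by
  obtain ⟨M, hM0, hM⟩ := Frame.wnorm_sum_skew_le
  obtain ⟨K, hK1, hK⟩ := Frame.exists_majorant
  refine ⟨fun C₀ q p => extraConst q p (extraConst 2 q (M C₀ (K C₀) + 1)),
    fun γ C₀ h q p Q hQr hq1 hq2 hp1 hp2 _ f hf hfc z L => ?_⟩
  obtain ⟨P⟩ := h.nonempty_frame z L
  have ha : (0 : ℝ) < 2 ^ z := by positivity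
  have hb : (0 : ℝ) < 2 ^ (z + L) := by positivity
  set g := trunc γ f (2 ^ z) (2 ^ (z + L)) with hg
  have hgc : Continuous g := continuous_trunc h.cont hf hfc ha hb
  have hgs : HasCompactSupport g := hasCompactSupport_trunc h.cont hfc
  have hmem : ∀ {u : Plane → lp (fun _ : ℕ => ℂ) Q} (φ : lp (fun _ : ℕ => ℂ) Q → ℝ),
      Continuous u → HasCompactSupport u → Continuous φ → φ 0 = 0 →
      (fun x => φ (u x)) ∈ testFunctions := fun φ hu hus hφ h0 =>
    mem_testFunctions (hφ.comp hu) (hus.comp_left h0)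
  have hcn : ∀ n, Continuous fun v : lp (fun _ : ℕ => ℂ) Q => ‖lpCoord Q n v‖ := fun n =>
    (lpCoord Q n).continuous.norm
  have hn0 : ∀ n, ‖lpCoord Q n 0‖ = 0 := fun n => by rw [map_zero, norm_zero]
  have hs : ∀ v : lp (fun _ : ℕ => ℂ) Q, HasSum (fun n => ‖lpCoord Q n v‖ ^ q) (‖v‖ ^ q) :=
    fun v => by
      have := lp.hasSum_norm (p := Q) (by rw [hQr]; linarith) v
      rwa [hQr] at this
  refine integral_rpow_le_of_dominated (𝒜 := P.family) (K := K C₀) (N := M C₀ (K C₀) + 1)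
    (hK γ C₀ h z L P) (hK1 C₀) (by linarith [hM0 C₀ (K C₀)])
    (F := fun n => ⟨_, hmem _ hf hfc (hcn n) (hn0 n)⟩)
    (G := fun n => ⟨_, hmem _ hgc hgs (hcn n) (hn0 n)⟩)
    (a := ⟨_, hmem _ hf hfc continuous_norm norm_zero⟩)
    (b := ⟨_, hmem _ hgc hgs continuous_norm norm_zero⟩)
    (fun n x => norm_nonneg _) (fun n x => norm_nonneg _) (fun x => norm_nonneg _)
    (fun x => norm_nonneg _) hq1 hq2 hp1 hp2 (fun x => hs (f x)) (fun x => hs (g x)) ?_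
  intro n U V hU hV
  have hw := isWeight_ratioWeight hU.weight hV.weight
  have part : ∀ ψ : ℂ →L[ℝ] ℝ,
      ∫ x, ψ (lpCoord Q n (g x)) ^ 2 * ratioWeight U V x ≤
        (M C₀ (K C₀) + 1) * ∫ x, ψ (lpCoord Q n (f x)) ^ 2 * ratioWeight U V x := fun ψ => by
    set φ := ψ.comp (lpCoord Q n) with hφ
    set u : TestFn := ⟨_, hmem φ hf hfc φ.continuous (map_zero φ)⟩ with hu
    have h1 := hM γ C₀ h z L P (K C₀) U V (hK1 C₀) hU hV u
    have h2 : ∀ x, φ (g x) = (∑ j ∈ Finset.range L,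
        ((h.piece (z + j)).lin - (h.piece (z + j)).symm.lin) u) x := fun x => by
      rw [← h.trunc_eq_sum u (φ.continuous.comp hf) z L x, hg, map_trunc φ h.cont hf ha hb]
    have h3 : ∫ x, φ (g x) ^ 2 * ratioWeight U V x ≤
        M C₀ (K C₀) * ∫ x, φ (f x) ^ 2 * ratioWeight U V x := by
      simp only [h2]
      exact h1
    have h4 : 0 ≤ ∫ x, φ (f x) ^ 2 * ratioWeight U V x :=
      integral_nonneg fun x => mul_nonneg (sq_nonneg _) (hw.pos x).le
    change ∫ x, φ (g x) ^ 2 * ratioWeight U V x ≤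
      (M C₀ (K C₀) + 1) * ∫ x, φ (f x) ^ 2 * ratioWeight U V x
    linarith
  have split : ∀ u : Plane → lp (fun _ : ℕ => ℂ) Q, Continuous u → HasCompactSupport u →
      ∫ x, ‖lpCoord Q n (u x)‖ ^ 2 * ratioWeight U V x =
        (∫ x, Complex.reCLM (lpCoord Q n (u x)) ^ 2 * ratioWeight U V x) +
          ∫ x, Complex.imCLM (lpCoord Q n (u x)) ^ 2 * ratioWeight U V x := fun u hu hus => by
    have hi : ∀ ψ : ℂ →L[ℝ] ℝ,
        Integrable fun x => ψ (lpCoord Q n (u x)) ^ 2 * ratioWeight U V x := fun ψ =>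
      TestFn.integrable_sq_mul ⟨_, hmem (ψ.comp (lpCoord Q n)) hu hus
        (ψ.comp (lpCoord Q n)).continuous (map_zero _)⟩ hw.loc
    rw [← integral_add (hi _) (hi _)]
    refine integral_congr_ae (Eventually.of_forall fun x => ?_)
    simp only [Complex.reCLM_apply, Complex.imCLM_apply, Complex.sq_norm, Complex.normSq_apply]
    ring
  change ∫ x, ‖lpCoord Q n (g x)‖ ^ 2 * ratioWeight U V x ≤
    (M C₀ (K C₀) + 1) * ∫ x, ‖lpCoord Q n (f x)‖ ^ 2 * ratioWeight U V x
  rw [split g hgc hgs, split f hf hfc]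
  linarith [part Complex.reCLM, part Complex.imCLM]

section

lemma Curve.of_convexOn {γ : ℝ → ℝ} {C₀ : ℝ} (hcont : Continuous γ) (hodd : ∀ t, γ (-t) = -γ t)
    (hsmooth : ContDiffOn ℝ 2 γ (Set.Ici 0)) (hmono : StrictMonoOn γ (Set.Ici 0))
    (hconv : ConvexOn ℝ (Set.Ici 0) γ) (hC₀ : 0 < C₀)
    (hgrow : ∀ t : ℝ, 0 < t → deriv γ t ≤ C₀ * t * deriv (deriv γ) t) : Curve γ C₀ := by
  have h0 : γ 0 = 0 := by
    have := hodd 0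
    rw [neg_zero] at this
    linarith
  have hz : (0 : ℝ) ∈ Set.Ici (0 : ℝ) := Set.self_mem_Ici
  have hd : ∀ t, 0 < t → ContDiffAt ℝ 2 γ t := fun t ht =>
    hsmooth.contDiffAt (Ici_mem_nhds ht)
  have h1 : ∀ t, 0 < t → HasDerivAt γ (deriv γ t) t := fun t ht =>
    ((hd t ht).differentiableAt (by norm_num)).hasDerivAt
  refine ⟨hcont, hC₀, fun t ht => ?_, h1, fun t ht => ?_, hgrow, fun s t hs hst => ?_,
    fun t ht => ?_⟩
  · rw [← h0]
    exact hmono hz ht.le ht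
  · have h2 : ContDiffOn ℝ 1 (deriv γ) (Set.Ioi 0) :=
      ((contDiffOn_succ_iff_deriv_of_isOpen (n := 1) isOpen_Ioi).1
        (hsmooth.mono Set.Ioi_subset_Ici_self)).2.2
    exact ((h2.contDiffAt (Ioi_mem_nhds ht)).differentiableAt (by norm_num)).hasDerivAt
  · have ht := hs.trans_le hst
    have := hconv.secant_mono hz hs.le ht.le hs.ne' ht.ne' hst
    rw [h0, sub_zero, sub_zero, sub_zero, sub_zero, div_le_div_iff₀ hs ht] at this
    linarith
  · have := hconv.slope_le_of_hasDerivAt hz ht.le ht (h1 t ht)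
    rw [slope_def_field, h0, sub_zero, sub_zero, div_le_iff₀ ht] at this
    linarith

lemma eLpNorm_le_of_integral_norm_rpow_le {E : Type*} [NormedAddCommGroup E] {f g : Plane → E}
    (hf : Continuous f)
    (hfc : HasCompactSupport f) (hg : Continuous g) (hgc : HasCompactSupport g) {p M : ℝ}
    (hp : 0 < p) (hM : 0 ≤ M) (h : ∫ x, ‖g x‖ ^ p ≤ M * ∫ x, ‖f x‖ ^ p) :
    eLpNorm g (ENNReal.ofReal p) volume ≤
      ENNReal.ofReal (M ^ p⁻¹) * eLpNorm f (ENNReal.ofReal p) volume := by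
  have hp0 : ENNReal.ofReal p ≠ 0 := by simpa using hp
  rw [(hg.memLp_of_hasCompactSupport hgc).eLpNorm_eq_integral_rpow_norm hp0 ENNReal.ofReal_ne_top,
    (hf.memLp_of_hasCompactSupport hfc).eLpNorm_eq_integral_rpow_norm hp0 ENNReal.ofReal_ne_top,
    ← ENNReal.ofReal_mul (by positivity), ENNReal.toReal_ofReal hp.le,
    ← Real.mul_rpow hM (by positivity)]
  exact ENNReal.ofReal_le_ofReal (Real.rpow_le_rpow (by positivity) h (by positivity))

variable {E : Type*} [NormedAddCommGroup E] [NormedSpace ℝ E] {γ : ℝ → ℝ} {f : Plane → E}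

lemma setIntegral_abs_eq_trunc (hγ : Continuous γ) (hodd : ∀ t, γ (-t) = -γ t) (hf : Continuous f)
    {r : ℝ} (hr0 : 0 < r) (hr1 : r < 1) (x : Plane) :
    ∫ t in {t : ℝ | r ≤ |t| ∧ |t| ≤ r⁻¹}, t⁻¹ • f (x - (t, γ t)) = trunc γ f r r⁻¹ x := by
  have hr : r ≤ r⁻¹ := hr1.le.trans (one_le_inv₀ hr0 |>.2 hr1.le)
  have hs : {t : ℝ | r ≤ |t| ∧ |t| ≤ r⁻¹} = Set.Icc (-r⁻¹) (-r) ∪ Set.Icc r r⁻¹ := by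
    ext t
    simp only [Set.mem_ofPred_eq, Set.mem_union, Set.mem_Icc]
    constructor
    · rintro ⟨h1, h2⟩
      rcases le_abs.1 h1 with h | h
      · exact Or.inr ⟨h, (abs_le.1 h2).2⟩
      · exact Or.inl ⟨(abs_le.1 h2).1, by linarith⟩
    · rintro (⟨h1, h2⟩ | ⟨h1, h2⟩)
      · rw [abs_of_nonpos (by linarith)]
        exact ⟨by linarith, by linarith⟩
      · rw [abs_of_nonneg (by linarith)]
        exact ⟨h1, h2⟩
  have hc : ∀ s : Set ℝ, (∀ t ∈ s, t ≠ 0) →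
      ContinuousOn (fun t => t⁻¹ • f (x - (t, γ t))) s := fun s h =>
    (continuousOn_id.inv₀ h).smul (Continuous.continuousOn (by fun_prop))
  have hi : IntervalIntegrable (fun t => t⁻¹ • f (x - (t, γ t))) volume r r⁻¹ :=
    (hc _ fun t ht => (pos_of_mem_uIcc hr0 (inv_pos.2 hr0) ht).ne').intervalIntegrable
  have hi' : IntervalIntegrable (fun t => t⁻¹ • f (x + (t, γ t))) volume r r⁻¹ :=
    ((continuousOn_id.inv₀ fun t ht => (pos_of_mem_uIcc hr0 (inv_pos.2 hr0) ht).ne').smul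
      (Continuous.continuousOn (by fun_prop))).intervalIntegrable
  have e1 : ∫ t in Set.Icc (-r⁻¹) (-r), t⁻¹ • f (x - (t, γ t)) =
      -∫ t in r..r⁻¹, t⁻¹ • f (x + (t, γ t)) := by
    rw [integral_Icc_eq_integral_Ioc, ← intervalIntegral.integral_of_le (neg_le_neg hr),
      ← intervalIntegral.integral_comp_neg, ← intervalIntegral.integral_neg]
    refine intervalIntegral.integral_congr fun t _ => ?_
    simp only [hodd, inv_neg, neg_smul]
    rw [← Prod.neg_mk, sub_neg_eq_add]
  rw [hs, setIntegral_union, e1, integral_Icc_eq_integral_Ioc, ← intervalIntegral.integral_of_le hr,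
    neg_add_eq_sub, ← intervalIntegral.integral_sub hi hi', trunc]
  · simp only [smul_sub]
  · rw [Set.disjoint_left]
    intro t h1 h2
    linarith [h1.2, h2.1]
  · exact measurableSet_Icc
  · exact (hc _ fun t ht => by linarith [ht.2]).integrableOn_compact isCompact_Icc
  · exact (hc _ fun t ht => by linarith [ht.1]).integrableOn_compact isCompact_Icc

lemma integrableOn_symm_diff (hγ : Continuous γ) (h0 : ∀ t, 0 < t → 0 ≤ γ t)
    (hslope : ∀ s t, 0 < s → s ≤ t → γ s * t ≤ s * γ t) {C : NNReal} (hL : LipschitzWith C f)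
    (hfc : HasCompactSupport f) (x : Plane) :
    IntegrableOn (fun t => t⁻¹ • (f (x - (t, γ t)) - f (x + (t, γ t)))) (Set.Ioi 0) := by
  have hf := hL.continuous
  obtain ⟨R, hR⟩ := hfc.isCompact.isBounded.exists_norm_le
  have hz : ∀ y : Plane, R < ‖y‖ → f y = 0 := fun y hy => by
    by_contra h
    exact hy.not_ge (hR y (subset_tsupport f h))
  have hc : ∀ s : Set ℝ, (∀ t ∈ s, 0 < t) →
      ContinuousOn (fun t => t⁻¹ • (f (x - (t, γ t)) - f (x + (t, γ t)))) s := fun s h =>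
    (continuousOn_id.inv₀ fun t ht => (h t ht).ne').smul (Continuous.continuousOn (by fun_prop))
  set S := max 1 (R + ‖x‖) with hS
  have hS1 : 1 ≤ S := le_max_left _ _
  have e : Set.Ioi (0 : ℝ) = Set.Ioc 0 1 ∪ (Set.Icc 1 S ∪ Set.Ioi S) := by
    ext t
    simp only [Set.mem_Ioi, Set.mem_union, Set.mem_Ioc, Set.mem_Icc]
    constructor
    · intro ht
      rcases le_or_gt t 1 with h | h
      · exact Or.inl ⟨ht, h⟩
      · rcases le_or_gt t S with h' | h'
        · exact Or.inr (Or.inl ⟨h.le, h'⟩)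
        · exact Or.inr (Or.inr h')
    · rintro (h | h | h)
      · exact h.1
      · linarith [h.1]
      · linarith
  rw [e]
  refine IntegrableOn.union ?_ (IntegrableOn.union ?_ ?_)
  · refine IntegrableOn.of_bound (C := C * (2 * max 1 (γ 1))) (by simp)
      ((hc _ fun t ht => ht.1).aestronglyMeasurable measurableSet_Ioc) ?_
    refine (ae_restrict_iff' measurableSet_Ioc).2 (Eventually.of_forall fun t ht => ?_)
    have h1 : ‖((t, γ t) : Plane)‖ ≤ t * max 1 (γ 1) := by
      have h2 := hslope t 1 ht.1 ht.2
      rw [mul_one] at h2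
      rw [Prod.norm_mk, Real.norm_of_nonneg ht.1.le, Real.norm_of_nonneg (h0 t ht.1)]
      exact max_le (le_mul_of_one_le_right ht.1.le (le_max_left _ _))
        (h2.trans (mul_le_mul_of_nonneg_left (le_max_right _ _) ht.1.le))
    have h3 := hL.norm_sub_le (x - (t, γ t)) (x + (t, γ t))
    have h4 : ‖(x - (t, γ t)) - (x + (t, γ t))‖ ≤ 2 * (t * max 1 (γ 1)) := by
      have : (x - (t, γ t)) - (x + (t, γ t)) = -((t, γ t) + (t, γ t)) := by abel
      rw [this, norm_neg]
      linarith [norm_add_le ((t, γ t) : Plane) (t, γ t)]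
    rw [norm_smul, norm_inv, Real.norm_of_nonneg ht.1.le, inv_mul_le_iff₀ ht.1]
    have := mul_le_mul_of_nonneg_left h4 C.coe_nonneg
    linarith
  · exact (hc _ fun t ht => by linarith [ht.1]).integrableOn_compact isCompact_Icc
  · refine IntegrableOn.congr_fun (f := fun _ => (0 : E)) integrableOn_zero (fun t ht => ?_)
      measurableSet_Ioi
    have ht' : S < t := ht
    have h1 : R + ‖x‖ < ‖((t, γ t) : Plane)‖ := by
      have : t ≤ ‖((t, γ t) : Plane)‖ := (le_abs_self t).trans (norm_fst_le ((t, γ t) : Plane))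
      linarith [le_max_right 1 (R + ‖x‖)]
    have h2 : R < ‖x - (t, γ t)‖ := by
      have := norm_sub_norm_le ((t, γ t) : Plane) x
      rw [norm_sub_rev] at this
      linarith
    have h3 : R < ‖x + (t, γ t)‖ := by
      have := norm_sub_norm_le ((t, γ t) : Plane) (-x)
      rw [sub_neg_eq_add, norm_neg, add_comm _ x] at this
      linarith
    simp only [hz _ h2, hz _ h3, sub_self, smul_zero]

lemma aecover_Icc_inv : AECover (volume.restrict (Set.Ioi (0 : ℝ))) (𝓝[>] (0 : ℝ))
    fun r : ℝ => Set.Icc r r⁻¹ where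
  ae_eventually_mem := by
    refine (ae_restrict_iff' measurableSet_Ioi).2 (Eventually.of_forall fun t ht => ?_)
    have h1 : ∀ᶠ r : ℝ in 𝓝[>] 0, r < t := nhdsWithin_le_nhds (Iio_mem_nhds ht)
    have h2 : ∀ᶠ r : ℝ in 𝓝[>] 0, t < r⁻¹ := tendsto_inv_nhdsGT_zero.eventually_gt_atTop t
    filter_upwards [h1, h2] with r hr hr'
    exact ⟨hr.le, hr'.le⟩
  measurableSet _ := measurableSet_Icc

lemma tendsto_trunc (hγ : Continuous γ) (h0 : ∀ t, 0 < t → 0 ≤ γ t)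
    (hslope : ∀ s t, 0 < s → s ≤ t → γ s * t ≤ s * γ t) {C : NNReal} (hL : LipschitzWith C f)
    (hfc : HasCompactSupport f) (x : Plane) :
    Tendsto (fun r => trunc γ f r r⁻¹ x) (𝓝[>] 0)
      (𝓝 (∫ t in Set.Ioi 0, t⁻¹ • (f (x - (t, γ t)) - f (x + (t, γ t))))) := by
  refine (aecover_Icc_inv.integral_tendsto_of_countably_generated
    (integrableOn_symm_diff hγ h0 hslope hL hfc x)).congr' ?_
  have h1 : ∀ᶠ r : ℝ in 𝓝[>] 0, r < 1 := nhdsWithin_le_nhds (Iio_mem_nhds one_pos)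
  filter_upwards [h1, self_mem_nhdsWithin] with r hr hr0
  have hr0' : 0 < r := hr0
  have hr' : r ≤ r⁻¹ := hr.le.trans (one_le_inv₀ hr0' |>.2 hr.le)
  rw [Measure.restrict_restrict measurableSet_Icc, Set.inter_eq_left.2, trunc,
    intervalIntegral.integral_of_le hr', integral_Icc_eq_integral_Ioc]
  exact fun t ht => hr0'.trans_le ht.1

end

end ConvexCurve

/-- for `5/3 < q < 5/2` and `5/3 < p < 5/2`, the Hilbert transform along the
plane curve `Γ(t) = (t, γ(t))` is bounded on `L^p(ℝ²; ℓ^q)`. -/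
theorem hilbert_transform_convex_curve_lq_bounded
    (γ : ℝ → ℝ) (hcont : Continuous γ) (hodd : ∀ t, γ (-t) = -γ t)
    (hsmooth : ContDiffOn ℝ 2 γ (Set.Ici 0))
    (hmono : StrictMonoOn γ (Set.Ici 0)) (hconv : ConvexOn ℝ (Set.Ici 0) γ)
    (h2mono : MonotoneOn (deriv (deriv γ)) (Set.Ioi 0) ∨
      AntitoneOn (deriv (deriv γ)) (Set.Ioi 0))
    (C₀ : ℝ) (hC₀ : 0 < C₀)
    (hgrow : ∀ t : ℝ, 0 < t → deriv γ t ≤ C₀ * t * deriv (deriv γ) t)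
    (q : ℝ) (hq1 : 5/3 < q) (hq2 : q < 5/2)
    (p : ℝ) (hp1 : 5/3 < p) (hp2 : p < 5/2)
    [Fact (1 ≤ ENNReal.ofReal q)] :
    ∃ C : ℝ, 0 < C ∧ ∀ f : ℝ × ℝ → lp (fun _ : ℕ => ℂ) (ENNReal.ofReal q),
      ContDiff ℝ (⊤ : ℕ∞) f → HasCompactSupport f →
      ∃ Hf : ℝ × ℝ → lp (fun _ : ℕ => ℂ) (ENNReal.ofReal q),
        (∀ x, Tendsto (fun r : ℝ => ∫ t in {t : ℝ | r ≤ |t| ∧ |t| ≤ r⁻¹},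
            t⁻¹ • f (x - (t, γ t))) (𝓝[>] 0) (𝓝 (Hf x))) ∧
        eLpNorm Hf (ENNReal.ofReal p) volume ≤
          ENNReal.ofReal C * eLpNorm f (ENNReal.ofReal p) volume := by
  have hγ := ConvexCurve.Curve.of_convexOn hcont hodd hsmooth hmono hconv hC₀ hgrow
  obtain ⟨M, hM⟩ := ConvexCurve.integral_norm_trunc_rpow_le
  refine ⟨max (M C₀ q p) 1 ^ p⁻¹, Real.rpow_pos_of_pos (by positivity) _, fun f hf hfc => ?_⟩
  obtain ⟨K, hK⟩ := hf.lipschitzWith_of_hasCompactSupport hfc (by simp)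
  have hlim := ConvexCurve.tendsto_trunc hcont (fun t ht => (hγ.pos t ht).le) hγ.slope hK hfc
  refine ⟨_, fun x => (hlim x).congr' ?_, ?_⟩
  · have h1 : ∀ᶠ r : ℝ in 𝓝[>] 0, r < 1 := nhdsWithin_le_nhds (Iio_mem_nhds one_pos)
    filter_upwards [h1, self_mem_nhdsWithin] with r hr hr0
    exact (ConvexCurve.setIntegral_abs_eq_trunc hcont hodd hf.continuous hr0 hr x).symm
  have hz : ∀ N : ℕ, (2 : ℝ) ^ (-(N : ℤ) + (2 * N : ℕ)) = ((1 / 2 : ℝ) ^ N)⁻¹ := fun N => by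
    rw [one_div, inv_pow, inv_inv, ← zpow_natCast]
    congr 1
    push_cast
    ring
  have hz' : ∀ N : ℕ, (2 : ℝ) ^ (-(N : ℤ)) = (1 / 2 : ℝ) ^ N := fun N => by
    rw [zpow_neg, zpow_natCast, one_div, inv_pow]
  have hpow : Tendsto (fun N : ℕ => (1 / 2 : ℝ) ^ N) atTop (𝓝[>] 0) :=
    tendsto_nhdsWithin_iff.2 ⟨tendsto_pow_atTop_nhds_zero_of_lt_one (by norm_num) (by norm_num),
      Eventually.of_forall fun N => Set.mem_Ioi.2 (by positivity)⟩
  have hc : ∀ N : ℕ, Continuous (ConvexCurve.trunc γ f ((1 / 2) ^ N) ((1 / 2) ^ N)⁻¹) := fun N =>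
    ConvexCurve.continuous_trunc hcont hf.continuous hfc (by positivity) (by positivity)
  refine Lp.eLpNorm_le_of_ae_tendsto (u := atTop) (Eventually.of_forall fun N : ℕ => ?_)
    (fun N => (hc N).aestronglyMeasurable) (Eventually.of_forall fun x => (hlim x).comp hpow)
  refine ConvexCurve.eLpNorm_le_of_integral_norm_rpow_le hf.continuous hfc (hc N)
    (ConvexCurve.hasCompactSupport_trunc hcont hfc) (by linarith) (by positivity) ?_
  have h1 := hM γ C₀ hγ q p _ (ENNReal.toReal_ofReal (by linarith)) hq1 hq2 hp1 hp2 f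
    hf.continuous hfc (-N) (2 * N)
  rw [hz, hz'] at h1
  exact h1.trans (mul_le_mul_of_nonneg_right (le_max_left _ _) (by positivity))
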